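/- arXiv:1808.09358 — 2 statements merged into one kernel-verified Lean document; each statement's English description precedes it below -/
import Mathlib

section
/- Suppose d ≥ 2 is even. Then: (i) for every Φ ∈ 𝒮(ℂ^d) there exists Φ₂ ∈ 𝒮(ℂ²) such that, setting h(ξ) = ∫_{ℂ∖{0}} Φ₂(a, ξ/a) |a|^{d−4} da (an integral converging absolutely for every ξ ≠ 0 and defining a locally integrable function on ℂ), one has ∫_{ℂ^d} g(q_d(z)) Φ(z) dz = ∫_ℂ g(ξ) h(ξ) dξ for every continuous compactly supported g : ℂ → ℂ; and (ii) conversely, for every Φ₂ ∈ 𝒮(ℂ²) there exists Φ ∈ 𝒮(ℂ^d) for which the same identity holds. -/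
open MeasureTheory Filter

noncomputable section

/-- Extension of a vector in `ℂ^d` by zeros, for convenient indexing. -/
def padC {d : ℕ} (z : Fin d → ℂ) (n : ℕ) : ℂ :=
  if h : n < d then z ⟨n, h⟩ else 0

/-- The split quadratic form `q_d` on `ℂ^d`:
`z₁z₂ + z₃z₄ + ⋯ + z_{d−1}z_d` for `d` even, and
`z₁² + z₂z₃ + ⋯ + z_{d−1}z_d` for `d` odd. -/
def splitQC (d : ℕ) (z : Fin d → ℂ) : ℂ :=
  if Even d then ∑ i ∈ Finset.range (d / 2), padC z (2 * i) * padC z (2 * i + 1)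
  else padC z 0 ^ 2 + ∑ i ∈ Finset.range (d / 2), padC z (2 * i + 1) * padC z (2 * i + 2)

/-- The twisted pushforward
`h(ξ) = ∫_{ℂ∖{0}} Φ₂(a, ξ/a) |a|^{d−4} da`. -/
def hTwoC (d : ℕ) (Φ₂ : SchwartzMap (ℂ × ℂ) ℂ) (ξ : ℂ) : ℂ :=
  ∫ a in ({0}ᶜ : Set ℂ), Φ₂ (a, ξ / a) * ((‖a‖ ^ ((d : ℝ) - 4) : ℝ) : ℂ)

open scoped ContDiff SchwartzMap Topology

/-- Parameter integrals of uniformly Schwartz families are Schwartz. -/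
theorem aux_exists_schwartz_integral {P V E : Type*} [MeasurableSpace P] (μ : Measure P)
    [NormedAddCommGroup V] [NormedSpace ℝ V] [NormedAddCommGroup E] [NormedSpace ℝ E]
    [CompleteSpace E]
    (f : P → V → E) (hf : ∀ p, ContDiff ℝ ∞ (f p))
    (hm : ∀ n v, AEStronglyMeasurable (fun p => iteratedFDeriv ℝ n (f p) v) μ)
    (b : ℕ → ℕ → P → ℝ) (hb : ∀ k n, Integrable (b k n) μ)
    (hbd : ∀ k n p v, ‖v‖ ^ k * ‖iteratedFDeriv ℝ n (f p) v‖ ≤ b k n p) :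
    ∃ F : 𝓢(V, E), ∀ v, F v = ∫ p, f p v ∂μ := by
  have hIntg : ∀ n v, Integrable (fun p => iteratedFDeriv ℝ n (f p) v) μ := fun n v =>
    (hb 0 n).mono' (hm n v) (ae_of_all _ fun p => by simpa using hbd 0 n p v)
  have hT : HasFTaylorSeriesUpTo ((⊤ : ℕ∞) : WithTop ℕ∞) (fun v => ∫ p, f p v ∂μ)
      (fun v n => ∫ p, iteratedFDeriv ℝ n (f p) v ∂μ) := by
    have key : ∀ (n : ℕ) (v : V), HasFDerivAt (fun v => ∫ p, iteratedFDeriv ℝ n (f p) v ∂μ)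
        ((∫ p, iteratedFDeriv ℝ (n + 1) (f p) v ∂μ).curryLeft) v := by
      intro n v
      have hd : ∀ p w, HasFDerivAt (iteratedFDeriv ℝ n (f p))
          ((iteratedFDeriv ℝ (n + 1) (f p) w).curryLeft) w := by
        intro p w
        have h1 : DifferentiableAt ℝ (iteratedFDeriv ℝ n (f p)) w :=
          ((hf p).differentiable_iteratedFDeriv (by exact_mod_cast ENat.natCast_lt_top n)) w
        have := h1.hasFDerivAt
        rwa [fderiv_iteratedFDeriv] at this
      have h2 := hasFDerivAt_integral_of_dominated_of_fderiv_le (𝕜 := ℝ) (μ := μ)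
        (F := fun v p => iteratedFDeriv ℝ n (f p) v)
        (F' := fun v p => (iteratedFDeriv ℝ (n + 1) (f p) v).curryLeft) (x₀ := v)
        (s := Set.univ) (bound := b 0 (n + 1)) univ_mem
        (Eventually.of_forall fun x => hm n x) (hIntg n v)
        ((continuousMultilinearCurryLeftEquiv ℝ (fun _ : Fin (n + 1) => V) E).continuous.comp_aestronglyMeasurable
          (hm (n + 1) v))
        (ae_of_all _ fun p x _ => by
          rw [ContinuousMultilinearMap.curryLeft_norm]
          simpa using hbd 0 (n + 1) p x)
        (hb 0 (n + 1)) (ae_of_all _ fun p x _ => hd p x)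
      have hIntg' := Integrable.mono' (β := V →L[ℝ] (V [×n]→L[ℝ] E))
        (f := fun p => (iteratedFDeriv ℝ (n + 1) (f p) v).curryLeft) (hb 0 (n + 1))
        ((continuousMultilinearCurryLeftEquiv ℝ
          (fun _ : Fin (n + 1) => V) E).continuous.comp_aestronglyMeasurable
          (hm (n + 1) v)) (ae_of_all _ fun p => by
            rw [ContinuousMultilinearMap.curryLeft_norm]
            simpa using hbd 0 (n + 1) p v)
      have heq : (∫ p, iteratedFDeriv ℝ (n + 1) (f p) v ∂μ).curryLeft =
          ∫ p, (iteratedFDeriv ℝ (n + 1) (f p) v).curryLeft ∂μ := by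
        ext w m
        rw [ContinuousLinearMap.integral_apply hIntg', ContinuousMultilinearMap.integral_apply
          (hIntg'.apply_continuousLinearMap w)]
        rw [ContinuousMultilinearMap.curryLeft_apply, ContinuousMultilinearMap.integral_apply
          (hIntg (n + 1) v)]
        rfl
      rw [heq]
      exact h2
    constructor
    · intro v
      simp only [ContinuousMultilinearMap.curry0]
      rw [ContinuousMultilinearMap.integral_apply (hIntg 0 v)]
      simp
    · intro n _ v
      exact key n v
    · intro n _
      exact continuous_iff_continuousAt.2 fun v => (key n v).continuousAt
  refine ⟨⟨fun v => ∫ p, f p v ∂μ, hT.contDiff, ?_⟩, fun v => rfl⟩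
  intro k n
  refine ⟨∫ p, b k n p ∂μ, fun v => ?_⟩
  rw [← hT.eq_iteratedFDeriv (by exact_mod_cast le_top)]
  rw [← norm_smul_of_nonneg (by positivity : (0:ℝ) ≤ ‖v‖ ^ k), ← integral_smul]
  refine norm_integral_le_of_norm_le (hb k n) (ae_of_all _ fun p => ?_)
  rw [norm_smul_of_nonneg (by positivity)]
  exact hbd k n p v

theorem aux_schwartz_bound {V E : Type*} [NormedAddCommGroup V] [NormedSpace ℝ V]
    [NormedAddCommGroup E] [NormedSpace ℝ E] (f : 𝓢(V, E)) (k n : ℕ) :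
    ∃ C, 0 ≤ C ∧ ∀ x, (1 + ‖x‖) ^ k * ‖iteratedFDeriv ℝ n f x‖ ≤ C := by
  refine ⟨2 ^ k * ((Finset.Iic (k, n)).sup (schwartzSeminormFamily ℝ V E)) f, by positivity, 
    fun x => SchwartzMap.one_add_le_sup_seminorm_apply (m := (k, n)) le_rfl le_rfl f x⟩

theorem aux_norm_iter_comp {V W E : Type*} [NormedAddCommGroup V] [NormedSpace ℝ V]
    [NormedAddCommGroup W] [NormedSpace ℝ W]
    [NormedAddCommGroup E] [NormedSpace ℝ E] {f : W → E} (hf : ContDiff ℝ ∞ f)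
    (L : V →L[ℝ] W) (n : ℕ) (v : V) :
    ‖iteratedFDeriv ℝ n (fun v => f (L v)) v‖ ≤ ‖iteratedFDeriv ℝ n f (L v)‖ * ‖L‖ ^ n := by
  have := L.iteratedFDeriv_comp_right hf v (i := n) (by exact_mod_cast le_top)
  change ‖iteratedFDeriv ℝ n (f ∘ L) v‖ ≤ _
  rw [this]
  refine (ContinuousMultilinearMap.norm_compContinuousLinearMap_le _ _).trans ?_
  simp

theorem aux_tensor {V W : Type*} [NormedAddCommGroup V] [NormedSpace ℝ V]
    [NormedAddCommGroup W] [NormedSpace ℝ W] (f : 𝓢(V, ℂ)) (g : 𝓢(W, ℂ)) :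
    ∃ F : 𝓢(V × W, ℂ), ∀ v w, F (v, w) = f v * g w := by
  have hfs : ContDiff ℝ ∞ (fun p : V × W => f p.1) := (f.smooth ⊤).comp contDiff_fst
  have hgs : ContDiff ℝ ∞ (fun p : V × W => g p.2) := (g.smooth ⊤).comp contDiff_snd
  refine ⟨⟨fun p => f p.1 * g p.2, hfs.mul hgs, ?_⟩, fun v w => rfl⟩
  intro k n
  choose Cf hCf0 hCf using fun i => aux_schwartz_bound f k i
  choose Cg hCg0 hCg using fun i => aux_schwartz_bound g k i
  refine ⟨∑ i ∈ Finset.range (n + 1), (n.choose i : ℝ) * (Cf i * Cg (n - i)), fun p => ?_⟩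
  have h1 := norm_iteratedFDeriv_mul_le hfs hgs p (n := n) (by exact_mod_cast le_top)
  have hp : ‖p‖ ^ k ≤ (1 + ‖p.1‖) ^ k * (1 + ‖p.2‖) ^ k := by
    rw [← mul_pow]
    refine pow_le_pow_left₀ (norm_nonneg _) ?_ _
    rw [Prod.norm_def]
    refine max_le ?_ ?_ <;> nlinarith [norm_nonneg p.1, norm_nonneg p.2, mul_nonneg (norm_nonneg p.1) (norm_nonneg p.2)]
  refine (mul_le_mul_of_nonneg_left h1 (by positivity)).trans ?_
  rw [Finset.mul_sum]
  refine Finset.sum_le_sum fun i _ => ?_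
  have hA : ‖iteratedFDeriv ℝ i (fun p : V × W => f p.1) p‖ ≤ ‖iteratedFDeriv ℝ i f p.1‖ := by
    refine (aux_norm_iter_comp (f.smooth ⊤) (ContinuousLinearMap.fst ℝ V W) i p).trans ?_
    exact mul_le_of_le_one_right (norm_nonneg _)
      (pow_le_one₀ (norm_nonneg _) (ContinuousLinearMap.norm_fst_le ..))
  have hB : ‖iteratedFDeriv ℝ (n - i) (fun p : V × W => g p.2) p‖ ≤
      ‖iteratedFDeriv ℝ (n - i) g p.2‖ := by
    refine (aux_norm_iter_comp (g.smooth ⊤) (ContinuousLinearMap.snd ℝ V W) (n - i) p).trans ?_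
    exact mul_le_of_le_one_right (norm_nonneg _)
      (pow_le_one₀ (norm_nonneg _) (ContinuousLinearMap.norm_snd_le ..))
  calc _ ≤ ((1 + ‖p.1‖) ^ k * (1 + ‖p.2‖) ^ k) * ((n.choose i : ℝ) *
        ‖iteratedFDeriv ℝ i f p.1‖ * ‖iteratedFDeriv ℝ (n - i) g p.2‖) := by gcongr
    _ = (n.choose i : ℝ) * (((1 + ‖p.1‖) ^ k * ‖iteratedFDeriv ℝ i f p.1‖) *
        ((1 + ‖p.2‖) ^ k * ‖iteratedFDeriv ℝ (n - i) g p.2‖)) := by ring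
    _ ≤ _ := by
      gcongr
      · exact hCf0 i
      · exact hCf i _
      · exact hCg _ _

/-- Gaussians are Schwartz. -/
theorem aux_gauss {V : Type*} [NormedAddCommGroup V] [NormedSpace ℝ V] (p : V → ℝ)
    (hp : p.HasTemperateGrowth) (hlow : ∀ x, ‖x‖ ^ 2 ≤ p x) :
    ∃ F : 𝓢(V, ℂ), ∀ v, F v = ((Real.exp (-p v) : ℝ) : ℂ) := by
  have hg : ContDiff ℝ ∞ (fun t : ℝ => Real.exp (-t)) := by fun_prop
  have hsm : ContDiff ℝ ∞ (fun v => Real.exp (-p v)) := hg.comp hp.1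
  suffices h : ∃ F : 𝓢(V, ℝ), ∀ v, F v = Real.exp (-p v) by
    obtain ⟨F, hF⟩ := h
    refine ⟨F.postcompCLM (𝕜 := ℝ) Complex.ofRealCLM, fun v => ?_⟩
    simp [hF]
  refine ⟨⟨fun v => Real.exp (-p v), hsm, ?_⟩, fun v => rfl⟩
  intro k n
  obtain ⟨l, C, hC0, hC⟩ := hp.norm_iteratedFDeriv_le_uniform n
  have hder : ∀ i t, ‖iteratedFDeriv ℝ i (fun t : ℝ => Real.exp (-t)) t‖ = Real.exp (-t) := by
    intro i t
    rw [norm_iteratedFDeriv_eq_norm_iteratedDeriv]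
    have := iteratedDeriv_comp_neg i Real.exp t
    rw [this]
    simp [iteratedDeriv_eq_iterate, Real.iter_deriv_exp]
  -- polynomial times gaussian bounded
  obtain ⟨M, hM⟩ : ∃ M : ℝ, ∀ r : ℝ, 0 ≤ r → (1 + r) ^ (k + l * n) * Real.exp (-r ^ 2) ≤ M := by
    set N := k + l * n
    refine ⟨N.factorial * Real.exp 2, fun r hr => ?_⟩
    have h1 : (1 + r) ^ N / N.factorial ≤ Real.exp (1 + r) := Real.pow_div_factorial_le_exp _ (by positivity) N
    rw [div_le_iff₀ (by positivity)] at h1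
    calc _ ≤ (Real.exp (1 + r) * N.factorial) * Real.exp (-r ^ 2) := by gcongr
      _ = N.factorial * Real.exp (1 + r - r ^ 2) := by
        rw [show 1 + r - r ^ 2 = (1 + r) + (-r ^ 2) by ring, Real.exp_add (1 + r)]; ring
      _ ≤ _ := by
        gcongr
        nlinarith [sq_nonneg (r - 1)]
  refine ⟨n.factorial * (C + 1) ^ n * M, fun x => ?_⟩
  have h1 := norm_iteratedFDeriv_comp_le hg hp.1 (n := n) (by exact_mod_cast le_top) x
    (C := Real.exp (-p x)) (D := (C + 1) * (1 + ‖x‖) ^ l) (fun i _ => (hder i _).le)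
    (fun i hi hin => (hC i hin x).trans (by
      have h1 : (1:ℝ) ≤ (1 + ‖x‖) ^ l := one_le_pow₀ (by simp)
      have : 1 ≤ (C + 1) * (1 + ‖x‖) ^ l := by nlinarith
      refine le_trans ?_ (le_self_pow₀ this (by omega))
      nlinarith))
  change ‖x‖ ^ k * ‖iteratedFDeriv ℝ n ((fun t : ℝ => Real.exp (-t)) ∘ p) x‖ ≤ _
  calc _ ≤ (1 + ‖x‖) ^ k * (n.factorial * Real.exp (-‖x‖ ^ 2) * ((C + 1) * (1 + ‖x‖) ^ l) ^ n) := by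
        refine mul_le_mul ?_ (h1.trans ?_) (norm_nonneg _) (by positivity)
        · gcongr; simp
        · gcongr
          simpa using hlow x
    _ = n.factorial * (C + 1) ^ n * ((1 + ‖x‖) ^ (k + l * n) * Real.exp (-‖x‖ ^ 2)) := by
        rw [mul_pow, pow_add, pow_mul]; ring
    _ ≤ _ := by
        gcongr
        exact hM _ (norm_nonneg _)

section scaling
variable {V : Type*} [NormedAddCommGroup V] [NormedSpace ℂ V] [FiniteDimensional ℂ V]
  [MeasurableSpace V] [BorelSpace V]

theorem aux_map_smul (μ : Measure V) [μ.IsAddHaarMeasure] {a : ℂ} (ha : a ≠ 0) :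
    Measure.map (fun x : V => a • x) μ =
      ENNReal.ofReal ((‖a‖ ^ (2 * Module.finrank ℂ V))⁻¹) • μ := by
  let _ : NormedSpace ℝ V := NormedSpace.restrictScalars ℝ ℂ V
  have : FiniteDimensional ℝ V := FiniteDimensional.complexToReal V
  let f : V →ₗ[ℝ] V := (LinearMap.lsmul ℂ V a).restrictScalars ℝ
  have hdet : LinearMap.det f = ‖a‖ ^ (2 * Module.finrank ℂ V) := by
    rw [show f = (LinearMap.lsmul ℂ V a).restrictScalars ℝ from rfl,
      LinearMap.det_restrictScalars, Algebra.norm_complex_apply,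
      show LinearMap.lsmul ℂ V a = a • LinearMap.id from rfl, LinearMap.det_smul,
      LinearMap.det_id, mul_one, Complex.normSq_eq_norm_sq, norm_pow, ← pow_mul, mul_comm]
  have h0 : LinearMap.det f ≠ 0 := by
    rw [hdet]; exact pow_ne_zero _ (norm_ne_zero_iff.2 ha)
  have := Measure.map_linearMap_addHaar_eq_smul_addHaar (μ := μ) h0
  rw [hdet, abs_of_nonneg (by positivity)] at this
  exact this

theorem aux_integral_smul (μ : Measure V) [μ.IsAddHaarMeasure] {a : ℂ} (ha : a ≠ 0)
    {E : Type*} [NormedAddCommGroup E] [NormedSpace ℝ E] (f : V → E) :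
    ∫ x, f x ∂μ = (‖a‖ ^ (2 * Module.finrank ℂ V)) • ∫ x, f (a • x) ∂μ := by
  have hemb : MeasurableEmbedding (fun x : V => a • x) :=
    (Homeomorph.smulOfNeZero a ha).measurableEmbedding
  rw [← hemb.integral_map (g := f), aux_map_smul μ ha, integral_smul_measure,
    ENNReal.toReal_ofReal (by positivity), smul_smul, mul_inv_cancel₀, one_smul]
  exact pow_ne_zero _ (norm_ne_zero_iff.2 ha)

theorem aux_integrable_smul (μ : Measure V) [μ.IsAddHaarMeasure] {a : ℂ} (ha : a ≠ 0)
    {E : Type*} [NormedAddCommGroup E] (f : V → E) :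
    Integrable (fun x => f (a • x)) μ ↔ Integrable f μ := by
  have hemb : MeasurableEmbedding (fun x : V => a • x) :=
    (Homeomorph.smulOfNeZero a ha).measurableEmbedding
  have := hemb.integrable_map_iff (μ := μ) (g := f)
  rw [aux_map_smul μ ha, integrable_smul_measure] at this
  · exact this.symm
  · have h0 := norm_pos_iff.2 ha
    have : 0 < ‖a‖ ^ (2 * Module.finrank ℂ V) := by positivity
    simpa using this
  · exact ENNReal.ofReal_ne_top
end scaling

theorem aux_weight (k : ℕ) {a : ℂ} (ha : a ≠ 0) :
    ‖a‖ ^ (((2 * (k + 1) : ℕ) : ℝ) - 4) * ‖a‖ ^ 2 = ‖a‖ ^ (2 * k) := by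
  have h : 0 < ‖a‖ := norm_pos_iff.2 ha
  rw [← Real.rpow_natCast, ← Real.rpow_natCast, ← Real.rpow_add h]
  congr 1
  push_cast
  ring

theorem aux_int_weight (k : ℕ) (Φ : 𝓢(ℂ × ℂ, ℂ)) :
    Integrable (fun p : ℂ × ℂ => Φ p * ((‖p.1‖ ^ (2 * k) : ℝ) : ℂ)) := by
  have : (volume : Measure (ℂ × ℂ)).IsAddHaarMeasure :=
    inferInstanceAs ((volume : Measure ℂ).prod (volume : Measure ℂ)).IsAddHaarMeasure
  refine (Φ.integrable_pow_mul volume (2 * k)).mono' ?_ (ae_of_all _ fun p => ?_)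
  · exact (by fun_prop : Continuous _).aestronglyMeasurable
  · rw [norm_mul, Complex.norm_real, norm_pow, norm_norm, mul_comm]
    gcongr
    exact norm_fst_le p

theorem aux_H_integrable (k : ℕ) (Φ : 𝓢(ℂ × ℂ, ℂ)) :
    Integrable (fun p : ℂ × ℂ => Φ (p.1, p.2 / p.1) *
      ((‖p.1‖ ^ (((2 * (k + 1) : ℕ) : ℝ) - 4) : ℝ) : ℂ)) := by
  have hI := aux_int_weight k Φ
  have hmeas : Measurable (fun p : ℂ × ℂ => Φ (p.1, p.2 / p.1) *
      ((‖p.1‖ ^ (((2 * (k + 1) : ℕ) : ℝ) - 4) : ℝ) : ℂ)) := by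
    refine (Φ.continuous.measurable.comp (by fun_prop)).mul ?_
    exact Complex.measurable_ofReal.comp (by fun_prop)
  have h0 : ∀ᵐ a : ℂ, a ≠ 0 := by simp [ae_iff]
  rw [Measure.volume_eq_prod] at hI ⊢
  rw [integrable_prod_iff hmeas.aestronglyMeasurable]
  constructor
  · filter_upwards [hI.prod_right_ae, h0] with a hi ha
    rw [← aux_integrable_smul volume ha]
    have hc : ((‖a‖ ^ 2 : ℝ) : ℂ) ≠ 0 := by simpa using ha
    rw [← integrable_mul_const_iff (isUnit_iff_ne_zero.2 hc)]
    refine hi.congr (ae_of_all _ fun b => ?_)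
    simp only [smul_eq_mul]
    rw [mul_div_cancel_left₀ _ ha, mul_assoc, ← Complex.ofReal_mul, aux_weight k ha]
  · refine hI.norm.integral_prod_left.congr ?_
    filter_upwards [h0] with a ha
    rw [aux_integral_smul volume ha (fun y => ‖Φ (a, y / a) *
      ((‖a‖ ^ (((2 * (k + 1) : ℕ) : ℝ) - 4) : ℝ) : ℂ)‖), smul_eq_mul, ← integral_const_mul]
    congr 1
    ext b
    have : 0 ≤ ‖a‖ ^ (((2 * (k + 1) : ℕ) : ℝ) - 4) := by positivity
    simp only [smul_eq_mul, Module.finrank_self, mul_one]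
    rw [mul_div_cancel_left₀ _ ha, norm_mul, norm_mul, Complex.norm_real, Complex.norm_real,
      ← aux_weight k ha, norm_mul, Real.norm_of_nonneg this, norm_pow, norm_norm]
    ring

theorem aux_hTwoC_eq (d : ℕ) (Φ : 𝓢(ℂ × ℂ, ℂ)) (ξ : ℂ) : hTwoC d Φ ξ =
    ∫ a, Φ (a, ξ / a) * ((‖a‖ ^ ((d : ℝ) - 4) : ℝ) : ℂ) := by
  rw [hTwoC, restrict_compl_singleton]

theorem aux_hTwoC_integrable (k : ℕ) (Φ : 𝓢(ℂ × ℂ, ℂ)) :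
    Integrable (hTwoC (2 * (k + 1)) Φ) := by
  have h := aux_H_integrable k Φ
  rw [Measure.volume_eq_prod] at h
  refine h.integral_prod_right.congr (ae_of_all _ fun ξ => ?_)
  exact (aux_hTwoC_eq _ Φ ξ).symm

theorem aux_rhs (k : ℕ) (Φ : 𝓢(ℂ × ℂ, ℂ)) (g : ℂ → ℂ) (hg : Continuous g)
    (C : ℝ) (hC : ∀ x, ‖g x‖ ≤ C) :
    ∫ ξ, g ξ * hTwoC (2 * (k + 1)) Φ ξ =
      ∫ p : ℂ × ℂ, g (p.1 * p.2) * (Φ p * ((‖p.1‖ ^ (2 * k) : ℝ) : ℂ)) := by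
  have h := aux_H_integrable k Φ
  have hI := aux_int_weight k Φ
  have h0 : ∀ᵐ a : ℂ, a ≠ 0 := by simp [ae_iff]
  rw [Measure.volume_eq_prod] at h hI
  have h1 : Integrable (fun p : ℂ × ℂ => g p.2 * (Φ (p.1, p.2 / p.1) *
      ((‖p.1‖ ^ (((2 * (k + 1) : ℕ) : ℝ) - 4) : ℝ) : ℂ))) (volume.prod volume) :=
    h.bdd_mul (c := C) (by fun_prop) (ae_of_all _ fun p => hC _)
  have h2 : Integrable (fun p : ℂ × ℂ => g (p.1 * p.2) *
      (Φ p * ((‖p.1‖ ^ (2 * k) : ℝ) : ℂ))) (volume.prod volume) :=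
    hI.bdd_mul (c := C) (by fun_prop) (ae_of_all _ fun p => hC _)
  rw [Measure.volume_eq_prod, integral_prod _ h2]
  calc _ = ∫ ξ, ∫ a, g ξ * (Φ (a, ξ / a) *
      ((‖a‖ ^ (((2 * (k + 1) : ℕ) : ℝ) - 4) : ℝ) : ℂ)) := by
        congr 1; ext ξ
        rw [integral_const_mul, aux_hTwoC_eq]
    _ = ∫ a, ∫ ξ, g ξ * (Φ (a, ξ / a) *
      ((‖a‖ ^ (((2 * (k + 1) : ℕ) : ℝ) - 4) : ℝ) : ℂ)) := (integral_integral_swap h1).symm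
    _ = _ := by
      refine integral_congr_ae ?_
      filter_upwards [h0] with a ha
      rw [aux_integral_smul volume ha]
      rw [Complex.real_smul, ← integral_const_mul]
      congr 1; ext b
      simp only [smul_eq_mul, Module.finrank_self, mul_one]
      rw [mul_div_cancel_left₀ _ ha, ← aux_weight k ha]
      push_cast
      ring

theorem aux_integrableOn (k : ℕ) (Φ : 𝓢(ℂ × ℂ, ℂ)) (ξ : ℂ) (hξ : ξ ≠ 0) :
    IntegrableOn (fun a : ℂ => Φ (a, ξ / a) *
      ((‖a‖ ^ (((2 * (k + 1) : ℕ) : ℝ) - 4) : ℝ) : ℂ)) ({0}ᶜ : Set ℂ) := by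
  rw [IntegrableOn, restrict_compl_singleton]
  have h0 : ∀ᵐ a : ℂ, a ≠ 0 := by simp [ae_iff]
  obtain ⟨C, hC0, hC⟩ := aux_schwartz_bound Φ (2 + 2 * k + 3) 0
  have hIntg : Integrable (fun a : ℂ => (1 + ‖a‖) ^ (-3 : ℝ)) :=
    integrable_one_add_norm (by simp; norm_num)
  refine (hIntg.const_mul (C / ‖ξ‖ ^ 2)).mono' ?_ ?_
  · refine Measurable.aestronglyMeasurable ?_
    refine (Φ.continuous.measurable.comp (by fun_prop)).mul ?_
    exact Complex.measurable_ofReal.comp (by fun_prop)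
  · filter_upwards [h0] with a ha
    have hap : 0 < ‖a‖ := norm_pos_iff.2 ha
    have hξp : 0 < ‖ξ‖ := norm_pos_iff.2 hξ
    have hw := aux_weight k ha
    set w := ‖a‖ ^ (((2 * (k + 1) : ℕ) : ℝ) - 4)
    have hw0 : 0 ≤ w := by positivity
    have h1 := hC (a, ξ / a)
    rw [norm_iteratedFDeriv_zero] at h1
    have hb : ‖ξ‖ / ‖a‖ ≤ 1 + ‖(a, ξ / a)‖ := by
      have := norm_snd_le (a, ξ / a)
      simp only [norm_div] at this
      linarith
    have ha1 : ‖a‖ ≤ 1 + ‖(a, ξ / a)‖ := by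
      have := norm_fst_le (a, ξ / a)
      simp only at this
      linarith
    have ha2 : 1 + ‖a‖ ≤ 1 + ‖(a, ξ / a)‖ := by
      have := norm_fst_le (a, ξ / a)
      simp only at this
      linarith
    have h2 : (‖ξ‖ / ‖a‖) ^ 2 * ‖a‖ ^ (2 * k) * (1 + ‖a‖) ^ 3 * ‖Φ (a, ξ / a)‖ ≤ C := by
      refine le_trans ?_ h1
      rw [pow_add, pow_add]
      gcongr
    rw [norm_mul, Complex.norm_real, Real.norm_of_nonneg hw0]
    rw [Real.rpow_neg (by positivity), ← hw] at *
    have e3 : (1 + ‖a‖) ^ (3:ℝ) = (1 + ‖a‖) ^ 3 := by norm_cast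
    rw [e3, div_mul_eq_mul_div, le_div_iff₀ (by positivity), ← div_eq_mul_inv,
      le_div_iff₀ (by positivity)]
    calc _ = (‖ξ‖ / ‖a‖) ^ 2 * (w * ‖a‖ ^ 2) * (1 + ‖a‖) ^ 3 * ‖Φ (a, ξ / a)‖ := by
          field_simp
      _ ≤ C := h2

/-- the bilinear pairing -/
def auxDot {m : ℕ} (x y : Fin m → ℂ) : ℂ := ∑ i, x i * y i

/-- squared Euclidean length -/
def auxN2 {m : ℕ} (x : Fin m → ℂ) : ℝ := ∑ i, ‖x i‖ ^ 2

/-- dual vector -/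
def auxTil {m : ℕ} (x : Fin m → ℂ) : Fin m → ℂ :=
  fun i => (((max 1 (auxN2 x))⁻¹ : ℝ) : ℂ) * (starRingEnd ℂ) (x i)

/-- shell cutoff -/
def auxGam {m : ℕ} (x : Fin m → ℂ) : ℂ :=
  Set.indicator {x : Fin m → ℂ | 1 ≤ auxN2 x ∧ auxN2 x ≤ 4} (fun _ => 1) x

/-- disc cutoff -/
def auxChi (c : ℂ) : ℂ := Set.indicator (Metric.closedBall (0:ℂ) 1) (fun _ => 1) c

theorem aux_dot_cont {m : ℕ} : Continuous (fun p : (Fin m → ℂ) × (Fin m → ℂ) => auxDot p.1 p.2) := by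
  unfold auxDot; fun_prop

theorem aux_n2_cont {m : ℕ} : Continuous (auxN2 (m := m)) := by
  unfold auxN2; fun_prop

theorem aux_til_cont {m : ℕ} : Continuous (auxTil (m := m)) := by
  unfold auxTil
  refine continuous_pi fun i => ?_
  refine Continuous.mul (Complex.continuous_ofReal.comp ?_) (by fun_prop)
  refine Continuous.inv₀ (continuous_const.max aux_n2_cont) fun x => ?_
  have : (1:ℝ) ≤ max 1 (auxN2 x) := le_max_left _ _
  positivity

theorem aux_gam_meas {m : ℕ} : Measurable (auxGam (m := m)) := by
  unfold auxGam
  refine Measurable.indicator measurable_const ?_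
  exact (measurableSet_le measurable_const aux_n2_cont.measurable).inter
    (measurableSet_le aux_n2_cont.measurable measurable_const)

theorem aux_chi_meas : Measurable auxChi := by
  unfold auxChi
  exact Measurable.indicator measurable_const Metric.isClosed_closedBall.measurableSet

theorem aux_dot_til {m : ℕ} {x : Fin m → ℂ} (hx : 1 ≤ auxN2 x) : auxDot x (auxTil x) = 1 := by
  have h : auxDot x (auxTil x) = (((max 1 (auxN2 x))⁻¹ : ℝ) : ℂ) * ((auxN2 x : ℝ) : ℂ) := by
    unfold auxDot auxTil
    rw [show ((auxN2 x : ℝ) : ℂ) = ∑ i, ((‖x i‖ : ℂ)) ^ 2 by unfold auxN2; push_cast; rfl,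
      Finset.mul_sum]
    refine Finset.sum_congr rfl fun i _ => ?_
    rw [← Complex.mul_conj']
    ring
  rw [h, max_eq_right hx, ← Complex.ofReal_mul, inv_mul_cancel₀ (by linarith), Complex.ofReal_one]

theorem aux_dot_add {m : ℕ} (x y z : Fin m → ℂ) : auxDot x (y + z) = auxDot x y + auxDot x z := by
  simp [auxDot, mul_add, Finset.sum_add_distrib]

theorem aux_dot_smul {m : ℕ} (x y : Fin m → ℂ) (c : ℂ) : auxDot x (c • y) = c * auxDot x y := by
  simp only [auxDot, Pi.smul_apply, smul_eq_mul, Finset.mul_sum]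
  exact Finset.sum_congr rfl fun i _ => by ring

theorem aux_smul_dot {m : ℕ} (x y : Fin m → ℂ) (c : ℂ) : auxDot (c • x) y = c * auxDot x y := by
  simp only [auxDot, Pi.smul_apply, smul_eq_mul, Finset.mul_sum]
  exact Finset.sum_congr rfl fun i _ => by ring

/-- the involution -/
def auxShear {m : ℕ} (x : Fin m → ℂ) : (ℂ × (Fin m → ℂ)) →ₗ[ℝ] (ℂ × (Fin m → ℂ)) where
  toFun p := (auxDot x p.2, p.2 + (p.1 - auxDot x p.2) • auxTil x)
  map_add' p q := by
    ext
    · simp [aux_dot_add]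
    · simp [aux_dot_add]; ring
  map_smul' c p := by
    have h : auxDot x (c • p.2) = c * auxDot x p.2 := by
      rw [show c • p.2 = (c:ℂ) • p.2 from by ext; simp, aux_dot_smul]
    ext
    · simp [h]
    · simp [h]; ring

theorem aux_shear_mp {m : ℕ} {x : Fin m → ℂ} (hx : 1 ≤ auxN2 x) :
    MeasurePreserving (auxShear x) ((volume : Measure ℂ).prod (volume : Measure (Fin m → ℂ)))
      ((volume : Measure ℂ).prod (volume : Measure (Fin m → ℂ))) := by
  have hinv : auxShear x ∘ₗ auxShear x = LinearMap.id := by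
    apply LinearMap.ext
    intro p
    have h1 : auxDot x (p.2 + (p.1 - auxDot x p.2) • auxTil x) = p.1 := by
      rw [aux_dot_add, aux_dot_smul, aux_dot_til hx]; ring
    ext
    · simp [auxShear, h1]
    · simp only [auxShear, LinearMap.comp_apply, LinearMap.coe_mk, AddHom.coe_mk, h1]
      simp; ring
  have hdet : LinearMap.det (auxShear x) * LinearMap.det (auxShear x) = 1 := by
    rw [← LinearMap.det_comp, hinv, LinearMap.det_id]
  have habs : |LinearMap.det (auxShear x)| = 1 := by
    rcases mul_self_eq_one_iff.1 hdet with h | h <;> simp [h]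
  refine ⟨(LinearMap.continuous_of_finiteDimensional _).measurable, ?_⟩
  have := Measure.prod.instIsAddHaarMeasure (volume : Measure ℂ) (volume : Measure (Fin m → ℂ))
  rw [Measure.map_linearMap_addHaar_eq_smul_addHaar _ (by intro h; simp [h] at hdet), abs_inv, habs]
  simp

theorem aux_shear_emb {m : ℕ} {x : Fin m → ℂ} (hx : 1 ≤ auxN2 x) :
    MeasurableEmbedding (auxShear x) := by
  have hinv : ∀ p, auxShear x (auxShear x p) = p := by
    intro p
    have h1 : auxDot x (p.2 + (p.1 - auxDot x p.2) • auxTil x) = p.1 := by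
      rw [aux_dot_add, aux_dot_smul, aux_dot_til hx]; ring
    ext
    · simp [auxShear, h1]
    · simp only [auxShear, LinearMap.coe_mk, AddHom.coe_mk, h1]
      simp; ring
  have hc : Continuous (auxShear x) := LinearMap.continuous_of_finiteDimensional _
  exact (Homeomorph.mk ⟨auxShear x, auxShear x, hinv, hinv⟩ hc hc).measurableEmbedding

theorem aux_shear_integral {m : ℕ} {x : Fin m → ℂ} (hx : 1 ≤ auxN2 x) (a : ℂ)
    (Φ : 𝓢((Fin m → ℂ) × (Fin m → ℂ), ℂ)) (g : ℂ → ℂ) :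
    ∫ p : ℂ × (Fin m → ℂ), g (a * p.1) * (auxChi (auxDot x p.2) *
      Φ (a • x, p.2 + (p.1 - auxDot x p.2) • auxTil x)) ∂(volume.prod volume) =
    (∫ c, auxChi c) * ∫ y, g (auxDot (a • x) y) * Φ (a • x, y) := by
  rw [← integral_prod_mul]
  refine Eq.trans ?_ ((aux_shear_mp hx).integral_comp (aux_shear_emb hx) _)
  congr 1
  ext p
  have h1 : auxDot x (p.2 + (p.1 - auxDot x p.2) • auxTil x) = p.1 := by
    rw [aux_dot_add, aux_dot_smul, aux_dot_til hx]; ring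
  simp only [auxShear, LinearMap.coe_mk, AddHom.coe_mk, aux_smul_dot, h1]
  ring

theorem aux_chi_int : (∫ c, auxChi c) ≠ 0 := by
  unfold auxChi
  rw [integral_indicator Metric.isClosed_closedBall.measurableSet, setIntegral_const]
  simp [Measure.real, Real.pi_ne_zero]

section reorder
variable {A B X Z : Type*} [MeasureSpace A] [MeasureSpace B] [MeasureSpace X] [MeasureSpace Z]
  [SFinite (volume : Measure A)] [SFinite (volume : Measure B)]
  [SFinite (volume : Measure X)] [SFinite (volume : Measure Z)]

/-- middle swap -/
def auxReorder (A B X Z : Type*) [MeasureSpace A] [MeasureSpace B] [MeasureSpace X]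
    [MeasureSpace Z] : (A × B) × (X × Z) ≃ᵐ (A × X) × (B × Z) where
  toEquiv := Equiv.prodProdProdComm A B X Z
  measurable_toFun := by
    simp only [Equiv.prodProdProdComm]
    exact ((measurable_fst.comp measurable_fst).prodMk (measurable_fst.comp measurable_snd)).prodMk
      ((measurable_snd.comp measurable_fst).prodMk (measurable_snd.comp measurable_snd))
  measurable_invFun := by
    simp only [Equiv.prodProdProdComm]
    exact ((measurable_fst.comp measurable_fst).prodMk (measurable_fst.comp measurable_snd)).prodMk
      ((measurable_snd.comp measurable_fst).prodMk (measurable_snd.comp measurable_snd))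

theorem aux_reorder_mp : MeasurePreserving (auxReorder A B X Z)
    (((volume : Measure A).prod (volume : Measure B)).prod
      ((volume : Measure X).prod (volume : Measure Z)))
    (((volume : Measure A).prod (volume : Measure X)).prod
      ((volume : Measure B).prod (volume : Measure Z))) := by
  have h1 := measurePreserving_prodAssoc (volume : Measure A) (volume : Measure B)
    ((volume : Measure X).prod (volume : Measure Z))
  have h2 := (measurePreserving_prodAssoc (volume : Measure B) (volume : Measure X)
    (volume : Measure Z)).symm
  have h3 := (Measure.measurePreserving_swap (μ := (volume : Measure B))
    (ν := (volume : Measure X))).prod (MeasurePreserving.id (volume : Measure Z))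
  have h4 := measurePreserving_prodAssoc (volume : Measure X) (volume : Measure B)
    (volume : Measure Z)
  have h5 := (measurePreserving_prodAssoc (volume : Measure A) (volume : Measure X)
    ((volume : Measure B).prod (volume : Measure Z))).symm
  exact h5.comp (((MeasurePreserving.id (volume : Measure A)).prod
    (h4.comp (h3.comp h2))).comp h1)
end reorder

section partOne
variable {m : ℕ}

theorem aux_dot_le (x y : Fin m → ℂ) : ‖auxDot x y‖ ≤ m * (‖x‖ * ‖y‖) := by
  unfold auxDot
  refine (norm_sum_le _ _).trans ?_
  refine (Finset.sum_le_card_nsmul _ _ (‖x‖ * ‖y‖) fun i _ => ?_).trans (by simp)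
  rw [norm_mul]
  gcongr
  · exact norm_le_pi_norm x i
  · exact norm_le_pi_norm y i

theorem aux_x_le {x : Fin m → ℂ} (hx : auxN2 x ≤ 4) : ‖x‖ ≤ 2 := by
  refine (pi_norm_le_iff_of_nonneg (by norm_num)).2 fun i => ?_
  have h : ‖x i‖ ^ 2 ≤ auxN2 x :=
    Finset.single_le_sum (f := fun i => ‖x i‖ ^ 2) (fun i _ => by positivity) (Finset.mem_univ i)
  nlinarith [norm_nonneg (x i)]

theorem aux_til_le {x : Fin m → ℂ} (hx : auxN2 x ≤ 4) : ‖auxTil x‖ ≤ 2 := by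
  refine (pi_norm_le_iff_of_nonneg (by norm_num)).2 fun i => ?_
  unfold auxTil
  have h1 : (1:ℝ) ≤ max 1 (auxN2 x) := le_max_left _ _
  rw [norm_mul, Complex.norm_real, norm_inv, Real.norm_of_nonneg (by positivity), RCLike.norm_conj]
  calc _ ≤ 1 * ‖x i‖ := by gcongr; exact inv_le_one_of_one_le₀ h1
    _ ≤ 2 := by rw [one_mul]; exact (norm_le_pi_norm x i).trans (aux_x_le hx)

/-- linear part -/
def auxL (x : Fin m → ℂ) : (ℂ × ℂ) →L[ℝ] (Fin m → ℂ) × (Fin m → ℂ) :=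
  ((ContinuousLinearMap.fst ℝ ℂ ℂ).smulRight x).prod
    ((ContinuousLinearMap.snd ℝ ℂ ℂ).smulRight (auxTil x))

/-- shift -/
def auxS (p : (Fin m → ℂ) × (Fin m → ℂ)) : (Fin m → ℂ) × (Fin m → ℂ) :=
  (0, p.2 - auxDot p.1 p.2 • auxTil p.1)

theorem auxSL (p : (Fin m → ℂ) × (Fin m → ℂ)) (v : ℂ × ℂ) : auxS p + auxL p.1 v =
    (v.1 • p.1, p.2 + (v.2 - auxDot p.1 p.2) • auxTil p.1) := by
  ext i
  · simp [auxS, auxL]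
  · simp [auxS, auxL]; ring

theorem aux_L_cont : Continuous (auxL (m := m)) := by
  rw [continuous_clm_apply]
  intro v
  have h2 := aux_til_cont (m := m)
  simp only [auxL, ContinuousLinearMap.prod_apply, ContinuousLinearMap.smulRight_apply]
  fun_prop

theorem aux_S_cont : Continuous (auxS (m := m)) := by
  unfold auxS
  have h1 := aux_dot_cont (m := m)
  have h2 := aux_til_cont (m := m)
  fun_prop

theorem aux_L_le {x : Fin m → ℂ} (hx : auxN2 x ≤ 4) : ‖auxL x‖ ≤ 2 := by
  refine ContinuousLinearMap.opNorm_le_bound _ (by norm_num) fun v => ?_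
  simp only [auxL, ContinuousLinearMap.prod_apply, ContinuousLinearMap.smulRight_apply,
    ContinuousLinearMap.coe_fst', ContinuousLinearMap.coe_snd']
  refine max_le ?_ ?_
  · simp only [norm_smul]
    nlinarith [norm_fst_le v, aux_x_le hx, norm_nonneg v.1, norm_nonneg x]
  · simp only [norm_smul]
    nlinarith [norm_snd_le v, aux_til_le hx, norm_nonneg v.2, norm_nonneg (auxTil x)]

theorem aux_v_le (p : (Fin m → ℂ) × (Fin m → ℂ)) (v : ℂ × ℂ) (h1 : 1 ≤ auxN2 p.1)
    (h4 : auxN2 p.1 ≤ 4) : ‖v‖ ≤ 2 * m * ‖auxS p + auxL p.1 v‖ := by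
  rw [auxSL]
  have hdt := aux_dot_til h1
  have hx := aux_x_le h4
  have ht := aux_til_le h4
  refine max_le ?_ ?_
  · have h : v.1 = auxDot (v.1 • p.1) (auxTil p.1) := by rw [aux_smul_dot, hdt, mul_one]
    calc ‖v.1‖ = ‖auxDot (v.1 • p.1) (auxTil p.1)‖ := by rw [← h]
      _ ≤ m * (‖v.1 • p.1‖ * ‖auxTil p.1‖) := aux_dot_le _ _
      _ ≤ m * (‖(v.1 • p.1, p.2 + (v.2 - auxDot p.1 p.2) • auxTil p.1)‖ * 2) := by
        gcongr
        exact norm_fst_le (v.1 • p.1, p.2 + (v.2 - auxDot p.1 p.2) • auxTil p.1)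
      _ = _ := by ring
  · have h : v.2 = auxDot p.1 (p.2 + (v.2 - auxDot p.1 p.2) • auxTil p.1) := by
      rw [aux_dot_add, aux_dot_smul, hdt]; ring
    calc ‖v.2‖ = ‖auxDot p.1 (p.2 + (v.2 - auxDot p.1 p.2) • auxTil p.1)‖ := by rw [← h]
      _ ≤ m * (‖p.1‖ * ‖p.2 + (v.2 - auxDot p.1 p.2) • auxTil p.1‖) := aux_dot_le _ _
      _ ≤ m * (2 * ‖(v.1 • p.1, p.2 + (v.2 - auxDot p.1 p.2) • auxTil p.1)‖) := by
        gcongr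
        exact norm_snd_le (v.1 • p.1, p.2 + (v.2 - auxDot p.1 p.2) • auxTil p.1)
      _ = _ := by ring

theorem aux_z_le (p : (Fin m → ℂ) × (Fin m → ℂ)) (v : ℂ × ℂ) (h1 : 1 ≤ auxN2 p.1)
    (h4 : auxN2 p.1 ≤ 4) (hc : ‖auxDot p.1 p.2‖ ≤ 1) :
    1 + ‖p.2‖ ≤ (3 + 4 * m) * (1 + ‖auxS p + auxL p.1 v‖) := by
  have hv := aux_v_le p v h1 h4
  have ht := aux_til_le h4
  have hy : ‖p.2 + (v.2 - auxDot p.1 p.2) • auxTil p.1‖ ≤ ‖auxS p + auxL p.1 v‖ := by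
    rw [auxSL]
    exact norm_snd_le (v.1 • p.1, p.2 + (v.2 - auxDot p.1 p.2) • auxTil p.1)
  have hz : ‖p.2‖ ≤ ‖p.2 + (v.2 - auxDot p.1 p.2) • auxTil p.1‖ +
      ‖(v.2 - auxDot p.1 p.2) • auxTil p.1‖ := by
    have := norm_sub_le (p.2 + (v.2 - auxDot p.1 p.2) • auxTil p.1)
      ((v.2 - auxDot p.1 p.2) • auxTil p.1)
    rwa [add_sub_cancel_right] at this
  have hs : ‖(v.2 - auxDot p.1 p.2) • auxTil p.1‖ ≤ (‖v‖ + 1) * 2 := by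
    rw [norm_smul]
    gcongr
    exact (norm_sub_le _ _).trans (add_le_add (norm_snd_le v) hc)
  have hm : (0:ℝ) ≤ m := by positivity
  nlinarith [norm_nonneg (auxS p + auxL p.1 v)]

/-- the family of test functions -/
def auxF (Φ : 𝓢((Fin m → ℂ) × (Fin m → ℂ), ℂ)) (p : (Fin m → ℂ) × (Fin m → ℂ)) (v : ℂ × ℂ) : ℂ :=
  (auxGam p.1 * auxChi (auxDot p.1 p.2)) • Φ (auxS p + auxL p.1 v)

theorem aux_shift_iter (Φ : 𝓢((Fin m → ℂ) × (Fin m → ℂ), ℂ))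
    (p : (Fin m → ℂ) × (Fin m → ℂ)) (n : ℕ) (v : ℂ × ℂ) :
    iteratedFDeriv ℝ n (fun v => Φ (auxS p + auxL p.1 v)) v =
      (iteratedFDeriv ℝ n Φ (auxS p + auxL p.1 v)).compContinuousLinearMap (fun _ => auxL p.1) := by
  have hΦ : ContDiff ℝ ∞ (fun u => Φ (auxS p + u)) := (Φ.smooth ⊤).comp (by fun_prop)
  have := (auxL p.1).iteratedFDeriv_comp_right (hΦ) v (i := n) (by exact_mod_cast le_top)
  rw [iteratedFDeriv_comp_add_left] at this
  exact this

theorem aux_F_contDiff (Φ : 𝓢((Fin m → ℂ) × (Fin m → ℂ), ℂ))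
    (p : (Fin m → ℂ) × (Fin m → ℂ)) : ContDiff ℝ ∞ (auxF Φ p) := by
  unfold auxF
  have h : ContDiff ℝ ∞ (fun v => Φ (auxS p + auxL p.1 v)) := (Φ.smooth ⊤).comp (by fun_prop)
  simp only [smul_eq_mul]
  exact contDiff_const.mul h

theorem aux_F_iter (Φ : 𝓢((Fin m → ℂ) × (Fin m → ℂ), ℂ))
    (p : (Fin m → ℂ) × (Fin m → ℂ)) (n : ℕ) (v : ℂ × ℂ) :
    iteratedFDeriv ℝ n (auxF Φ p) v = (auxGam p.1 * auxChi (auxDot p.1 p.2)) •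
      (iteratedFDeriv ℝ n Φ (auxS p + auxL p.1 v)).compContinuousLinearMap (fun _ => auxL p.1) := by
  rw [← aux_shift_iter]
  have h : ContDiff ℝ ∞ (fun v => Φ (auxS p + auxL p.1 v)) := (Φ.smooth ⊤).comp (by fun_prop)
  exact iteratedFDeriv_const_smul_apply (R := ℂ) (a := auxGam p.1 * auxChi (auxDot p.1 p.2))
    (h.contDiffAt.of_le (by exact_mod_cast le_top))

theorem aux_F_meas (Φ : 𝓢((Fin m → ℂ) × (Fin m → ℂ), ℂ)) (n : ℕ) (v : ℂ × ℂ) :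
    AEStronglyMeasurable (fun p => iteratedFDeriv ℝ n (auxF Φ p) v) (volume.prod volume) := by
  simp_rw [aux_F_iter]
  refine AEStronglyMeasurable.smul (𝕜 := ℂ) ?_ ?_
  · exact ((aux_gam_meas.comp measurable_fst).mul
      (aux_chi_meas.comp aux_dot_cont.measurable)).aestronglyMeasurable
  · refine Continuous.aestronglyMeasurable ?_
    have h1 : Continuous (fun p : (Fin m → ℂ) × (Fin m → ℂ) =>
        iteratedFDeriv ℝ n Φ (auxS p + auxL p.1 v)) := by
      refine ((Φ.smooth ⊤).continuous_iteratedFDeriv (by exact_mod_cast le_top)).comp ?_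
      exact aux_S_cont.add ((aux_L_cont.comp continuous_fst).clm_apply continuous_const)
    have h2 : Continuous (fun p : (Fin m → ℂ) × (Fin m → ℂ) =>
        ContinuousMultilinearMap.compContinuousLinearMapContinuousMultilinear ℝ
          (fun _ : Fin n => ℂ × ℂ) (fun _ : Fin n => (Fin m → ℂ) × (Fin m → ℂ)) ℂ
          (fun _ => auxL p.1)) :=
      (ContinuousMultilinearMap.cont _).comp (continuous_pi fun _ => aux_L_cont.comp continuous_fst)
    exact h2.clm_apply h1

theorem aux_F_bound (Φ : 𝓢((Fin m → ℂ) × (Fin m → ℂ), ℂ)) (k n : ℕ) :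
    ∃ b : (Fin m → ℂ) × (Fin m → ℂ) → ℝ, Integrable b (volume.prod volume) ∧
      ∀ p v, ‖v‖ ^ k * ‖iteratedFDeriv ℝ n (auxF Φ p) v‖ ≤ b p := by
  obtain ⟨C, hC0, hC⟩ := aux_schwartz_bound Φ (k + (2 * m + 1)) n
  set K : ℝ := (2 * m) ^ k * (3 + 4 * m) ^ (2 * m + 1) * 2 ^ n * C with hK
  refine ⟨fun p => Set.indicator (Metric.closedBall (0 : Fin m → ℂ) 2) (fun _ => K) p.1 *
    (1 + ‖p.2‖) ^ (-((2 * m + 1 : ℕ) : ℝ)), ?_, fun p v => ?_⟩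
  · refine Integrable.mul_prod (f := Set.indicator (Metric.closedBall (0 : Fin m → ℂ) 2) (fun _ => K))
      (g := fun z : Fin m → ℂ => (1 + ‖z‖) ^ (-((2 * m + 1 : ℕ) : ℝ))) ?_ ?_
    · exact (integrable_indicator_iff Metric.isClosed_closedBall.measurableSet).2
        (integrableOn_const (measure_closedBall_lt_top.ne))
    · refine integrable_one_add_norm ?_
      simp [finrank_real_of_complex]
  · have hK0 : 0 ≤ K := by positivity
    by_cases hp : (1 ≤ auxN2 p.1 ∧ auxN2 p.1 ≤ 4) ∧ ‖auxDot p.1 p.2‖ ≤ 1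
    · obtain ⟨⟨h1, h4⟩, hc⟩ := hp
      have e1 : ‖auxGam p.1 * auxChi (auxDot p.1 p.2)‖ ≤ 1 := by
        rw [norm_mul]
        refine mul_le_one₀ (M₀ := ℝ) ?_ (norm_nonneg _) ?_
        · unfold auxGam; exact (norm_indicator_le_norm_self _ _).trans (by simp)
        · unfold auxChi; exact (norm_indicator_le_norm_self _ _).trans (by simp)
      have e2 : ‖iteratedFDeriv ℝ n (auxF Φ p) v‖ ≤
          2 ^ n * ‖iteratedFDeriv ℝ n Φ (auxS p + auxL p.1 v)‖ := by
        rw [aux_F_iter, norm_smul]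
        calc _ ≤ 1 * (‖iteratedFDeriv ℝ n Φ (auxS p + auxL p.1 v)‖ * ∏ _i : Fin n, ‖auxL p.1‖) := by
              gcongr
              exact ContinuousMultilinearMap.norm_compContinuousLinearMap_le _ _
          _ ≤ 1 * (‖iteratedFDeriv ℝ n Φ (auxS p + auxL p.1 v)‖ * 2 ^ n) := by
              simp only [Finset.prod_const, Finset.card_univ, Fintype.card_fin]
              gcongr
              exact aux_L_le h4
          _ = _ := by ring
      have e3 := aux_v_le p v h1 h4
      have e4 := aux_z_le p v h1 h4 hc
      have e5 := hC (auxS p + auxL p.1 v)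
      set N := ‖auxS p + auxL p.1 v‖ with hN
      have hN0 : 0 ≤ N := norm_nonneg _
      set D := ‖iteratedFDeriv ℝ n Φ (auxS p + auxL p.1 v)‖
      have hmem : p.1 ∈ Metric.closedBall (0 : Fin m → ℂ) 2 := by simpa using aux_x_le h4
      beta_reduce
      rw [Set.indicator_of_mem hmem, Real.rpow_neg (by positivity),
        Real.rpow_natCast, ← div_eq_mul_inv, le_div_iff₀ (by positivity)]
      calc _ ≤ (2 * m * (1 + N)) ^ k * (2 ^ n * D) * ((3 + 4 * m) * (1 + N)) ^ (2 * m + 1) := by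
            gcongr
            exact e3.trans (by gcongr; linarith)
        _ = (2 * m) ^ k * (3 + 4 * m) ^ (2 * m + 1) * 2 ^ n * ((1 + N) ^ (k + (2 * m + 1)) * D) := by
            rw [mul_pow (2 * m : ℝ) (1 + N), mul_pow (3 + 4 * m : ℝ) (1 + N), pow_add (1 + N)]; ring
        _ ≤ K := by rw [hK]; gcongr
    · have : auxGam p.1 * auxChi (auxDot p.1 p.2) = 0 := by
        rw [not_and_or] at hp
        rcases hp with hp | hp
        · have h : p.1 ∉ {x : Fin m → ℂ | 1 ≤ auxN2 x ∧ auxN2 x ≤ 4} := hp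
          rw [auxGam, Set.indicator_of_notMem h, zero_mul]
        · have h : auxDot p.1 p.2 ∉ Metric.closedBall (0:ℂ) 1 := by simpa using hp
          rw [auxChi, Set.indicator_of_notMem h, mul_zero]
      rw [aux_F_iter, this, zero_smul, norm_zero, mul_zero]
      refine mul_nonneg (Set.indicator_nonneg (fun _ _ => hK0) _) (by positivity)

theorem aux_F_schwartz (Φ : 𝓢((Fin m → ℂ) × (Fin m → ℂ), ℂ)) :
    ∃ F : 𝓢(ℂ × ℂ, ℂ), ∀ v, F v = ∫ p, auxF Φ p v ∂(volume.prod volume) := by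
  choose b hb hbd using aux_F_bound Φ
  exact aux_exists_schwartz_integral _ (auxF Φ) (aux_F_contDiff Φ) (aux_F_meas Φ) b hb hbd

theorem aux_F_integrable (Φ : 𝓢((Fin m → ℂ) × (Fin m → ℂ), ℂ)) (k : ℕ) :
    Integrable (fun q : (ℂ × ℂ) × ((Fin m → ℂ) × (Fin m → ℂ)) =>
      ((‖q.1.1‖ ^ k : ℝ) : ℂ) * auxF Φ q.2 q.1)
      (((volume : Measure ℂ).prod (volume : Measure ℂ)).prod
        ((volume : Measure (Fin m → ℂ)).prod (volume : Measure (Fin m → ℂ)))) := by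
  obtain ⟨b0, hb0, hbd0⟩ := aux_F_bound Φ 0 0
  obtain ⟨b, hb, hbd⟩ := aux_F_bound Φ (k + 5) 0
  have hIntg : Integrable (fun v : ℂ × ℂ => (1 + ‖v‖) ^ (-((5 : ℕ) : ℝ)))
      ((volume : Measure ℂ).prod (volume : Measure ℂ)) := by
    refine integrable_one_add_norm ?_
    simp
    norm_num
  refine (hIntg.mul_prod ((hb0.add hb).const_mul (2 ^ (k + 5)))).mono' ?_ (ae_of_all _ fun q => ?_)
  · refine Measurable.aestronglyMeasurable ?_
    unfold auxF
    simp only [smul_eq_mul]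
    refine Measurable.mul (by fun_prop) (Measurable.mul ?_ ?_)
    · exact ((aux_gam_meas.comp measurable_fst).mul
        (aux_chi_meas.comp aux_dot_cont.measurable)).comp measurable_snd
    · refine (Φ.continuous.comp ?_).measurable
      exact (aux_S_cont.comp continuous_snd).add
        ((aux_L_cont.comp (continuous_fst.comp continuous_snd)).clm_apply continuous_fst)
  · have h0 := hbd0 q.2 q.1
    have h1 := hbd q.2 q.1
    rw [norm_iteratedFDeriv_zero] at h0 h1
    rw [norm_mul, Complex.norm_real, norm_pow, norm_norm, Real.rpow_neg (by positivity),
      Real.rpow_natCast, mul_comm (_⁻¹), ← div_eq_mul_inv, le_div_iff₀ (by positivity)]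
    have h2 : (1 + ‖q.1‖) ^ (k + 5) ≤ 2 ^ (k + 5) * (1 + ‖q.1‖ ^ (k + 5)) := by
      rcases le_total ‖q.1‖ 1 with h | h
      · calc _ ≤ (2:ℝ) ^ (k + 5) * 1 := by rw [mul_one]; gcongr; linarith
          _ ≤ _ := by gcongr; linarith [pow_nonneg (norm_nonneg q.1) (k + 5)]
      · calc _ ≤ (2 * ‖q.1‖) ^ (k + 5) := by gcongr; linarith
          _ = (2:ℝ) ^ (k + 5) * ‖q.1‖ ^ (k + 5) := by rw [mul_pow]
          _ ≤ _ := by gcongr; linarith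
    set y := ‖auxF Φ q.2 q.1‖
    have hy : 0 ≤ y := norm_nonneg _
    calc ‖q.1.1‖ ^ k * y * (1 + ‖q.1‖) ^ 5 ≤ (1 + ‖q.1‖) ^ k * y * (1 + ‖q.1‖) ^ 5 := by
          gcongr
          linarith [norm_fst_le q.1]
      _ = (1 + ‖q.1‖) ^ (k + 5) * y := by rw [pow_add]; ring
      _ ≤ 2 ^ (k + 5) * (1 + ‖q.1‖ ^ (k + 5)) * y := by gcongr
      _ = 2 ^ (k + 5) * (‖q.1‖ ^ 0 * y + ‖q.1‖ ^ (k + 5) * y) := by ring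
      _ ≤ _ := by simp only [Pi.add_apply]; gcongr

end partOne

/-- radial shell -/
def auxSh (a : ℂ) : ℝ :=
  Set.indicator {a : ℂ | 1 ≤ (‖a‖ ^ 2)⁻¹ ∧ (‖a‖ ^ 2)⁻¹ ≤ 4} (fun a => (‖a‖ ^ 2)⁻¹) a

theorem aux_sh_meas : Measurable auxSh := by
  unfold auxSh
  refine Measurable.indicator (by fun_prop) ?_
  have hm : Measurable (fun a : ℂ => (‖a‖ ^ 2)⁻¹) := by fun_prop
  exact (measurableSet_le measurable_const hm).inter (measurableSet_le hm measurable_const)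

theorem aux_sh_integrable : Integrable auxSh := by
  have h : Integrable (Set.indicator (Metric.closedBall (0:ℂ) 1) (fun _ => (4:ℝ))) :=
    (integrable_indicator_iff Metric.isClosed_closedBall.measurableSet).2
        (integrableOn_const (measure_closedBall_lt_top.ne))
  refine h.mono' aux_sh_meas.aestronglyMeasurable (ae_of_all _ fun a => ?_)
  unfold auxSh
  by_cases ha : a ∈ {a : ℂ | 1 ≤ (‖a‖ ^ 2)⁻¹ ∧ (‖a‖ ^ 2)⁻¹ ≤ 4}
  · have h1 : a ∈ Metric.closedBall (0:ℂ) 1 := by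
      have h2 := ha.1
      by_contra hcon
      simp only [Metric.mem_closedBall, dist_zero_right, not_le] at hcon
      have h3 : 1 < ‖a‖ ^ 2 := by nlinarith
      have := inv_lt_one_of_one_lt₀ h3
      linarith
    rw [Set.indicator_of_mem ha, Set.indicator_of_mem h1, Real.norm_of_nonneg (by positivity)]
    exact ha.2
  · rw [Set.indicator_of_notMem ha, norm_zero]
    exact Set.indicator_nonneg (fun _ _ => by norm_num) _

theorem aux_sh_nonneg (a : ℂ) : 0 ≤ auxSh a := by
  unfold auxSh
  exact Set.indicator_nonneg (fun _ _ => by positivity) _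

theorem aux_sh_pos : 0 < ∫ a, auxSh a := by
  rw [integral_pos_iff_support_of_nonneg aux_sh_nonneg aux_sh_integrable]
  have hsub : Metric.ball (3 / 4 : ℂ) (1 / 4) ⊆ Function.support auxSh := by
    intro a ha
    rw [mem_ball_iff_norm] at ha
    have h34 : ‖(3 / 4 : ℂ)‖ = 3 / 4 := by norm_num
    have h1 : ‖a‖ ≤ 1 := by
      have := norm_add_le (a - 3 / 4) (3 / 4)
      rw [sub_add_cancel, h34] at this
      linarith
    have h2 : 1 / 2 ≤ ‖a‖ := by
      have := norm_sub_norm_le (3 / 4 : ℂ) a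
      rw [h34, norm_sub_rev] at this
      linarith
    have hm : a ∈ {a : ℂ | 1 ≤ (‖a‖ ^ 2)⁻¹ ∧ (‖a‖ ^ 2)⁻¹ ≤ 4} := by
      constructor
      · exact (one_le_inv₀ (by positivity)).2 (by nlinarith)
      · rw [inv_le_comm₀ (by positivity) (by norm_num)]
        nlinarith
    rw [Function.mem_support, auxSh, Set.indicator_of_mem hm]
    positivity
  exact (Metric.measure_ball_pos volume _ (by norm_num)).trans_le (measure_mono hsub)

theorem aux_n2_smul {m : ℕ} (a : ℂ) (y : Fin m → ℂ) : auxN2 (a⁻¹ • y) = (‖a‖ ^ 2)⁻¹ * auxN2 y := by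
  simp only [auxN2, Pi.smul_apply, smul_eq_mul, norm_mul, norm_inv, Finset.mul_sum]
  exact Finset.sum_congr rfl fun i _ => by rw [mul_pow, inv_pow]

theorem aux_n2_pos {m : ℕ} {y : Fin m → ℂ} (hy : y ≠ 0) : 0 < auxN2 y := by
  obtain ⟨i, hi⟩ := Function.ne_iff.1 hy
  have h : ‖y i‖ ^ 2 ≤ auxN2 y :=
    Finset.single_le_sum (f := fun i => ‖y i‖ ^ 2) (fun i _ => by positivity) (Finset.mem_univ i)
  have : 0 < ‖y i‖ := norm_pos_iff.2 hi
  exact lt_of_lt_of_le (by positivity) h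

theorem aux_gam_scale {m : ℕ} {y : Fin m → ℂ} (hy : y ≠ 0) :
    ∃ s : ℂ, s ≠ 0 ∧ ∀ a : ℂ, (((‖s • a‖ ^ 2)⁻¹ : ℝ) : ℂ) * auxGam ((s • a)⁻¹ • y) =
      (((‖s‖ ^ 2)⁻¹ : ℝ) : ℂ) * ((auxSh a : ℝ) : ℂ) := by
  have hp := aux_n2_pos hy
  have hs : ‖((Real.sqrt (auxN2 y) : ℝ) : ℂ)‖ ^ 2 = auxN2 y := by
    rw [Complex.norm_real, Real.norm_of_nonneg (Real.sqrt_nonneg _), Real.sq_sqrt hp.le]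
  refine ⟨((Real.sqrt (auxN2 y) : ℝ) : ℂ), ?_, fun a => ?_⟩
  · intro h; rw [h] at hs; simp at hs; linarith
  have hn : auxN2 ((((Real.sqrt (auxN2 y) : ℝ) : ℂ) • a)⁻¹ • y) = (‖a‖ ^ 2)⁻¹ := by
    rw [aux_n2_smul, norm_smul, mul_pow, hs, mul_inv]
    field_simp
  rw [norm_smul, mul_pow, mul_inv, auxGam, auxSh]
  by_cases ha : 1 ≤ (‖a‖ ^ 2)⁻¹ ∧ (‖a‖ ^ 2)⁻¹ ≤ 4
  · have h1 : a ∈ {a : ℂ | 1 ≤ (‖a‖ ^ 2)⁻¹ ∧ (‖a‖ ^ 2)⁻¹ ≤ 4} := ha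
    have h2 : ((((Real.sqrt (auxN2 y) : ℝ) : ℂ) • a)⁻¹ • y) ∈
      {x : Fin m → ℂ | 1 ≤ auxN2 x ∧ auxN2 x ≤ 4} := by
      simp only [Set.mem_ofPred_eq, hn]; exact ha
    rw [Set.indicator_of_mem h1, Set.indicator_of_mem h2]
    push_cast; ring
  · have h1 : a ∉ {a : ℂ | 1 ≤ (‖a‖ ^ 2)⁻¹ ∧ (‖a‖ ^ 2)⁻¹ ≤ 4} := ha
    have h2 : ((((Real.sqrt (auxN2 y) : ℝ) : ℂ) • a)⁻¹ • y) ∉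
      {x : Fin m → ℂ | 1 ≤ auxN2 x ∧ auxN2 x ≤ 4} := by
      simp only [Set.mem_ofPred_eq, hn]; exact ha
    rw [Set.indicator_of_notMem h1, Set.indicator_of_notMem h2]
    simp

theorem aux_gam_int {m : ℕ} {y : Fin m → ℂ} (hy : y ≠ 0) :
    Integrable (fun a : ℂ => (((‖a‖ ^ 2)⁻¹ : ℝ) : ℂ) * auxGam (a⁻¹ • y)) := by
  obtain ⟨s, hs, h⟩ := aux_gam_scale hy
  rw [← aux_integrable_smul volume hs]
  simp_rw [h]
  exact aux_sh_integrable.ofReal.const_mul _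

theorem aux_gam_integral {m : ℕ} {y : Fin m → ℂ} (hy : y ≠ 0) :
    ∫ a : ℂ, (((‖a‖ ^ 2)⁻¹ : ℝ) : ℂ) * auxGam (a⁻¹ • y) = ((∫ a, auxSh a : ℝ) : ℂ) := by
  obtain ⟨s, hs, h⟩ := aux_gam_scale hy
  have hp : 0 < ‖s‖ := norm_pos_iff.2 hs
  rw [aux_integral_smul volume hs]
  simp_rw [h]
  rw [integral_const_mul, integral_complex_ofReal, Module.finrank_self, Complex.real_smul, ← mul_assoc,
    ← Complex.ofReal_mul, mul_one, mul_inv_cancel₀ (by positivity), Complex.ofReal_one, one_mul]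

theorem aux_gam_norm_integral {m : ℕ} {y : Fin m → ℂ} (hy : y ≠ 0) :
    ∫ a : ℂ, ‖(((‖a‖ ^ 2)⁻¹ : ℝ) : ℂ) * auxGam (a⁻¹ • y)‖ = ∫ a, auxSh a := by
  obtain ⟨s, hs, h⟩ := aux_gam_scale hy
  have hp : 0 < ‖s‖ := norm_pos_iff.2 hs
  rw [aux_integral_smul volume hs]
  simp_rw [h, norm_mul, Complex.norm_real, Real.norm_of_nonneg (aux_sh_nonneg _)]
  rw [integral_const_mul, Module.finrank_self, smul_eq_mul, ← mul_assoc,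
    Real.norm_of_nonneg (by positivity), mul_one, mul_inv_cancel₀ (by positivity), one_mul]

theorem aux_polar {k : ℕ} (Ψ : (Fin (k + 1) → ℂ) → ℂ) (hΨ : Integrable Ψ) :
    ∫ a : ℂ, ∫ y : Fin (k + 1) → ℂ, ((((‖a‖ ^ 2)⁻¹ : ℝ) : ℂ) * auxGam (a⁻¹ • y)) * Ψ y =
      ((∫ a, auxSh a : ℝ) : ℂ) * ∫ y, Ψ y := by
  have h0 : ∀ᵐ y : Fin (k + 1) → ℂ, y ≠ 0 := by simp [ae_iff]
  have hIntg : Integrable (fun q : ℂ × (Fin (k + 1) → ℂ) =>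
      ((((‖q.1‖ ^ 2)⁻¹ : ℝ) : ℂ) * auxGam (q.1⁻¹ • q.2)) * Ψ q.2) (volume.prod volume) := by
    rw [integrable_prod_iff']
    · constructor
      · filter_upwards [h0] with y hy
        exact (aux_gam_int hy).mul_const _
      · refine (hΨ.norm.const_mul (∫ a, auxSh a)).congr ?_
        filter_upwards [h0] with y hy
        simp_rw [norm_mul _ (Ψ y)]
        rw [integral_mul_const, aux_gam_norm_integral hy]
    · refine AEStronglyMeasurable.mul ?_ hΨ.aestronglyMeasurable.comp_snd
      refine Measurable.aestronglyMeasurable (Measurable.mul (by fun_prop) ?_)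
      exact aux_gam_meas.comp (by fun_prop)
  rw [integral_integral_swap hIntg, ← integral_const_mul]
  refine integral_congr_ae ?_
  filter_upwards [h0] with y hy
  rw [integral_mul_const, aux_gam_integral hy]

theorem aux_partI (k : ℕ) (Φ : 𝓢((Fin (k + 1) → ℂ) × (Fin (k + 1) → ℂ), ℂ)) :
    ∃ Φ₂ : 𝓢(ℂ × ℂ, ℂ), ∀ g : ℂ → ℂ, Continuous g → ∀ C : ℝ, (∀ x, ‖g x‖ ≤ C) →
      ∫ p, g (auxDot p.1 p.2) * Φ p ∂(volume.prod volume) =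
      ∫ p : ℂ × ℂ, g (p.1 * p.2) * (Φ₂ p * ((‖p.1‖ ^ (2 * k) : ℝ) : ℂ)) := by
  obtain ⟨F, hF⟩ := aux_F_schwartz Φ
  have hc0 := aux_chi_int
  set c0 := ∫ c, auxChi c with hc0d
  have hC0 : ((∫ a, auxSh a : ℝ) : ℂ) ≠ 0 := by exact_mod_cast aux_sh_pos.ne'
  set C0 := ((∫ a, auxSh a : ℝ) : ℂ) with hC0d
  refine ⟨(C0 * c0)⁻¹ • F, fun g hg C hC => ?_⟩
  have hΦ : Integrable Φ ((volume : Measure (Fin (k + 1) → ℂ)).prod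
      (volume : Measure (Fin (k + 1) → ℂ))) := by
    have := Measure.prod.instIsAddHaarMeasure (volume : Measure (Fin (k + 1) → ℂ))
      (volume : Measure (Fin (k + 1) → ℂ))
    exact Φ.integrable
  have hgΦ : Integrable (fun p => g (auxDot p.1 p.2) * Φ p)
      ((volume : Measure (Fin (k + 1) → ℂ)).prod (volume : Measure (Fin (k + 1) → ℂ))) :=
    hΦ.bdd_mul (c := C) (hg.comp aux_dot_cont).aestronglyMeasurable (ae_of_all _ fun p => hC _)
  set Ψ : (Fin (k + 1) → ℂ) → ℂ := fun x => ∫ y, g (auxDot x y) * Φ (x, y) with hΨ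
  have hΨi : Integrable Ψ := hgΦ.integral_prod_left
  have h4 : Integrable (fun q : (ℂ × ℂ) × ((Fin (k + 1) → ℂ) × (Fin (k + 1) → ℂ)) =>
      g (q.1.1 * q.1.2) * (((‖q.1.1‖ ^ (2 * k) : ℝ) : ℂ) * auxF Φ q.2 q.1))
      ((volume.prod volume).prod (volume.prod volume)) :=
    (aux_F_integrable Φ (2 * k)).bdd_mul (c := C)
      (hg.comp (by fun_prop)).aestronglyMeasurable (ae_of_all _ fun p => hC _)
  set G : (ℂ × (Fin (k + 1) → ℂ)) × (ℂ × (Fin (k + 1) → ℂ)) → ℂ := fun r =>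
    g (r.1.1 * r.2.1) * (((‖r.1.1‖ ^ (2 * k) : ℝ) : ℂ) * auxF Φ (r.1.2, r.2.2) (r.1.1, r.2.1)) with hG
  have hGi : Integrable G ((volume.prod volume).prod (volume.prod volume)) := by
    rw [← (aux_reorder_mp (A := ℂ) (B := ℂ) (X := Fin (k + 1) → ℂ)
      (Z := Fin (k + 1) → ℂ)).integrable_comp_emb (auxReorder _ _ _ _).measurableEmbedding]
    exact h4
  have hinner : ∀ u : ℂ × (Fin (k + 1) → ℂ), ∫ r, G (u, r) ∂(volume.prod volume) =
      ((‖u.1‖ ^ (2 * k) : ℝ) : ℂ) * auxGam u.2 * (c0 * Ψ (u.1 • u.2)) := by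
    intro u
    by_cases hu : u.2 ∈ {x : Fin (k + 1) → ℂ | 1 ≤ auxN2 x ∧ auxN2 x ≤ 4}
    · rw [hΨ, hc0d]
      beta_reduce
      rw [← aux_shear_integral hu.1 u.1 Φ g, ← integral_const_mul]
      congr 1
      ext r
      have := auxSL (u.2, r.2) (u.1, r.1)
      simp only at this
      simp only [hG, auxF, this, smul_eq_mul]
      ring
    · have : auxGam u.2 = 0 := Set.indicator_of_notMem hu _
      simp [hG, auxF, this]
  have hGi' := hGi.integral_prod_left
  simp_rw [hinner] at hGi'
  have hR : ∫ p : ℂ × ℂ, g (p.1 * p.2) * (F p * ((‖p.1‖ ^ (2 * k) : ℝ) : ℂ)) =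
      C0 * c0 * ∫ y, Ψ y := by
    calc _ = ∫ v : ℂ × ℂ, ∫ p, g (v.1 * v.2) * (((‖v.1‖ ^ (2 * k) : ℝ) : ℂ) * auxF Φ p v)
          ∂(volume.prod volume) ∂(volume.prod volume) := by
          rw [Measure.volume_eq_prod]
          congr 1; ext v
          rw [integral_const_mul, integral_const_mul, hF, mul_comm (∫ p, _ ∂_)]
      _ = _ := (integral_prod _ h4).symm
      _ = ∫ r, G r ∂((volume.prod volume).prod (volume.prod volume)) := by
          rw [← (aux_reorder_mp (A := ℂ) (B := ℂ) (X := Fin (k + 1) → ℂ)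
            (Z := Fin (k + 1) → ℂ)).integral_comp (auxReorder _ _ _ _).measurableEmbedding]
          rfl
      _ = ∫ u, ∫ r, G (u, r) ∂(volume.prod volume) ∂(volume.prod volume) := integral_prod _ hGi
      _ = ∫ u : ℂ × (Fin (k + 1) → ℂ), ((‖u.1‖ ^ (2 * k) : ℝ) : ℂ) * auxGam u.2 *
            (c0 * Ψ (u.1 • u.2)) ∂(volume.prod volume) := by simp_rw [hinner]
      _ = ∫ a : ℂ, ∫ x : Fin (k + 1) → ℂ, ((‖a‖ ^ (2 * k) : ℝ) : ℂ) * auxGam x *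
            (c0 * Ψ (a • x)) := integral_prod _ hGi'
      _ = ∫ a : ℂ, ∫ y : Fin (k + 1) → ℂ,
            ((((‖a‖ ^ 2)⁻¹ : ℝ) : ℂ) * auxGam (a⁻¹ • y)) * (c0 * Ψ y) := by
          have h0 : ∀ᵐ a : ℂ, a ≠ 0 := by simp [ae_iff]
          refine integral_congr_ae ?_
          filter_upwards [h0] with a ha
          rw [aux_integral_smul volume ha (fun y => ((((‖a‖ ^ 2)⁻¹ : ℝ) : ℂ) *
            auxGam (a⁻¹ • y)) * (c0 * Ψ y)), Complex.real_smul, ← integral_const_mul]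
          congr 1; ext x
          rw [inv_smul_smul₀ ha, Module.finrank_fin_fun]
          have hp : (‖a‖ : ℂ) ≠ 0 := by simpa using ha
          push_cast
          rw [mul_add, pow_add]
          field_simp
      _ = C0 * ∫ y, c0 * Ψ y := aux_polar _ (hΨi.const_mul c0)
      _ = _ := by rw [integral_const_mul, mul_assoc]
  have hL : ∫ p, g (auxDot p.1 p.2) * Φ p ∂(volume.prod volume) = ∫ y, Ψ y :=
    integral_prod _ hgΦ
  rw [hL]
  calc _ = (C0 * c0)⁻¹ * (C0 * c0 * ∫ y, Ψ y) := by
        rw [← mul_assoc, inv_mul_cancel₀ (mul_ne_zero hC0 hc0), one_mul]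
    _ = _ := by
      rw [← hR, ← integral_const_mul]
      congr 1; ext p
      simp only [smul_apply, smul_eq_mul]
      ring

/-- additive characters -/
def auxE (w ξ : ℂ) : ℂ := Complex.exp ((2 * Real.pi * inner ℝ w ξ : ℝ) * Complex.I)

theorem aux_E_norm (w ξ : ℂ) : ‖auxE w ξ‖ = 1 := by
  rw [auxE, Complex.norm_exp_ofReal_mul_I]

theorem aux_E_add (w ξ η : ℂ) : auxE w (ξ + η) = auxE w ξ * auxE w η := by
  simp only [auxE]
  rw [← Complex.exp_add, inner_add_right]
  congr 1; push_cast; ring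

theorem aux_E_cont : Continuous (fun q : ℂ × ℂ => auxE q.1 q.2) := by
  unfold auxE; fun_prop

theorem aux_int_growth (Φ : 𝓢(ℂ × ℂ, ℂ)) (f : ℂ × ℂ → ℂ) (hf : Continuous f) (N : ℕ) (C : ℝ)
    (hC : ∀ p, ‖f p‖ ≤ C * (1 + ‖p‖) ^ N) : Integrable (fun p => f p * Φ p) := by
  obtain ⟨K, hK0, hK⟩ := aux_schwartz_bound Φ (N + 5) 0
  have hIntg : Integrable (fun v : ℂ × ℂ => (1 + ‖v‖) ^ (-((5 : ℕ) : ℝ))) := by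
    rw [Measure.volume_eq_prod]
    refine integrable_one_add_norm ?_
    simp
    norm_num
  refine (hIntg.const_mul (C * K)).mono' (hf.mul Φ.continuous).aestronglyMeasurable
    (ae_of_all _ fun p => ?_)
  have h1 := hK p
  rw [norm_iteratedFDeriv_zero] at h1
  have hC0 : 0 ≤ C := by
    have := (norm_nonneg _).trans (hC 0)
    simpa using this
  rw [norm_mul, Real.rpow_neg (by positivity), Real.rpow_natCast, ← div_eq_mul_inv,
    le_div_iff₀ (by positivity)]
  calc _ ≤ C * (1 + ‖p‖) ^ N * ‖Φ p‖ * (1 + ‖p‖) ^ 5 := by gcongr; exact hC p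
    _ = C * ((1 + ‖p‖) ^ (N + 5) * ‖Φ p‖) := by rw [pow_add]; ring
    _ ≤ _ := by gcongr

open scoped LineDeriv in
theorem aux_ibp (w u : ℂ) (h : ℂ → ℂ) (hc : Continuous h) (N : ℕ) (C : ℝ)
    (hC : ∀ a, ‖h a‖ ≤ C * (1 + ‖a‖) ^ N) (Φ : 𝓢(ℂ × ℂ, ℂ)) :
    ∫ p : ℂ × ℂ, (auxE w (p.1 * p.2) * h p.1) * (∂_{((0:ℂ), u)} Φ) p =
    -∫ p : ℂ × ℂ, (auxE w (p.1 * p.2) *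
      (((2 * Real.pi * inner ℝ w (p.1 * u) : ℝ) * Complex.I) * h p.1)) * Φ p := by
  have hE : Continuous (fun p : ℂ × ℂ => auxE w (p.1 * p.2)) := by unfold auxE; fun_prop
  have hC0 : 0 ≤ C := by
    have := (norm_nonneg _).trans (hC 0)
    simpa using this
  have i1 : ∀ Ψ : 𝓢(ℂ × ℂ, ℂ), Integrable (fun p => (auxE w (p.1 * p.2) * h p.1) * Ψ p) := by
    intro Ψ
    refine aux_int_growth Ψ _ (hE.mul (hc.comp continuous_fst)) N C fun p => ?_
    rw [norm_mul, aux_E_norm, one_mul]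
    refine (hC _).trans ?_
    gcongr
    exact norm_fst_le p
  have i2 : Integrable (fun p => (auxE w (p.1 * p.2) *
      (((2 * Real.pi * inner ℝ w (p.1 * u) : ℝ) * Complex.I) * h p.1)) * Φ p) := by
    refine aux_int_growth Φ _ (hE.mul (by fun_prop)) (N + 1) (2 * Real.pi * ‖w‖ * ‖u‖ * C) fun p => ?_
    rw [norm_mul, aux_E_norm, one_mul, norm_mul, norm_mul, Complex.norm_I, Complex.norm_real,
      norm_mul, mul_one, Real.norm_of_nonneg (by positivity)]
    calc _ ≤ 2 * Real.pi * (‖w‖ * ‖p.1 * u‖) * (C * (1 + ‖p.1‖) ^ N) := by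
          gcongr
          · exact norm_inner_le_norm _ _
          · exact hC _
      _ ≤ 2 * Real.pi * (‖w‖ * ((1 + ‖p‖) * ‖u‖)) * (C * (1 + ‖p‖) ^ N) := by
          rw [norm_mul]
          have := norm_fst_le p
          gcongr
          linarith
      _ = _ := by rw [pow_succ]; ring
  have hvol : (volume : Measure (ℂ × ℂ)).IsAddHaarMeasure :=
    inferInstanceAs ((volume : Measure ℂ).prod (volume : Measure ℂ)).IsAddHaarMeasure
  refine integral_bilinear_hasLineDerivAt_right_eq_neg_left_of_integrable
    (B := ContinuousLinearMap.mul ℝ ℂ) (v := ((0:ℂ), u)) i2 (i1 _) (i1 _) ?_ ?_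
  · intro p _
    unfold HasLineDerivAt
    have h1 : HasDerivAt (fun t : ℝ => (2 * Real.pi * inner ℝ w (p.1 * (p.2 + t • u)) : ℝ))
        (2 * Real.pi * inner ℝ w (p.1 * u)) 0 := by
      have e : (fun t : ℝ => (2 * Real.pi * inner ℝ w (p.1 * (p.2 + t • u)) : ℝ)) =
          fun t : ℝ => 2 * Real.pi * inner ℝ w (p.1 * p.2) +
            t * (2 * Real.pi * inner ℝ w (p.1 * u)) := by
        ext t
        rw [mul_add, inner_add_right, mul_smul_comm, inner_smul_right]
        ring
      rw [e]
      simpa using ((hasDerivAt_id (0:ℝ)).mul_const (2 * Real.pi * inner ℝ w (p.1 * u))).const_add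
        (2 * Real.pi * inner ℝ w (p.1 * p.2))
    have h2 := ((h1.ofReal_comp.mul_const Complex.I).cexp).mul_const (h p.1)
    simp only [Prod.fst_add, Prod.snd_add, Prod.smul_fst, Prod.smul_snd, smul_zero, add_zero]
    unfold auxE
    rw [zero_smul, add_zero, mul_assoc] at h2
    exact h2
  · intro p _
    have := (Φ.differentiableAt (x := p)).hasFDerivAt.hasLineDerivAt ((0:ℂ), u)
    rwa [← SchwartzMap.lineDerivOp_apply_eq_fderiv] at this

open scoped LineDeriv in
theorem aux_ibp2 (w u : ℂ) (k : ℕ) (Φ : 𝓢(ℂ × ℂ, ℂ)) :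
    ∫ p : ℂ × ℂ, (auxE w (p.1 * p.2) * ((‖p.1‖ ^ (2 * k) : ℝ) : ℂ)) *
      (∂_{((0:ℂ), u)} (∂_{((0:ℂ), u)} Φ)) p =
    ∫ p : ℂ × ℂ, (auxE w (p.1 * p.2) * ((-(4 * Real.pi ^ 2 * (inner ℝ w (p.1 * u)) ^ 2 *
      ‖p.1‖ ^ (2 * k)) : ℝ) : ℂ)) * Φ p := by
  rw [aux_ibp w u (fun a => ((‖a‖ ^ (2 * k) : ℝ) : ℂ)) (by fun_prop) (2 * k) 1,
    aux_ibp w u (fun a => (((2 * Real.pi * inner ℝ w (a * u) : ℝ) * Complex.I) *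
      ((‖a‖ ^ (2 * k) : ℝ) : ℂ))) (by fun_prop) (2 * k + 1) (2 * Real.pi * ‖w‖ * ‖u‖), neg_neg]
  · congr 1; ext p
    push_cast
    linear_combination ((auxE w (p.1 * p.2)) * 4 * (Real.pi : ℂ) ^ 2 *
      ((inner ℝ w (p.1 * u) : ℝ) : ℂ) ^ 2 * (‖p.1‖ : ℂ) ^ (2 * k) * Φ p) * Complex.I_sq
  · intro a
    rw [norm_mul, norm_mul, Complex.norm_I, Complex.norm_real, Complex.norm_real, norm_pow,
      norm_norm, norm_mul, mul_one, Real.norm_of_nonneg (by positivity)]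
    calc _ ≤ 2 * Real.pi * (‖w‖ * ‖a * u‖) * ‖a‖ ^ (2 * k) := by
          gcongr
          exact norm_inner_le_norm _ _
      _ ≤ 2 * Real.pi * (‖w‖ * ((1 + ‖a‖) * ‖u‖)) * (1 + ‖a‖) ^ (2 * k) := by
          rw [norm_mul]
          gcongr <;> linarith [norm_nonneg a]
      _ = _ := by rw [pow_succ]; ring
  · intro a
    rw [Complex.norm_real, norm_pow, norm_norm, one_mul]
    gcongr
    linarith [norm_nonneg a]

theorem aux_inner_sq (w a : ℂ) : (inner ℝ w (a * 1) : ℝ) ^ 2 + (inner ℝ w (a * Complex.I) : ℝ) ^ 2 =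
    ‖w‖ ^ 2 * ‖a‖ ^ 2 := by
  simp only [Complex.inner, ← Complex.normSq_eq_norm_sq, Complex.normSq_apply]
  simp
  ring

open scoped LineDeriv in
theorem aux_Lam (k : ℕ) (Φ : 𝓢(ℂ × ℂ, ℂ)) : ∃ Λ : 𝓢(ℂ × ℂ, ℂ), ∀ w : ℂ,
    ∫ p : ℂ × ℂ, auxE w (p.1 * p.2) * (Λ p * ((‖p.1‖ ^ (2 * k) : ℝ) : ℂ)) =
    ((1 + ‖w‖ ^ 2 : ℝ) : ℂ) *
      ∫ p : ℂ × ℂ, auxE w (p.1 * p.2) * (Φ p * ((‖p.1‖ ^ (2 * (k + 1)) : ℝ) : ℂ)) := by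
  have htg : Function.HasTemperateGrowth (fun p : ℂ × ℂ => ((‖p.1‖ ^ 2 : ℝ) : ℂ)) := by
    have h1 : Function.HasTemperateGrowth (fun p : ℂ × ℂ => p.1) :=
      (ContinuousLinearMap.fst ℝ ℂ ℂ).hasTemperateGrowth
    exact Function.HasTemperateGrowth.comp Function.Complex.hasTemperateGrowth_ofReal
      (Function.HasTemperateGrowth.comp (Function.hasTemperateGrowth_norm_sq ℂ) h1)
  set A := SchwartzMap.smulLeftCLM ℂ (fun p : ℂ × ℂ => ((‖p.1‖ ^ 2 : ℝ) : ℂ)) Φ with hA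
  set B := ∂_{((0:ℂ), (1:ℂ))} (∂_{((0:ℂ), (1:ℂ))} Φ) with hB
  set D := ∂_{((0:ℂ), Complex.I)} (∂_{((0:ℂ), Complex.I)} Φ) with hD
  refine ⟨A - (((4 * Real.pi ^ 2)⁻¹ : ℝ) : ℂ) • (B + D), fun w => ?_⟩
  have hE : Continuous (fun p : ℂ × ℂ => auxE w (p.1 * p.2)) := by unfold auxE; fun_prop
  have hi : ∀ (Ψ : 𝓢(ℂ × ℂ, ℂ)), Integrable
      (fun p : ℂ × ℂ => (auxE w (p.1 * p.2) * ((‖p.1‖ ^ (2 * k) : ℝ) : ℂ)) * Ψ p) := by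
    intro Ψ
    refine aux_int_growth Ψ _ (hE.mul (by fun_prop)) (2 * k) 1 fun p => ?_
    rw [norm_mul, aux_E_norm, one_mul, Complex.norm_real, norm_pow, norm_norm, one_mul]
    gcongr
    linarith [norm_fst_le p]
  have hi2 : ∀ u : ℂ, Integrable (fun p : ℂ × ℂ => (auxE w (p.1 * p.2) *
      ((-(4 * Real.pi ^ 2 * (inner ℝ w (p.1 * u)) ^ 2 * ‖p.1‖ ^ (2 * k)) : ℝ) : ℂ)) * Φ p) := by
    intro u
    refine aux_int_growth Φ _ (hE.mul (by fun_prop)) (2 * k + 2)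
      (4 * Real.pi ^ 2 * (‖w‖ * ‖u‖) ^ 2) fun p => ?_
    rw [norm_mul, aux_E_norm, one_mul, Complex.norm_real, norm_neg, norm_mul, norm_mul, norm_pow,
      norm_pow, norm_norm, Real.norm_of_nonneg (by positivity)]
    calc _ ≤ 4 * Real.pi ^ 2 * (‖w‖ * ‖p.1 * u‖) ^ 2 * ‖p.1‖ ^ (2 * k) := by
          gcongr
          exact norm_inner_le_norm _ _
      _ ≤ 4 * Real.pi ^ 2 * (‖w‖ * ((1 + ‖p‖) * ‖u‖)) ^ 2 * (1 + ‖p‖) ^ (2 * k) := by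
          rw [norm_mul]
          gcongr <;> linarith [norm_fst_le p]
      _ = _ := by rw [pow_add]; ring
  have hB2 := aux_ibp2 w 1 k Φ
  have hD2 := aux_ibp2 w Complex.I k Φ
  rw [← hB] at hB2
  rw [← hD] at hD2
  have hpi : (Real.pi : ℂ) ≠ 0 := by exact_mod_cast Real.pi_ne_zero
  calc _ = ∫ p : ℂ × ℂ, ((auxE w (p.1 * p.2) * ((‖p.1‖ ^ (2 * k) : ℝ) : ℂ)) * A p -
        (((4 * Real.pi ^ 2)⁻¹ : ℝ) : ℂ) * ((auxE w (p.1 * p.2) * ((‖p.1‖ ^ (2 * k) : ℝ) : ℂ)) * B p +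
          (auxE w (p.1 * p.2) * ((‖p.1‖ ^ (2 * k) : ℝ) : ℂ)) * D p)) := by
        congr 1; ext p
        simp only [sub_apply, add_apply, smul_apply, smul_eq_mul]
        ring
    _ = _ := by
      have hBD : Integrable (fun p : ℂ × ℂ => (((4 * Real.pi ^ 2)⁻¹ : ℝ) : ℂ) *
          ((auxE w (p.1 * p.2) * ((‖p.1‖ ^ (2 * k) : ℝ) : ℂ)) * B p +
          (auxE w (p.1 * p.2) * ((‖p.1‖ ^ (2 * k) : ℝ) : ℂ)) * D p)) :=
        ((hi B).add (hi D)).const_mul _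
      have hBD2 : Integrable (fun p : ℂ × ℂ => (((4 * Real.pi ^ 2)⁻¹ : ℝ) : ℂ) *
          ((auxE w (p.1 * p.2) *
      ((-(4 * Real.pi ^ 2 * (inner ℝ w (p.1 * 1)) ^ 2 * ‖p.1‖ ^ (2 * k)) : ℝ) : ℂ)) * Φ p +
          (auxE w (p.1 * p.2) *
      ((-(4 * Real.pi ^ 2 * (inner ℝ w (p.1 * Complex.I)) ^ 2 * ‖p.1‖ ^ (2 * k)) : ℝ) : ℂ)) * Φ p)) :=
        ((hi2 1).add (hi2 Complex.I)).const_mul _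
      rw [integral_sub (hi A) hBD, integral_const_mul,
        integral_add (hi B) (hi D), hB2, hD2, ← integral_add (hi2 _) (hi2 _),
        ← integral_const_mul, ← integral_const_mul, ← integral_sub (hi A) hBD2]
      congr 1; ext p
      rw [hA, SchwartzMap.smulLeftCLM_apply_apply htg, smul_eq_mul]
      have h1 : (((inner ℝ w (p.1 * 1) : ℝ) : ℂ)) ^ 2 + ((inner ℝ w (p.1 * Complex.I) : ℝ) : ℂ) ^ 2 =
          (‖w‖ : ℂ) ^ 2 * (‖p.1‖ : ℂ) ^ 2 := by exact_mod_cast aux_inner_sq w p.1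
      have h2 : (4 * (Real.pi:ℂ) ^ 2)⁻¹ * (4 * (Real.pi:ℂ) ^ 2) = 1 := inv_mul_cancel₀ (by simp [hpi])
      push_cast
      rw [mul_add 2 k 1, pow_add]
      linear_combination (auxE w (p.1 * p.2) * (‖p.1‖ : ℂ) ^ (2 * k) * Φ p) * h1 +
        (auxE w (p.1 * p.2) * (‖p.1‖ : ℂ) ^ (2 * k) * Φ p *
          ((((inner ℝ w (p.1 * 1) : ℝ) : ℂ)) ^ 2 + ((inner ℝ w (p.1 * Complex.I) : ℝ) : ℂ) ^ 2)) * h2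


theorem aux_gaussC : ∃ Γ : 𝓢(ℂ × ℂ, ℂ), ∀ w : ℂ,
    ∫ q : ℂ × ℂ, auxE w (q.1 * q.2) * Γ q = (((1 + ‖w‖ ^ 2)⁻¹ : ℝ) : ℂ) := by
  have htg : Function.HasTemperateGrowth
      (fun q : ℂ × ℂ => Real.pi * (‖q.1‖ ^ 2 + ‖q.2‖ ^ 2)) := by
    have h1 : Function.HasTemperateGrowth (fun p : ℂ × ℂ => p.1) :=
      (ContinuousLinearMap.fst ℝ ℂ ℂ).hasTemperateGrowth
    have h2 : Function.HasTemperateGrowth (fun p : ℂ × ℂ => p.2) :=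
      (ContinuousLinearMap.snd ℝ ℂ ℂ).hasTemperateGrowth
    exact (Function.HasTemperateGrowth.const Real.pi).mul
      ((Function.HasTemperateGrowth.comp (Function.hasTemperateGrowth_norm_sq ℂ) h1).add
      (Function.HasTemperateGrowth.comp (Function.hasTemperateGrowth_norm_sq ℂ) h2))
  obtain ⟨Γ, hΓ⟩ := aux_gauss _ htg (fun q => by
    have h3 : ‖q‖ ^ 2 ≤ ‖q.1‖ ^ 2 + ‖q.2‖ ^ 2 := by
      rw [Prod.norm_def]
      rcases max_choice ‖q.1‖ ‖q.2‖ with h | h <;> rw [h] <;> nlinarith [sq_nonneg ‖q.1‖, sq_nonneg ‖q.2‖]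
    have : 0 ≤ ‖q.1‖ ^ 2 + ‖q.2‖ ^ 2 := by positivity
    nlinarith [Real.pi_gt_three])
  refine ⟨Γ, fun w => ?_⟩
  have hE : Continuous (fun p : ℂ × ℂ => auxE w (p.1 * p.2)) := by unfold auxE; fun_prop
  have hIntg : Integrable (fun q : ℂ × ℂ => auxE w (q.1 * q.2) * Γ q) :=
    aux_int_growth Γ _ hE 0 1 fun p => by rw [aux_E_norm]; simp
  have hpi : (Real.pi : ℂ) ≠ 0 := by exact_mod_cast Real.pi_ne_zero
  have hin : ∀ x : ℂ, ∫ y : ℂ, auxE w (x * y) * Γ (x, y) =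
      Complex.exp (-((Real.pi * (1 + ‖w‖ ^ 2) : ℝ) : ℂ) * (‖x‖ : ℂ) ^ 2) := by
    intro x
    have h1 := GaussianFourier.integral_cexp_neg_mul_sq_norm_add (V := ℂ) (b := (Real.pi : ℂ))
      (by simpa using Real.pi_pos) (2 * Real.pi * Complex.I) ((starRingEnd ℂ) x * w)
    have h2 : ∀ y : ℂ, auxE w (x * y) * Γ (x, y) =
      Complex.exp (-(Real.pi : ℂ) * (‖x‖ : ℂ) ^ 2) * Complex.exp (-(Real.pi : ℂ) * (‖y‖ : ℂ) ^ 2 +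
        2 * Real.pi * Complex.I * ((inner ℝ ((starRingEnd ℂ) x * w) y : ℝ) : ℂ)) := by
      intro y
      have h3 : (inner ℝ ((starRingEnd ℂ) x * w) y : ℝ) = inner ℝ w (x * y) := by
        simp only [Complex.inner, map_mul, Complex.conj_conj]
        congr 1; ring
      rw [h3, hΓ, auxE, Complex.ofReal_exp, ← Complex.exp_add, ← Complex.exp_add]
      congr 1
      push_cast
      ring
    simp_rw [h2]
    rw [integral_const_mul, h1, Complex.finrank_real_complex, div_self hpi, Complex.one_cpow, one_mul,
      ← Complex.exp_add, norm_mul, RCLike.norm_conj]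
    congr 1
    push_cast
    field_simp
    rw [Complex.I_sq]
    ring
  have hpos : 0 < Real.pi * (1 + ‖w‖ ^ 2) := by positivity
  rw [Measure.volume_eq_prod] at hIntg ⊢
  rw [integral_prod _ hIntg]
  simp_rw [hin]
  rw [GaussianFourier.integral_cexp_neg_mul_sq_norm (V := ℂ) (by rw [Complex.ofReal_re]; exact hpos),
    Complex.finrank_real_complex]
  have h0 : (1 + (‖w‖ : ℂ) ^ 2) ≠ 0 := by
    have : (1 + ‖w‖ ^ 2 : ℝ) ≠ 0 := by positivity
    exact_mod_cast this
  push_cast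
  rw [div_self two_ne_zero, Complex.cpow_one]
  field_simp

theorem aux_partII_exp (k : ℕ) : ∀ Φ₂ : 𝓢(ℂ × ℂ, ℂ),
    ∃ Φ : 𝓢((Fin (k+1) → ℂ) × (Fin (k+1) → ℂ), ℂ), ∀ w : ℂ,
    ∫ p, auxE w (auxDot p.1 p.2) * Φ p ∂(volume.prod volume) =
      ∫ p : ℂ × ℂ, auxE w (p.1 * p.2) * (Φ₂ p * ((‖p.1‖ ^ (2 * k) : ℝ) : ℂ)) := by
  induction k with
  | zero =>
    intro Φ₂
    let e := ContinuousLinearEquiv.funUnique (Fin 1) ℝ ℂ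
    let E : ((Fin 1 → ℂ) × (Fin 1 → ℂ)) ≃L[ℝ] (ℂ × ℂ) := e.prodCongr e
    refine ⟨SchwartzMap.compCLMOfContinuousLinearEquiv ℂ E Φ₂, fun w => ?_⟩
    have hm := (volume_preserving_funUnique (Fin 1) ℂ)
    have hmp := hm.prod hm
    have := hmp.integral_comp ((MeasurableEquiv.funUnique (Fin 1) ℂ).prodCongr
      (MeasurableEquiv.funUnique (Fin 1) ℂ)).measurableEmbedding
      (fun p : ℂ × ℂ => auxE w (p.1 * p.2) * (Φ₂ p * ((‖p.1‖ ^ (2 * 0) : ℝ) : ℂ)))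
    rw [Measure.volume_eq_prod ℂ ℂ, ← this]
    congr 1; ext p
    have hd : auxDot p.1 p.2 = p.1 0 * p.2 0 := by simp [auxDot]
    rw [hd]
    rw [mul_zero, pow_zero, Complex.ofReal_one, mul_one]
    rfl
  | succ k ih =>
    intro Φ₂
    obtain ⟨Λ, hΛ⟩ := aux_Lam k Φ₂
    obtain ⟨Φ', hΦ'⟩ := ih Λ
    obtain ⟨Γ, hΓ⟩ := aux_gaussC
    obtain ⟨F, hF⟩ := aux_tensor Γ Φ'
    let e : (Fin (k+1+1) → ℂ) ≃L[ℝ] ℂ × (Fin (k+1) → ℂ) :=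
      (Fin.consEquivL ℝ (fun _ : Fin (k+1+1) => ℂ)).symm
    let E : ((Fin (k+1+1) → ℂ) × (Fin (k+1+1) → ℂ)) ≃L[ℝ]
        (ℂ × ℂ) × ((Fin (k+1) → ℂ) × (Fin (k+1) → ℂ)) :=
      (e.prodCongr e).trans (ContinuousLinearEquiv.prodProdProdComm ℝ _ _ _ _)
    have hEa : ∀ p, E p = ((p.1 0, p.2 0), (fun i => p.1 i.succ, fun i => p.2 i.succ)) := fun p => rfl
    refine ⟨SchwartzMap.compCLMOfContinuousLinearEquiv ℂ E F, fun w => ?_⟩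
    have hm := volume_preserving_piFinSuccAbove (fun _ : Fin (k+1+1) => ℂ) 0
    have hmp := hm.prod hm
    have hmp2 := (aux_reorder_mp (A := ℂ) (B := Fin (k+1) → ℂ) (X := ℂ) (Z := Fin (k+1) → ℂ)).comp hmp
    have := hmp2.integral_comp ((auxReorder ℂ (Fin (k+1) → ℂ) ℂ (Fin (k+1) → ℂ)).measurableEmbedding.comp
      ((MeasurableEquiv.piFinSuccAbove (fun _ : Fin (k+1+1) => ℂ) 0).prodCongr
      (MeasurableEquiv.piFinSuccAbove (fun _ : Fin (k+1+1) => ℂ) 0)).measurableEmbedding)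
      (fun p : (ℂ × ℂ) × ((Fin (k+1) → ℂ) × (Fin (k+1) → ℂ)) =>
        (auxE w (p.1.1 * p.1.2) * Γ p.1) * (auxE w (auxDot p.2.1 p.2.2) * Φ' p.2))
    rw [integral_prod_mul (fun q : ℂ × ℂ => auxE w (q.1 * q.2) * Γ q)
      (fun q : (Fin (k+1) → ℂ) × (Fin (k+1) → ℂ) => auxE w (auxDot q.1 q.2) * Φ' q), hΦ', hΛ,
      ← Measure.volume_eq_prod ℂ ℂ, hΓ, ← mul_assoc, ← Complex.ofReal_mul,
      inv_mul_cancel₀ (by positivity), Complex.ofReal_one, one_mul] at this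
    rw [← this]
    congr 1; ext p
    have hd : auxDot p.1 p.2 = p.1 0 * p.2 0 +
      auxDot (fun i : Fin (k+1) => p.1 i.succ) (fun i : Fin (k+1) => p.2 i.succ) := by
      simp only [auxDot]; rw [Fin.sum_univ_succ]
    have h2 : SchwartzMap.compCLMOfContinuousLinearEquiv ℂ E F p =
      Γ (p.1 0, p.2 0) * Φ' (fun i => p.1 i.succ, fun i => p.2 i.succ) := by
      change F (E p) = _
      rw [hEa, hF]
    rw [h2, hd, aux_E_add]
    change _ = (auxE w (p.1 0 * p.2 0) * Γ (p.1 0, p.2 0)) * (auxE w (auxDot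
      (fun i : Fin (k+1) => p.1 i.succ) (fun i : Fin (k+1) => p.2 i.succ)) *
      Φ' (fun i => p.1 i.succ, fun i => p.2 i.succ))
    ring


open scoped FourierTransform in
theorem aux_fourier_rep (g : 𝓢(ℂ, ℂ)) : ∃ G : 𝓢(ℂ, ℂ), ∀ ξ, g ξ = ∫ w, auxE w ξ * G w := by
  refine ⟨𝓕 g, fun ξ => ?_⟩
  have h1 : g = 𝓕⁻ (𝓕 g) := (FourierTransform.fourierInv_fourier_eq g).symm
  generalize (𝓕 g : 𝓢(ℂ, ℂ)) = G at *
  rw [h1, SchwartzMap.fourierInv_coe, Real.fourierInv_eq']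
  rfl

theorem aux_E_meas {X : Type*} [MeasurableSpace X] (u : X → ℂ) (hu : Measurable u) :
    Measurable (fun q : X × ℂ => auxE q.2 (u q.1)) := by
  have hm0 : Measurable (fun q : X × ℂ => u q.1) := hu.comp measurable_fst
  unfold auxE
  have h1 : Measurable (fun q : X × ℂ => (inner ℝ q.2 (u q.1) : ℝ)) :=
    Measurable.inner measurable_snd hm0
  fun_prop

theorem aux_swap {X : Type*} [MeasurableSpace X] (μ : Measure X) [SFinite μ] (u : X → ℂ)
    (hu : Measurable u) (F : X → ℂ) (hF : Integrable F μ) (G : 𝓢(ℂ, ℂ)) :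
    ∫ x, (∫ w, auxE w (u x) * G w) * F x ∂μ = ∫ w, G w * ∫ x, auxE w (u x) * F x ∂μ := by
  have hIntg : Integrable (fun q : X × ℂ => auxE q.2 (u q.1) * (F q.1 * G q.2))
      (μ.prod volume) := by
    have hm : Measurable (fun q : X × ℂ => auxE q.2 (u q.1)) := aux_E_meas u hu
    have hb : ∀ᵐ q : X × ℂ ∂(μ.prod volume), ‖auxE q.2 (u q.1)‖ ≤ 1 :=
      ae_of_all _ fun q => (aux_E_norm _ _).le
    have hp : Integrable (fun q : X × ℂ => F q.1 * G q.2) (μ.prod volume) :=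
      Integrable.mul_prod (f := F) (g := fun w => G w) hF G.integrable
    exact hp.bdd_mul hm.aestronglyMeasurable hb
  calc _ = ∫ x, (∫ w, auxE w (u x) * (F x * G w)) ∂μ := by
        congr 1; ext x
        rw [← integral_mul_const]
        congr 1; ext w; ring
    _ = ∫ w, (∫ x, auxE w (u x) * (F x * G w) ∂μ) := integral_integral_swap hIntg
    _ = _ := by
        congr 1; ext w
        rw [← integral_const_mul]
        congr 1; ext x; ring

theorem aux_approx {X : Type*} [MeasurableSpace X] (μ : Measure X) (u : X → ℂ)
    (hu : Measurable u) (F : X → ℂ) (hF : Integrable F μ) (g h : ℂ → ℂ) (hg : Continuous g)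
    (hh : Continuous h) (C : ℝ) (hC : ∀ x, ‖h x‖ ≤ C) (ε : ℝ) (hε : ∀ x, ‖g x - h x‖ ≤ ε) :
    ‖∫ x, g (u x) * F x ∂μ - ∫ x, h (u x) * F x ∂μ‖ ≤ ε * ∫ x, ‖F x‖ ∂μ := by
  have i1 : Integrable (fun x => h (u x) * F x) μ :=
    hF.bdd_mul (hh.measurable.comp hu).aestronglyMeasurable (ae_of_all _ fun x => hC _)
  have i2 : Integrable (fun x => (g (u x) - h (u x)) * F x) μ :=
    hF.bdd_mul (c := ε) ((hg.sub hh).measurable.comp hu).aestronglyMeasurable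
      (ae_of_all _ fun x => hε _)
  have i3 : Integrable (fun x => g (u x) * F x) μ := by
    refine (i1.add i2).congr (ae_of_all _ fun x => ?_)
    simp only [Pi.add_apply]; ring
  rw [← integral_sub i3 i1, ← integral_const_mul]
  refine norm_integral_le_of_norm_le (hF.norm.const_mul _) (ae_of_all _ fun x => ?_)
  rw [← sub_mul, norm_mul]
  gcongr
  exact hε _

theorem aux_exp_to_g {X Y : Type*} [MeasurableSpace X] [MeasurableSpace Y] (μ : Measure X)
    (ν : Measure Y) [SFinite μ] [SFinite ν] (u : X → ℂ) (hu : Measurable u) (v : Y → ℂ)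
    (hv : Measurable v) (F : X → ℂ) (hF : Integrable F μ) (G : Y → ℂ) (hG : Integrable G ν)
    (h : ∀ w, ∫ x, auxE w (u x) * F x ∂μ = ∫ y, auxE w (v y) * G y ∂ν)
    (g : ℂ → ℂ) (hg : Continuous g) (hgs : HasCompactSupport g) :
    ∫ x, g (u x) * F x ∂μ = ∫ y, g (v y) * G y ∂ν := by
  have key : ∀ ε : ℝ, 0 < ε → ‖∫ x, g (u x) * F x ∂μ - ∫ y, g (v y) * G y ∂ν‖ ≤
      ε * (∫ x, ‖F x‖ ∂μ + ∫ y, ‖G y‖ ∂ν) := by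
    intro ε hε
    obtain ⟨f, hf1, hf2, hf3⟩ := hg.exists_contDiff_approx ⊤ (ε := fun _ ↦ ε) (by fun_prop)
      (by intro; exact hε)
    have hfs : HasCompactSupport f := hgs.mono hf3
    let f' : 𝓢(ℂ, ℂ) := hfs.toSchwartzMap (by exact_mod_cast hf1)
    have hff : ∀ x, f x = f' x := fun x => rfl
    obtain ⟨H, hH⟩ := aux_fourier_rep f'
    have e : ∫ x, f (u x) * F x ∂μ = ∫ y, f (v y) * G y ∂ν := by
      simp_rw [hff, hH]
      rw [aux_swap μ u hu F hF H, aux_swap ν v hv G hG H]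
      simp_rw [h]
    have hfc : Continuous f := hf1.continuous
    obtain ⟨C, hC⟩ := hfs.exists_bound_of_continuous hfc
    have hd : ∀ x, ‖g x - f x‖ ≤ ε := fun x => by
      have := (hf2 x).le
      rwa [dist_comm, dist_eq_norm] at this
    have a1 := aux_approx μ u hu F hF g f hg hfc C hC ε hd
    have a2 := aux_approx ν v hv G hG g f hg hfc C hC ε hd
    rw [← e] at a2
    have := norm_sub_le (∫ x, g (u x) * F x ∂μ - ∫ x, f (u x) * F x ∂μ)
      (∫ y, g (v y) * G y ∂ν - ∫ x, f (u x) * F x ∂μ)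
    rw [sub_sub_sub_cancel_right] at this
    linarith
  rw [← sub_eq_zero, ← norm_le_zero_iff]
  have hS : 0 ≤ ∫ x, ‖F x‖ ∂μ + ∫ y, ‖G y‖ ∂ν :=
    add_nonneg (integral_nonneg fun _ => norm_nonneg _) (integral_nonneg fun _ => norm_nonneg _)
  refine le_of_forall_pos_le_add fun δ hδ => ?_
  refine (key (δ / (∫ x, ‖F x‖ ∂μ + ∫ y, ‖G y‖ ∂ν + 1)) (by positivity)).trans ?_
  rw [zero_add, div_mul_eq_mul_div, div_le_iff₀ (by positivity)]
  nlinarith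

theorem aux_partII (k : ℕ) (Φ₂ : 𝓢(ℂ × ℂ, ℂ)) :
    ∃ Φ : 𝓢((Fin (k+1) → ℂ) × (Fin (k+1) → ℂ), ℂ), ∀ g : ℂ → ℂ, Continuous g →
      HasCompactSupport g →
    ∫ p, g (auxDot p.1 p.2) * Φ p ∂(volume.prod volume) =
      ∫ p : ℂ × ℂ, g (p.1 * p.2) * (Φ₂ p * ((‖p.1‖ ^ (2 * k) : ℝ) : ℂ)) := by
  obtain ⟨Φ, hΦ⟩ := aux_partII_exp k Φ₂
  refine ⟨Φ, fun g hg hgs => ?_⟩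
  have := Measure.prod.instIsAddHaarMeasure (volume : Measure (Fin (k+1) → ℂ))
    (volume : Measure (Fin (k+1) → ℂ))
  have hs : SFinite (volume : Measure (ℂ × ℂ)) :=
    inferInstanceAs (SFinite ((volume : Measure ℂ).prod (volume : Measure ℂ)))
  exact aux_exp_to_g (volume.prod volume) (volume : Measure (ℂ × ℂ))
    (fun p : (Fin (k+1) → ℂ) × (Fin (k+1) → ℂ) => auxDot p.1 p.2) aux_dot_cont.measurable
    (fun p : ℂ × ℂ => p.1 * p.2) (by fun_prop) Φ Φ.integrable _ (aux_int_weight k Φ₂) hΦ g hg hgs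


/-- interleaving of indices -/
def auxIdx (m : ℕ) : Fin m ⊕ Fin m ≃ Fin (2 * m) where
  toFun := Sum.elim (fun i => ⟨2 * i.1, by omega⟩) (fun i => ⟨2 * i.1 + 1, by omega⟩)
  invFun n := if n.1 % 2 = 0 then Sum.inl ⟨n.1 / 2, by omega⟩ else Sum.inr ⟨n.1 / 2, by omega⟩
  left_inv := by
    rintro (i | i)
    · simp
    · have : (2 * i.1 + 1) % 2 = 1 := by omega
      have h2 : (2 * i.1 + 1) / 2 = i.1 := by omega
      simp [this, h2]
  right_inv := by
    intro n
    dsimp only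
    split_ifs with h
    · ext; simp; omega
    · ext; simp; omega

/-- separation of even and odd coordinates -/
def auxSep (m : ℕ) : (Fin (2 * m) → ℂ) ≃L[ℝ] (Fin m → ℂ) × (Fin m → ℂ) :=
  LinearEquiv.toContinuousLinearEquiv
    { toFun := fun z => (fun i => z (auxIdx m (Sum.inl i)), fun i => z (auxIdx m (Sum.inr i)))
      map_add' := fun _ _ => rfl
      map_smul' := fun _ _ => rfl
      invFun := fun p n => Sum.elim p.1 p.2 ((auxIdx m).symm n)
      left_inv := fun z => by
        ext n
        obtain ⟨t, rfl⟩ := (auxIdx m).surjective n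
        rcases t with t | t <;> simp
      right_inv := fun p => by
        ext <;> simp }

theorem aux_L_apply (m : ℕ) (z : Fin (2 * m) → ℂ) : auxSep m z =
    (fun i => z (auxIdx m (Sum.inl i)), fun i => z (auxIdx m (Sum.inr i))) := rfl

theorem aux_L_mp (m : ℕ) : MeasurePreserving (auxSep m) volume (volume.prod volume) := by
  have h1 := (volume_measurePreserving_piCongrLeft (fun _ : Fin (2 * m) => ℂ) (auxIdx m)).symm
  have h2 := volume_measurePreserving_sumPiEquivProdPi (fun _ : Fin m ⊕ Fin m => ℂ)
  exact h2.comp h1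

theorem aux_L_int (m : ℕ) (f : (Fin m → ℂ) × (Fin m → ℂ) → ℂ) :
    ∫ z, f (auxSep m z) = ∫ p, f p ∂(volume.prod volume) :=
  (aux_L_mp m).integral_comp (auxSep m).toHomeomorph.measurableEmbedding f

theorem aux_L_split (m : ℕ) (z : Fin (2 * m) → ℂ) :
    splitQC (2 * m) z = auxDot (auxSep m z).1 (auxSep m z).2 := by
  rw [splitQC, if_pos (even_two_mul m), Nat.mul_div_cancel_left _ (by norm_num), auxDot,
    Finset.sum_range]
  refine Finset.sum_congr rfl fun i _ => ?_
  have h1 : 2 * i.1 < 2 * m := by omega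
  have h2 : 2 * i.1 + 1 < 2 * m := by omega
  rw [padC, padC, dif_pos h1, dif_pos h2]
  rfl

/-- complex, even-dimensional case of the reduction of pushforwards under
the split quadratic form in `d` variables to twisted pushforwards in `2` variables. -/
theorem pushforward_eq_twisted_pushforward_complex_even (d : ℕ) (hd : 2 ≤ d) (hde : Even d) :
    (∀ Φ₂ : SchwartzMap (ℂ × ℂ) ℂ,
      (∀ ξ : ℂ, ξ ≠ 0 → IntegrableOn
          (fun a : ℂ => Φ₂ (a, ξ / a) * ((‖a‖ ^ ((d : ℝ) - 4) : ℝ) : ℂ))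
          ({0}ᶜ : Set ℂ)) ∧
      LocallyIntegrable (hTwoC d Φ₂) volume) ∧
    (∀ Φ : SchwartzMap (Fin d → ℂ) ℂ, ∃ Φ₂ : SchwartzMap (ℂ × ℂ) ℂ,
      ∀ g : ℂ → ℂ, Continuous g → HasCompactSupport g →
        ∫ z : Fin d → ℂ, g (splitQC d z) * Φ z = ∫ ξ : ℂ, g ξ * hTwoC d Φ₂ ξ) ∧
    (∀ Φ₂ : SchwartzMap (ℂ × ℂ) ℂ, ∃ Φ : SchwartzMap (Fin d → ℂ) ℂ,
      ∀ g : ℂ → ℂ, Continuous g → HasCompactSupport g →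
        ∫ z : Fin d → ℂ, g (splitQC d z) * Φ z = ∫ ξ : ℂ, g ξ * hTwoC d Φ₂ ξ) := by
  obtain ⟨k, rfl⟩ : ∃ k, d = 2 * (k + 1) := by
    obtain ⟨r, hr⟩ := hde
    exact ⟨r - 1, by omega⟩
  refine ⟨fun Φ₂ => ⟨fun ξ hξ => aux_integrableOn k Φ₂ ξ hξ,
    (aux_hTwoC_integrable k Φ₂).locallyIntegrable⟩, fun Φ => ?_, fun Φ₂ => ?_⟩
  · obtain ⟨Φ₂, h⟩ := aux_partI k
      (SchwartzMap.compCLMOfContinuousLinearEquiv ℂ (auxSep (k + 1)).symm Φ)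
    refine ⟨Φ₂, fun g hg hgs => ?_⟩
    obtain ⟨C, hC⟩ := hgs.exists_bound_of_continuous hg
    rw [aux_rhs k Φ₂ g hg C hC, ← h g hg C hC, ← aux_L_int]
    congr 1; ext z
    rw [aux_L_split]
    change _ = _ * Φ ((auxSep (k + 1)).symm (auxSep (k + 1) z))
    rw [ContinuousLinearEquiv.symm_apply_apply]
  · obtain ⟨Φ, h⟩ := aux_partII k Φ₂
    refine ⟨SchwartzMap.compCLMOfContinuousLinearEquiv ℂ (auxSep (k + 1)) Φ, fun g hg hgs => ?_⟩
    obtain ⟨C, hC⟩ := hgs.exists_bound_of_continuous hg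
    rw [aux_rhs k Φ₂ g hg C hC, ← h g hg hgs, ← aux_L_int]
    congr 1; ext z
    rw [aux_L_split]
    rfl
end
end

section
/- Suppose d ≥ 3 is odd. For Φ₂ ∈ 𝒮(ℂ³) set h(ξ) = ∫_{ℂ∖{0}} ∫_ℂ Φ₂(u, (ξ−u²)/t, t) |t|^{d−5} du dt (an integral converging absolutely for every ξ ≠ 0 and defining a locally integrable function on ℂ). Then: (i) for every Φ ∈ 𝒮(ℂ^d) there exists Φ₂ ∈ 𝒮(ℂ³) such that ∫_{ℂ^d} g(q_d(z)) Φ(z) dz = ∫_ℂ g(ξ) h(ξ) dξ for every continuous compactly supported g : ℂ → ℂ; and (ii) conversely, for every Φ₂ ∈ 𝒮(ℂ³) there exists Φ ∈ 𝒮(ℂ^d) for which the same identity holds. -/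
open MeasureTheory Filter

noncomputable section

/-- The twisted pushforward
`h(ξ) = ∫_{ℂ∖{0}} ∫_ℂ Φ₂(u, (ξ−u²)/t, t) |t|^{d−5} du dt`. -/
def hThreeC (d : ℕ) (Φ₂ : SchwartzMap (ℂ × ℂ × ℂ) ℂ) (ξ : ℂ) : ℂ :=
  ∫ t in ({0}ᶜ : Set ℂ), ∫ u : ℂ,
    Φ₂ (u, (ξ - u ^ 2) / t, t) * ((‖t‖ ^ ((d : ℝ) - 5) : ℝ) : ℂ)

open scoped SchwartzMap FourierTransform ContDiff Topology

namespace PF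

set_option linter.unusedSectionVars false

section pft
variable {E V : Type} [NormedAddCommGroup E] [NormedSpace ℝ E]
  [NormedAddCommGroup V] [NormedSpace ℝ V] [MeasurableSpace V] [BorelSpace V]
  [FiniteDimensional ℝ V] {μ : Measure V} [μ.IsAddHaarMeasure]

/-- Partial Fourier transform in the second variable. -/
def pft (μ : Measure V) (L : V →L[ℝ] V →L[ℝ] ℝ) {W : Type} [NormedAddCommGroup W]
    [NormedSpace ℂ W] (Φ : E × V → W) (p : E × V) : W :=
  ∫ y, 𝐞 (-L y p.2) • Φ (p.1, y) ∂μ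

lemma schwartz_unif_bound {W : Type} [NormedAddCommGroup W] [NormedSpace ℝ W]
    (Φ : 𝓢(E × V, W)) (k l : ℕ) :
    ∃ C : ℝ, ∀ e y, ‖(e, y)‖ ^ k * ‖Φ (e, y)‖ ≤ C * (1 + ‖y‖) ^ (-(l : ℝ)) := by
  obtain ⟨C1, _, h1⟩ := Φ.decay k 0
  obtain ⟨C2, _, h2⟩ := Φ.decay (k + l) 0
  refine ⟨2 ^ l * (C1 + C2), fun e y => ?_⟩
  have h1' := h1 (e, y)
  have h2' := h2 (e, y)
  simp only [norm_iteratedFDeriv_zero] at h1' h2'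
  have := pow_mul_le_of_le_of_pow_mul_le (C₁ := C1) (C₂ := C2) (k := 0) (l := l) (x := ‖y‖)
    (f := ‖(e, y)‖ ^ k * ‖Φ (e, y)‖) (norm_nonneg _) (by positivity) h1' (by
      refine le_trans ?_ h2'
      rw [zero_add]
      have : ‖y‖ ≤ ‖(e, y)‖ := norm_snd_le (e, y)
      calc ‖y‖ ^ l * (‖(e, y)‖ ^ k * ‖Φ (e, y)‖) ≤ ‖(e, y)‖ ^ l * (‖(e, y)‖ ^ k * ‖Φ (e, y)‖) := by
            gcongr
        _ = _ := by ring)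
  simpa using this

lemma slice_integrable {W : Type} [NormedAddCommGroup W] [NormedSpace ℝ W]
    (Φ : 𝓢(E × V, W)) (e : E) : Integrable (fun y => Φ (e, y)) μ := by
  obtain ⟨C, hC⟩ := schwartz_unif_bound Φ 0 μ.integrablePower
  refine ((Measure.integrable_pow_neg_integrablePower μ).const_mul C).mono'
    (Continuous.aestronglyMeasurable (by fun_prop)) (ae_of_all _ fun y => ?_)
  simpa using hC e y

lemma char_slice_integrable (L : V →L[ℝ] V →L[ℝ] ℝ) {W : Type} [NormedAddCommGroup W]
    [NormedSpace ℂ W] (Φ : 𝓢(E × V, W)) (p : E × V) :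
    Integrable (fun y => 𝐞 (-L y p.2) • Φ (p.1, y)) μ := by
  have := (VectorFourier.fourierIntegral_convergent_iff (μ := μ) Real.continuous_fourierChar
      (by apply L.continuous₂ : Continuous (fun p : V × V ↦ L.toLinearMap₁₂ p.1 p.2)) p.2).2
      (slice_integrable (μ := μ) Φ p.1)
  exact this

lemma pft_bound (L : V →L[ℝ] V →L[ℝ] ℝ) {W : Type} [NormedAddCommGroup W]
    [NormedSpace ℂ W] (Φ : 𝓢(E × V, W)) (k : ℕ) :
    ∃ C : ℝ, ∀ p : E × V, ‖p.1‖ ^ k * ‖pft μ L Φ p‖ ≤ C := by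
  obtain ⟨C, hC⟩ := schwartz_unif_bound Φ k μ.integrablePower
  refine ⟨∫ y, C * (1 + ‖y‖) ^ (-(μ.integrablePower : ℝ)) ∂μ, fun p => ?_⟩
  have h1 : ‖pft μ L Φ p‖ ≤ ∫ y, ‖Φ (p.1, y)‖ ∂μ := by
    refine (norm_integral_le_integral_norm _).trans (le_of_eq ?_)
    simp [Circle.norm_smul]
  calc ‖p.1‖ ^ k * ‖pft μ L Φ p‖ ≤ ‖p.1‖ ^ k * ∫ y, ‖Φ (p.1, y)‖ ∂μ := by gcongr
    _ = ∫ y, ‖p.1‖ ^ k * ‖Φ (p.1, y)‖ ∂μ := by rw [integral_const_mul]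
    _ ≤ _ := by
      refine integral_mono ((slice_integrable Φ p.1).norm.const_mul _)
        ((Measure.integrable_pow_neg_integrablePower μ).const_mul C) fun y => ?_
      refine le_trans ?_ (hC p.1 y)
      have : ‖p.1‖ ≤ ‖(p.1, y)‖ := norm_fst_le (p.1, y)
      dsimp only
      gcongr

/-- The Schwartz function whose partial Fourier transform is the derivative of that of `Φ`. -/
def dpft (L : V →L[ℝ] V →L[ℝ] ℝ) {W : Type} [NormedAddCommGroup W]
    [NormedSpace ℂ W] (Φ : 𝓢(E × V, W)) : 𝓢(E × V, (E × V) →L[ℝ] W) :=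
  SchwartzMap.postcompCLM (𝕜 := ℝ)
    (ContinuousLinearMap.precomp W ((ContinuousLinearMap.inl ℝ E V).comp
      (ContinuousLinearMap.fst ℝ E V))) (SchwartzMap.fderivCLM ℝ (E × V) W Φ)
  + (-(2 * Real.pi * Complex.I)) • SchwartzMap.smulRightCLM ℂ W
      ((ContinuousLinearMap.precomp ℝ (ContinuousLinearMap.snd ℝ E V)).comp
        (L.comp (ContinuousLinearMap.snd ℝ E V))) Φ

lemma dpft_apply (L : V →L[ℝ] V →L[ℝ] ℝ) {W : Type} [NormedAddCommGroup W]
    [NormedSpace ℂ W] (Φ : 𝓢(E × V, W)) (q w : E × V) :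
    dpft L Φ q w = fderiv ℝ Φ q (w.1, 0) + (-(2 * Real.pi * Complex.I)) • (L q.2 w.2) • Φ q := rfl

lemma hasFDerivAt_pft_aux (L : V →L[ℝ] V →L[ℝ] ℝ) {W : Type} [NormedAddCommGroup W]
    [NormedSpace ℂ W] (Φ : 𝓢(E × V, W)) (q : E × V) (y : V) :
    HasFDerivAt (fun q : E × V => 𝐞 (-L y q.2) • Φ (q.1, y))
      (𝐞 (-L y q.2) • dpft L Φ (q.1, y)) q := by
  have h1 : HasFDerivAt (fun q : E × V => ((𝐞 (-L y q.2) : Circle) : ℂ))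
        (((𝐞 (-L y q.2) : Circle) : ℂ) • ((-(2 * Real.pi * Complex.I)) •
          (Complex.ofRealCLM.comp ((L y).comp (ContinuousLinearMap.snd ℝ E V))))) q := by
    have ha : HasFDerivAt (fun q : E × V => -L y q.2)
        (-((L y).comp (ContinuousLinearMap.snd ℝ E V))) q :=
        (((L y).comp (ContinuousLinearMap.snd ℝ E V)).hasFDerivAt).neg
    refine ((Real.hasDerivAt_fourierChar (-L y q.2)).hasFDerivAt.comp q ha).congr_fderiv ?_
    refine ContinuousLinearMap.ext fun w => ?_
    simp
    ring
  have h2 : HasFDerivAt (fun q : E × V => Φ (q.1, y))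
        ((fderiv ℝ Φ (q.1, y)).comp ((ContinuousLinearMap.inl ℝ E V).comp
      (ContinuousLinearMap.fst ℝ E V))) q := by
    have ha : HasFDerivAt (fun q : E × V => (q.1, y)) ((ContinuousLinearMap.inl ℝ E V).comp
          (ContinuousLinearMap.fst ℝ E V)) q := 
      (hasFDerivAt_fst (p := q) (𝕜 := ℝ)).prodMk (hasFDerivAt_const y q)
    exact (Φ.hasFDerivAt (q.1, y)).comp q ha
  refine (h1.smul h2).congr_fderiv ?_
  refine ContinuousLinearMap.ext fun w => ?_
  have e1 : (𝐞 (-L y q.2) • dpft L Φ (q.1, y)) w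
    = ((𝐞 (-L y q.2) : Circle) : ℂ) • (dpft L Φ (q.1, y) w) := rfl
  rw [e1, dpft_apply]
  simp only [add_apply, smul_apply, ContinuousLinearMap.smulRight_apply,
    ContinuousLinearMap.comp_apply, ContinuousLinearMap.coe_fst', ContinuousLinearMap.coe_snd',
    ContinuousLinearMap.inl_apply, Complex.ofRealCLM_apply, smul_eq_mul, smul_add, mul_smul,
    Complex.coe_smul]

lemma hasFDerivAt_pft (L : V →L[ℝ] V →L[ℝ] ℝ) {W : Type} [NormedAddCommGroup W]
    [NormedSpace ℂ W] (Φ : 𝓢(E × V, W)) (p : E × V) :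
    HasFDerivAt (pft μ L Φ) (pft μ L (dpft L Φ) p) p := by
  obtain ⟨C, hC⟩ := schwartz_unif_bound (dpft L Φ) 0 μ.integrablePower
  have hb : ∀ y : V, ∀ q : E × V, ‖𝐞 (-L y q.2) • dpft L Φ (q.1, y)‖ ≤
      C * (1 + ‖y‖) ^ (-(μ.integrablePower : ℝ)) := by
    intro y q
    refine (Circle.norm_smul (𝐞 (-L y q.2)) (dpft L Φ (q.1, y))).le.trans ?_
    simpa using hC q.1 y
  have hm : AEStronglyMeasurable (fun y => 𝐞 (-L y p.2) • dpft L Φ (p.1, y)) μ :=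
    (char_slice_integrable L (dpft L Φ) p).aestronglyMeasurable
  have hm' : ∀ q : E × V, Integrable (fun y => 𝐞 (-L y q.2) • Φ (q.1, y)) μ :=
    fun q => char_slice_integrable L Φ q
  have hi := ((Measure.integrable_pow_neg_integrablePower μ).const_mul C)
  have key := hasFDerivAt_integral_of_dominated_of_fderiv_le (𝕜 := ℝ) (s := Set.univ) (x₀ := p)
    (μ := μ) (F := fun (q : E × V) y => 𝐞 (-L y q.2) • Φ (q.1, y))
    (F' := fun q y => 𝐞 (-L y q.2) • dpft L Φ (q.1, y))
    (bound := fun y => C * (1 + ‖y‖) ^ (-(μ.integrablePower : ℝ))) univ_mem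
    (Eventually.of_forall fun q => (hm' q).aestronglyMeasurable)
    (hm' p) hm (ae_of_all _ fun y q _ => hb y q) hi
    (ae_of_all _ fun y q _ => hasFDerivAt_pft_aux L Φ q y)
  exact key

lemma contDiff_pft (L : V →L[ℝ] V →L[ℝ] ℝ) (n : ℕ) : ∀ {W : Type} [NormedAddCommGroup W]
    [NormedSpace ℂ W] (Φ : 𝓢(E × V, W)), ContDiff ℝ n (pft μ L Φ) := by
  induction n with
  | zero =>
    intro W _ _ Φ
    have : Differentiable ℝ (pft μ L Φ) := fun p => (hasFDerivAt_pft L Φ p).differentiableAt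
    exact contDiff_zero.2 this.continuous
  | succ n ih =>
    intro W _ _ Φ
    have : ((n + 1 : ℕ) : WithTop ℕ∞) = (n : WithTop ℕ∞) + 1 := by push_cast; rfl
    rw [this, contDiff_succ_iff_hasFDerivAt]
    refine ⟨_, ih (dpft L Φ), hasFDerivAt_pft L Φ⟩

lemma pft_decay0 (L : V →L[ℝ] V →L[ℝ] ℝ) {c : ℝ} (hL : ∀ η, ‖η‖ ≤ c * ‖L.flip η‖) (k : ℕ) :
    ∀ {W : Type} [NormedAddCommGroup W]
    [NormedSpace ℂ W] (Φ : 𝓢(E × V, W)), ∃ C, ∀ p : E × V, ‖p.2‖ ^ k * ‖pft μ L Φ p‖ ≤ C := by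
  induction k with
  | zero =>
    intro W _ _ Φ
    obtain ⟨C, hC⟩ := pft_bound (μ := μ) L Φ 0
    exact ⟨C, by simpa using hC⟩
  | succ k ih =>
    intro W _ _ Φ
    let Φ1 : 𝓢(E × V, V →L[ℝ] W) := SchwartzMap.postcompCLM (𝕜 := ℝ)
      (ContinuousLinearMap.precomp W (ContinuousLinearMap.inr ℝ E V))
      (SchwartzMap.fderivCLM ℝ (E × V) W Φ)
    obtain ⟨C, hC⟩ := ih Φ1
    refine ⟨|c| * C, fun p => ?_⟩
    have hd : ∀ e y, HasFDerivAt (fun y => Φ (e, y)) (Φ1 (e, y)) y := by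
      intro e y
      have ha : HasFDerivAt (fun y : V => (e, y)) (ContinuousLinearMap.inr ℝ E V) y := by
        convert! (hasFDerivAt_const e y).prodMk (hasFDerivAt_id (𝕜 := ℝ) y)
      exact (Φ.hasFDerivAt (e, y)).comp y ha
    have hfd : fderiv ℝ (fun y => Φ (p.1, y)) = fun y => Φ1 (p.1, y) := by
      ext1 y; exact (hd p.1 y).fderiv
    have key := VectorFourier.fourierIntegral_fderiv (μ := μ) L (slice_integrable Φ p.1)
      (fun y => (hd p.1 y).differentiableAt) (by rw [hfd]; exact slice_integrable Φ1 p.1)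
    have key2 := congrFun key p.2
    rw [hfd] at key2
    have key3 : pft μ L Φ1 p = VectorFourier.fourierSMulRight (-L.flip)
      (fun η => pft μ L Φ (p.1, η)) p.2 := key2
    have key4 := congrArg norm key3
    rw [VectorFourier.norm_fourierSMulRight] at key4
    simp only [neg_apply, norm_neg] at key4
    have h2pi : (1 : ℝ) ≤ 2 * Real.pi := by linarith [Real.pi_gt_three]
    calc ‖p.2‖ ^ (k + 1) * ‖pft μ L Φ p‖ = ‖p.2‖ ^ k * (‖p.2‖ * ‖pft μ L Φ p‖) := by ring
      _ ≤ ‖p.2‖ ^ k * (|c| * ‖L.flip p.2‖ * ‖pft μ L Φ p‖) := by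
        gcongr
        exact (hL p.2).trans (by gcongr; exact le_abs_self c)
      _ ≤ ‖p.2‖ ^ k * (|c| * (2 * Real.pi * ‖L.flip p.2‖ * ‖pft μ L Φ p‖)) := by
        rw [mul_assoc |c|]
        gcongr
        have : 0 ≤ ‖L.flip p.2‖ := norm_nonneg _
        nlinarith
      _ = |c| * (‖p.2‖ ^ k * ‖pft μ L Φ1 p‖) := by rw [key4]; ring
      _ ≤ _ := by gcongr; exact hC p

lemma pft_decay (L : V →L[ℝ] V →L[ℝ] ℝ) {c : ℝ} (hL : ∀ η, ‖η‖ ≤ c * ‖L.flip η‖) (k n : ℕ) :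
    ∀ {W : Type} [NormedAddCommGroup W]
    [NormedSpace ℂ W] (Φ : 𝓢(E × V, W)),
    ∃ C, ∀ p : E × V, ‖p‖ ^ k * ‖iteratedFDeriv ℝ n (pft μ L Φ) p‖ ≤ C := by
  induction n with
  | zero =>
    intro W _ _ Φ
    obtain ⟨C1, h1⟩ := pft_bound (μ := μ) L Φ k
    obtain ⟨C2, h2⟩ := pft_decay0 (μ := μ) L hL k Φ
    refine ⟨max C1 C2, fun p => ?_⟩
    rw [norm_iteratedFDeriv_zero, Prod.norm_def]
    rcases le_total ‖p.1‖ ‖p.2‖ with h | h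
    · rw [max_eq_right h]; exact (h2 p).trans (le_max_right _ _)
    · rw [max_eq_left h]; exact (h1 p).trans (le_max_left _ _)
  | succ n ih =>
    intro W _ _ Φ
    obtain ⟨C, hC⟩ := ih (dpft L Φ)
    refine ⟨C, fun p => ?_⟩
    have : fderiv ℝ (pft μ L Φ) = pft μ L (dpft L Φ) := by
      ext1 q; exact (hasFDerivAt_pft L Φ q).fderiv
    rw [← norm_iteratedFDeriv_fderiv, this]
    exact hC p

/-- Partial Fourier transform as a Schwartz function. -/
def pftS (μ : Measure V) [μ.IsAddHaarMeasure] (L : V →L[ℝ] V →L[ℝ] ℝ) {c : ℝ}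
    (hL : ∀ η, ‖η‖ ≤ c * ‖L.flip η‖)
    (Φ : 𝓢(E × V, ℂ)) : 𝓢(E × V, ℂ) where
  toFun := pft μ L Φ
  smooth' := contDiff_infty.2 fun n => contDiff_pft L n Φ
  decay' k n := pft_decay L hL k n Φ

end pft
end PF

namespace PF
set_option linter.unusedSectionVars false

section fib
variable {E V : Type} [NormedAddCommGroup E] [NormedSpace ℝ E]
  [NormedAddCommGroup V] [NormedSpace ℝ V] [MeasurableSpace V] [BorelSpace V]
  [FiniteDimensional ℝ V] {μ : Measure V} [μ.IsAddHaarMeasure]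

lemma pft_decay1 (L : V →L[ℝ] V →L[ℝ] ℝ) (k n : ℕ) :
    ∀ {W : Type} [NormedAddCommGroup W]
    [NormedSpace ℂ W] (Φ : 𝓢(E × V, W)),
    ∃ C, ∀ p : E × V, ‖p.1‖ ^ k * ‖iteratedFDeriv ℝ n (pft μ L Φ) p‖ ≤ C := by
  induction n with
  | zero =>
    intro W _ _ Φ
    obtain ⟨C1, h1⟩ := pft_bound (μ := μ) L Φ k
    refine ⟨C1, fun p => ?_⟩
    rw [norm_iteratedFDeriv_zero]
    exact h1 p
  | succ n ih =>
    intro W _ _ Φ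
    obtain ⟨C, hC⟩ := ih (dpft L Φ)
    refine ⟨C, fun p => ?_⟩
    have : fderiv ℝ (pft μ L Φ) = pft μ L (dpft L Φ) := by
      ext1 q; exact (hasFDerivAt_pft L Φ q).fderiv
    rw [← norm_iteratedFDeriv_fderiv, this]
    exact hC p

/-- Composition on the right with a linear map does not increase derivatives much. -/
lemma norm_iteratedFDeriv_comp_clm {E E' F : Type} [NormedAddCommGroup E] [NormedSpace ℝ E]
    [NormedAddCommGroup E'] [NormedSpace ℝ E'] [NormedAddCommGroup F] [NormedSpace ℝ F]
    (g : E' →L[ℝ] E) (hg : ‖g‖ ≤ 1) {f : E → F} (hf : ContDiff ℝ ∞ f) (n : ℕ) (x : E') :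
    ‖iteratedFDeriv ℝ n (fun x => f (g x)) x‖ ≤ ‖iteratedFDeriv ℝ n f (g x)‖ := by
  have h := g.iteratedFDeriv_comp_right hf x (i := n) (by exact_mod_cast le_top)
  have h' : (fun x => f (g x)) = f ∘ g := rfl
  rw [h', h]
  refine (ContinuousMultilinearMap.norm_compContinuousLinearMap_le _ _).trans ?_
  have : ∏ i : Fin n, ‖g‖ ≤ 1 := Finset.prod_le_one (fun _ _ => norm_nonneg _) fun _ _ => hg
  exact mul_le_of_le_one_right (norm_nonneg _) this

/-- Integration along the second factor. -/
def fib (μ : Measure V) [μ.IsAddHaarMeasure] (Φ : 𝓢(E × V, ℂ)) : 𝓢(E, ℂ) where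
  toFun e := pft μ 0 Φ (e, 0)
  smooth' := (contDiff_infty.2 fun n => contDiff_pft (μ := μ) 0 n Φ).comp
    (ContinuousLinearMap.inl ℝ E V).contDiff
  decay' k n := by
    obtain ⟨C, hC⟩ := pft_decay1 (μ := μ) 0 k n Φ
    refine ⟨C, fun e => le_trans ?_ (hC (e, 0))⟩
    have := norm_iteratedFDeriv_comp_clm (ContinuousLinearMap.inl ℝ E V)
      (ContinuousLinearMap.norm_inl_le_one ℝ E V)
      (contDiff_infty.2 fun n => contDiff_pft (μ := μ) 0 n Φ) n e
    gcongr
    exact this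

lemma fib_apply (Φ : 𝓢(E × V, ℂ)) (e : E) : fib μ Φ e = ∫ y, Φ (e, y) ∂μ := by
  change pft μ 0 Φ (e, 0) = _
  simp [pft]

end fib

section ext
variable {E V : Type} [NormedAddCommGroup E] [NormedSpace ℝ E]
  [NormedAddCommGroup V] [NormedSpace ℝ V]

/-- External product of Schwartz functions. -/
def extS (f : 𝓢(E, ℂ)) (g : 𝓢(V, ℂ)) : 𝓢(E × V, ℂ) where
  toFun p := f p.1 * g p.2
  smooth' := ((f.smooth _).comp contDiff_fst).mul ((g.smooth _).comp contDiff_snd)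
  decay' k n := by
    choose Cf hf0 hf using fun k n => f.decay k n
    choose Cg hg0 hg using fun k n => g.decay k n
    refine ⟨∑ i ∈ Finset.range (n + 1), (n.choose i : ℝ) *
      (Cf k i * Cg 0 (n - i) + Cf 0 i * Cg k (n - i)), fun p => ?_⟩
    have h1 := norm_iteratedFDeriv_mul_le (𝕜 := ℝ) (N := ∞) (n := n)
      (f := fun p : E × V => f p.1) (g := fun p : E × V => g p.2)
      ((f.smooth _).comp contDiff_fst) ((g.smooth _).comp contDiff_snd) p
      (by exact_mod_cast le_top)
    refine (mul_le_mul_of_nonneg_left h1 (by positivity)).trans ?_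
    rw [Finset.mul_sum]
    refine Finset.sum_le_sum fun i _ => ?_
    have ha := norm_iteratedFDeriv_comp_clm (ContinuousLinearMap.fst ℝ E V)
      (ContinuousLinearMap.norm_fst_le ℝ E V) (f.smooth _) i p
    have hb := norm_iteratedFDeriv_comp_clm (ContinuousLinearMap.snd ℝ E V)
      (ContinuousLinearMap.norm_snd_le ℝ E V) (g.smooth _) (n - i) p
    simp only [ContinuousLinearMap.coe_fst', ContinuousLinearMap.coe_snd'] at ha hb
    have hp : ‖p‖ ^ k ≤ ‖p.1‖ ^ k + ‖p.2‖ ^ k := by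
      rw [Prod.norm_def]
      rcases le_total ‖p.1‖ ‖p.2‖ with h | h
      · rw [max_eq_right h]; exact le_add_of_nonneg_left (by positivity)
      · rw [max_eq_left h]; exact le_add_of_nonneg_right (by positivity)
    have e1 := hf k i p.1
    have e2 := hf 0 i p.1
    have e3 := hg k (n - i) p.2
    have e4 := hg 0 (n - i) p.2
    simp only [pow_zero, one_mul] at e2 e4
    set A := ‖iteratedFDeriv ℝ i f p.1‖
    set B := ‖iteratedFDeriv ℝ (n - i) g p.2‖
    calc ‖p‖ ^ k * ((n.choose i : ℝ) * ‖iteratedFDeriv ℝ i (fun p : E × V => f p.1) p‖ *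
          ‖iteratedFDeriv ℝ (n - i) (fun p : E × V => g p.2) p‖)
        ≤ (‖p.1‖ ^ k + ‖p.2‖ ^ k) * ((n.choose i : ℝ) * A * B) := by gcongr
      _ = (n.choose i : ℝ) * ((‖p.1‖ ^ k * A) * B + A * (‖p.2‖ ^ k * B)) := by ring
      _ ≤ _ := by
        have := (hf0 k i).le
        have := (hf0 0 i).le
        gcongr

@[simp] lemma extS_apply (f : 𝓢(E, ℂ)) (g : 𝓢(V, ℂ)) (p : E × V) :
    extS f g p = f p.1 * g p.2 := rfl

lemma htg_prodMk {D : Type} [NormedAddCommGroup D] [NormedSpace ℝ D] {f : D → E} {g : D → V}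
    (hf : f.HasTemperateGrowth) (hg : g.HasTemperateGrowth) :
    (fun x => (f x, g x)).HasTemperateGrowth := by
  have h1 := (ContinuousLinearMap.inl ℝ E V).hasTemperateGrowth.comp hf
  have h2 := (ContinuousLinearMap.inr ℝ E V).hasTemperateGrowth.comp hg
  convert! h1.add h2 using 1
  ext1 x
  simp
end ext
end PF

namespace PF
set_option linter.unusedSectionVars false

section avg
variable {E X : Type} [NormedAddCommGroup E] [NormedSpace ℝ E]
  [NormedAddCommGroup X] [NormedSpace ℂ X] [MeasurableSpace X] [BorelSpace X]
  [FiniteDimensional ℝ X] {μ : Measure X} [μ.IsAddHaarMeasure]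

lemma avg_lemma (F : 𝓢(E × (X × X), ℂ)) (ρ : ℂ × ℂ → ℂ) (hρ : ContDiff ℝ ∞ ρ)
    (hρc : HasCompactSupport ρ) (δ : ℝ) (hδ : 0 < δ) (hρ0 : ∀ v, ‖v‖ < δ → ρ v = 0)
    (w : X → ℂ) (hw : w.HasTemperateGrowth) :
    ∃ Ψ : 𝓢(E × (ℂ × ℂ), ℂ), ∀ e v, Ψ (e, v) =
      ρ v * ∫ x, w x * F (e, (v.1 • x, v.2 • x)) ∂μ := by
  let θ : ContDiffBump (0 : ℂ × ℂ) := ⟨δ / 2, δ, by positivity, by linarith⟩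
  let κ : ContDiffBump (0 : X) := ⟨1, 2, by norm_num, by norm_num⟩
  have hκc : HasCompactSupport (fun x => (κ x : ℂ)) := κ.hasCompactSupport.comp_left Complex.ofReal_zero
  have hκs : ContDiff ℝ ∞ (fun x => (κ x : ℂ)) := Complex.ofRealCLM.contDiff.comp κ.contDiff
  let κS : 𝓢(X, ℂ) := hκc.toSchwartzMap hκs
  let ρS : 𝓢(ℂ × ℂ, ℂ) := hρc.toSchwartzMap hρ
  let P : 𝓢((E × (X × X)) × ((ℂ × ℂ) × X), ℂ) := extS F (extS ρS κS)
  let g : (E × (ℂ × ℂ)) × X → (E × (X × X)) × ((ℂ × ℂ) × X) := fun p =>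
    ((p.1.1, (p.1.2.1 • p.2, p.1.2.2 • p.2)), (p.1.2, θ p.1.2 • p.2))
  have hp1 : (fun p : (E × (ℂ × ℂ)) × X => p.1).HasTemperateGrowth :=
    (ContinuousLinearMap.fst ℝ (E × (ℂ × ℂ)) X).hasTemperateGrowth
  have hp2 : (fun p : (E × (ℂ × ℂ)) × X => p.2).HasTemperateGrowth :=
    (ContinuousLinearMap.snd ℝ (E × (ℂ × ℂ)) X).hasTemperateGrowth
  have hp11 : (fun p : (E × (ℂ × ℂ)) × X => p.1.1).HasTemperateGrowth :=
    (ContinuousLinearMap.fst ℝ E (ℂ × ℂ)).hasTemperateGrowth.comp hp1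
  have hp12 : (fun p : (E × (ℂ × ℂ)) × X => p.1.2).HasTemperateGrowth :=
    (ContinuousLinearMap.snd ℝ E (ℂ × ℂ)).hasTemperateGrowth.comp hp1
  have hp121 : (fun p : (E × (ℂ × ℂ)) × X => p.1.2.1).HasTemperateGrowth :=
    (ContinuousLinearMap.fst ℝ ℂ ℂ).hasTemperateGrowth.comp hp12
  have hp122 : (fun p : (E × (ℂ × ℂ)) × X => p.1.2.2).HasTemperateGrowth :=
    (ContinuousLinearMap.snd ℝ ℂ ℂ).hasTemperateGrowth.comp hp12
  have hθ : (fun p : (E × (ℂ × ℂ)) × X => θ p.1.2).HasTemperateGrowth :=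
    (θ.hasCompactSupport.hasTemperateGrowth θ.contDiff).comp hp12
  have hg : g.HasTemperateGrowth :=
    htg_prodMk (htg_prodMk hp11 (htg_prodMk (hp121.smul hp2) (hp122.smul hp2)))
      (htg_prodMk hp12 (hθ.smul hp2))
  have hup : ∃ (k : ℕ) (C : ℝ), ∀ p, ‖p‖ ≤ C * (1 + ‖g p‖) ^ k := by
    refine ⟨1, 1 + 2 / δ, fun p => ?_⟩
    rw [pow_one]
    have h1 : ‖(g p).1.1‖ ≤ ‖g p‖ := (norm_fst_le _).trans (norm_fst_le _)
    have h2 : ‖(g p).1.2.1‖ ≤ ‖g p‖ := (norm_fst_le _).trans ((norm_snd_le _).trans (norm_fst_le _))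
    have h3 : ‖(g p).1.2.2‖ ≤ ‖g p‖ := (norm_snd_le _).trans ((norm_snd_le _).trans (norm_fst_le _))
    have h4 : ‖(g p).2.1‖ ≤ ‖g p‖ := (norm_fst_le _).trans (norm_snd_le _)
    have h5 : ‖(g p).2.2‖ ≤ ‖g p‖ := (norm_snd_le _).trans (norm_snd_le _)
    have hdd : 0 < 2 / δ := by positivity
    set N := ‖g p‖ with hN
    have hN0 : 0 ≤ N := norm_nonneg _
    have hle : N ≤ (1 + 2 / δ) * (1 + N) := by nlinarith
    have hx : ‖p.2‖ ≤ (1 + 2 / δ) * (1 + N) := by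
      by_cases hv : ‖p.1.2‖ < δ / 2
      · have : θ p.1.2 = 1 := θ.one_of_mem_closedBall (by simpa using hv.le)
        simp only [g, this, one_smul] at h5
        exact h5.trans hle
      · push Not at hv
        have : ‖p.1.2‖ * ‖p.2‖ ≤ N := by
          simp only [g, norm_smul] at h2 h3
          rw [Prod.norm_def]
          rcases le_total ‖p.1.2.1‖ ‖p.1.2.2‖ with h | h
          · rw [max_eq_right h]; exact h3
          · rw [max_eq_left h]; exact h2
        have h6 : δ / 2 * ‖p.2‖ ≤ N := le_trans (by gcongr) this
        have h7 : ‖p.2‖ ≤ 2 / δ * N := by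
          calc ‖p.2‖ = 2 / δ * (δ / 2 * ‖p.2‖) := by field_simp
            _ ≤ _ := by gcongr
        nlinarith
    have e1 : ‖p.1.1‖ ≤ N := h1
    have e2 : ‖p.1.2‖ ≤ N := h4
    rw [Prod.norm_def, Prod.norm_def]
    exact max_le (max_le (e1.trans hle) (e2.trans hle)) hx
  let J : 𝓢((E × (ℂ × ℂ)) × X, ℂ) := SchwartzMap.compCLM ℝ hg hup P
  have hw' : (fun p : (E × (ℂ × ℂ)) × X => w p.2).HasTemperateGrowth := hw.comp hp2
  refine ⟨fib μ (SchwartzMap.smulLeftCLM ℂ (fun p : (E × (ℂ × ℂ)) × X => w p.2) J), fun e v => ?_⟩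
  rw [fib_apply, ← integral_const_mul]
  congr 1
  ext1 x
  rw [SchwartzMap.smulLeftCLM_apply_apply hw']
  have hJ : J ((e, v), x) = F (e, (v.1 • x, v.2 • x)) * (ρ v * (κ (θ v • x) : ℂ)) := rfl
  rw [hJ]
  by_cases hv : ‖v‖ < δ
  · simp [hρ0 v hv]
  · have : θ v = 0 := θ.zero_of_le_dist (by simpa using hv)
    have h1 : κ (0 : X) = 1 := κ.one_of_mem_closedBall (by simp [κ])
    simp [this, h1]
    ring
end avg
end PF

namespace PF
set_option linter.unusedSectionVars false

section scal

lemma mp_unit (u : ℂ) (hu : ‖u‖ = 1) : MeasurePreserving (fun x : ℂ => u * x) := by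
  have := (rotation ⟨u, by simpa [Submonoid.unitSphere] using hu⟩).measurePreserving
  exact this

lemma mp_unit_pi (n : ℕ) (u : ℂ) (hu : ‖u‖ = 1) :
    MeasurePreserving (fun x : Fin n → ℂ => u • x) :=
  volume_preserving_pi (fun _ : Fin n => mp_unit u hu)

lemma me_unit (u : ℂ) (hu : ‖u‖ = 1) : MeasurableEmbedding (fun x : ℂ => u * x) :=
  measurableEmbedding_mulLeft₀ (by rintro rfl; simp at hu)

lemma me_unit_pi (n : ℕ) (u : ℂ) (hu : ‖u‖ = 1) :
    MeasurableEmbedding (fun x : Fin n → ℂ => u • x) :=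
  measurableEmbedding_const_smul₀ (by rintro rfl; simp at hu)

lemma scal_pi {F : Type} [NormedAddCommGroup F] [NormedSpace ℝ F] (n : ℕ)
    (f : (Fin n → ℂ) → F) (t : ℂ) (ht : t ≠ 0) :
    ∫ x, f (t • x) = (‖t‖ ^ (2 * n))⁻¹ • ∫ x, f x := by
  have hu : ‖t / ‖t‖‖ = 1 := by simp [ht]
  have h1 := (mp_unit_pi n _ hu).integral_comp (me_unit_pi n _ hu) (fun x => f (‖t‖ • x))
  have h2 := Measure.integral_comp_smul (volume : Measure (Fin n → ℂ)) f ‖t‖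
  rw [h2] at h1
  have h3 : Module.finrank ℝ (Fin n → ℂ) = 2 * n := by
    rw [Module.finrank_pi_fintype]; simp [mul_comm]
  rw [h3, abs_of_nonneg (by positivity)] at h1
  rw [← h1]
  congr 1
  ext1 x
  congr 1
  ext1 i
  have : (‖t‖ : ℂ) ≠ 0 := by simpa using ht
  simp only [Pi.smul_apply, smul_eq_mul, Complex.real_smul]
  field_simp

lemma scal_C {F : Type} [NormedAddCommGroup F] [NormedSpace ℝ F]
    (f : ℂ → F) (t : ℂ) (ht : t ≠ 0) :
    ∫ x, f (t * x) = (‖t‖ ^ 2)⁻¹ • ∫ x, f x := by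
  have hu : ‖t / ‖t‖‖ = 1 := by simp [ht]
  have h1 := (mp_unit _ hu).integral_comp (me_unit _ hu) (fun x => f (‖t‖ • x))
  have h2 := Measure.integral_comp_smul (volume : Measure ℂ) f ‖t‖
  rw [h2, Complex.finrank_real_complex, abs_of_nonneg (by positivity)] at h1
  rw [← h1]
  congr 1
  ext1 x
  congr 1
  have : (‖t‖ : ℂ) ≠ 0 := by simpa using ht
  simp only [Complex.real_smul]
  field_simp

lemma scal_C_integrable {F : Type} [NormedAddCommGroup F] [NormedSpace ℝ F]
    {f : ℂ → F} (hf : Integrable f) (t : ℂ) (ht : t ≠ 0) :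
    Integrable (fun x => f (t * x)) := by
  have hu : ‖t / ‖t‖‖ = 1 := by simp [ht]
  have h2 := (integrable_comp_smul_iff (volume : Measure ℂ) f (R := ‖t‖) (by simpa using ht)).2 hf
  have h1 := ((mp_unit _ hu).integrable_comp_emb (me_unit _ hu)).2 h2
  refine h1.congr (ae_of_all _ fun x => ?_)
  simp only [Function.comp]
  congr 1
  have : (‖t‖ : ℂ) ≠ 0 := by simpa using ht
  simp only [Complex.real_smul]
  field_simp

end scal

section rho

/-- A bump function on the line supported in `(0, ∞)`. -/
def bb : ContDiffBump (2 : ℝ) := ⟨1 / 2, 1, by norm_num, by norm_num⟩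

/-- The weight functions used for averaging. -/
def rho (k : ℕ) (v : ℂ × ℂ) : ℂ :=
  (((‖v.1‖ ^ 2 + ‖v.2‖ ^ 2) ^ k * bb (‖v.1‖ ^ 2 + ‖v.2‖ ^ 2) : ℝ) : ℂ)

lemma bb_zero {r : ℝ} (hr : r ≤ 1 ∨ 3 ≤ r) : bb r = 0 := by
  refine bb.zero_of_le_dist ?_
  change (1 : ℝ) ≤ dist r 2
  rw [Real.dist_eq, le_abs]
  rcases hr with h | h
  · right; linarith
  · left; linarith

lemma rho_contDiff (k : ℕ) : ContDiff ℝ ∞ (rho k) := by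
  have h1 : ContDiff ℝ ∞ (fun v : ℂ × ℂ => ‖v.1‖ ^ 2 + ‖v.2‖ ^ 2) :=
    (contDiff_fst.norm_sq ℝ).add (contDiff_snd.norm_sq ℝ)
  exact Complex.ofRealCLM.contDiff.comp ((h1.pow k).mul (bb.contDiff.comp h1))

lemma rho_zero (k : ℕ) (v : ℂ × ℂ) (hv : ‖v‖ < 1 / 2) : rho k v = 0 := by
  have h1 : ‖v.1‖ < 1 / 2 := (norm_fst_le v).trans_lt hv
  have h2 : ‖v.2‖ < 1 / 2 := (norm_snd_le v).trans_lt hv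
  have : bb (‖v.1‖ ^ 2 + ‖v.2‖ ^ 2) = 0 := bb_zero (Or.inl (by
    nlinarith [norm_nonneg v.1, norm_nonneg v.2]))
  simp [rho, this]

lemma rho_supp (k : ℕ) : HasCompactSupport (rho k) := by
  refine HasCompactSupport.intro (isCompact_closedBall (0 : ℂ × ℂ) 2) fun v hv => ?_
  have hv' : 2 < ‖v‖ := by simpa using hv
  have : bb (‖v.1‖ ^ 2 + ‖v.2‖ ^ 2) = 0 := bb_zero (Or.inr (by
    rw [Prod.norm_def, lt_max_iff] at hv'
    rcases hv' with h | h <;> nlinarith [norm_nonneg v.1, norm_nonneg v.2]))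
  simp [rho, this]

/-- The normalizing constant. -/
def cc : ℂ := ∫ t : ℂ, ((bb (‖t‖ ^ 2) : ℝ) : ℂ)

lemma cc_ne : cc ≠ 0 := by
  rw [cc, integral_complex_ofReal]
  have hc : Continuous (fun t : ℂ => bb (‖t‖ ^ 2)) := bb.continuous.comp (by fun_prop)
  have hs : HasCompactSupport (fun t : ℂ => bb (‖t‖ ^ 2)) := by
    refine HasCompactSupport.intro (isCompact_closedBall (0 : ℂ) 2) fun v hv => ?_
    have hv' : 2 < ‖v‖ := by simpa using hv
    exact bb_zero (Or.inr (by nlinarith))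
  have : 0 < ∫ t : ℂ, bb (‖t‖ ^ 2) := by
    refine hc.integral_pos_of_hasCompactSupport_nonneg_nonzero hs (fun t => bb.nonneg)
      (x := ((Real.sqrt 2 : ℝ) : ℂ)) ?_
    have : ‖((Real.sqrt 2 : ℝ) : ℂ)‖ ^ 2 = 2 := by simp
    rw [this, bb.one_of_mem_closedBall (by simp [bb.rIn_pos.le])]
    norm_num
  exact_mod_cast this.ne'

lemma int_bb (s : ℝ) (hs : 0 < s) :
    ∫ t : ℂ, ((bb (s * ‖t‖ ^ 2) : ℝ) : ℂ) = (s : ℂ)⁻¹ * cc := by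
  have h := scal_C (fun t : ℂ => ((bb (‖t‖ ^ 2) : ℝ) : ℂ)) ((Real.sqrt s : ℝ) : ℂ)
    (by simpa using (Real.sqrt_pos.2 hs).ne')
  have e : ‖((Real.sqrt s : ℝ) : ℂ)‖ ^ 2 = s := by simp [Real.sq_sqrt hs.le]
  simp only [norm_mul, mul_pow, e] at h
  rw [h, cc, Complex.real_smul]
  push_cast
  rfl

lemma rho_line (k : ℕ) (t l : ℂ) : rho k (t, l * t) =
    (((1 + ‖l‖ ^ 2) ^ k * ‖t‖ ^ (2 * k) * bb ((1 + ‖l‖ ^ 2) * ‖t‖ ^ 2) : ℝ) : ℂ) := by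
  have : ‖t‖ ^ 2 + ‖l * t‖ ^ 2 = (1 + ‖l‖ ^ 2) * ‖t‖ ^ 2 := by rw [norm_mul]; ring
  simp only [rho, this]
  congr 2
  rw [mul_pow, pow_mul]

lemma int_rho (k : ℕ) (l : ℂ) : ∫ t : ℂ, rho k (t, l * t) * (((‖t‖ ^ (2 * k))⁻¹ : ℝ) : ℂ) =
    ((1 + ‖l‖ ^ 2 : ℝ) : ℂ) ^ k * (((1 + ‖l‖ ^ 2 : ℝ) : ℂ)⁻¹ * cc) := by
  rw [← int_bb _ (by positivity), ← integral_const_mul]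
  refine integral_congr_ae ?_
  filter_upwards [compl_mem_ae_iff.2 (measure_singleton (0 : ℂ))] with t ht
  have ht' : (‖t‖ : ℂ) ≠ 0 := by simpa using ht
  rw [rho_line]
  push_cast
  field_simp

end rho
end PF

namespace PF
set_option linter.unusedSectionVars false

/-- The standard additive character of `ℂ`. -/
def ch (s : ℂ) : ℂ := ((𝐞 s.re : Circle) : ℂ)

lemma ch_add (a b : ℂ) : ch (a + b) = ch a * ch b := by
  simp [ch, AddChar.map_add_eq_mul]

lemma ch_norm (a : ℂ) : ‖ch a‖ = 1 := Circle.norm_coe _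

lemma ch_zero : ch 0 = 1 := by simp [ch]

lemma ch_continuous : Continuous ch :=
  continuous_subtype_val.comp (Real.continuous_fourierChar.comp Complex.continuous_re)

lemma ch_sum {ι : Type} (s : Finset ι) (f : ι → ℂ) : ch (∑ i ∈ s, f i) = ∏ i ∈ s, ch (f i) := by
  classical
  induction s using Finset.induction_on with
  | empty => simp [ch_zero]
  | insert a s ha ih => rw [Finset.sum_insert ha, Finset.prod_insert ha, ch_add, ih]

/-- The pairing `Re (y η)` on `ℂ`. -/
def LC : ℂ →L[ℝ] ℂ →L[ℝ] ℝ :=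
  (ContinuousLinearMap.compL ℝ ℂ ℂ ℝ Complex.reCLM).comp (ContinuousLinearMap.mul ℝ ℂ)

@[simp] lemma LC_apply (y η : ℂ) : LC y η = (y * η).re := rfl

/-- The pairing `Re ∑ y_i η_i`. -/
def LX (n : ℕ) : (Fin n → ℂ) →L[ℝ] (Fin n → ℂ) →L[ℝ] ℝ :=
  ∑ i, LC.bilinearComp (ContinuousLinearMap.proj i) (ContinuousLinearMap.proj i)

@[simp] lemma LX_apply (n : ℕ) (y η : Fin n → ℂ) : LX n y η = (∑ i, y i * η i).re := by
  simp [LX, sum_apply]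

lemma LC_lower (η : ℂ) : ‖η‖ ≤ 1 * ‖LC.flip η‖ := by
  have h := (LC.flip η).le_opNorm (starRingEnd ℂ η)
  have h2 : (LC.flip η) (starRingEnd ℂ η) = ‖η‖ ^ 2 := by
    rw [ContinuousLinearMap.flip_apply, LC_apply, mul_comm, Complex.mul_conj, Complex.ofReal_re,
      Complex.normSq_eq_norm_sq]
  rw [h2, RCLike.norm_conj, Real.norm_of_nonneg (by positivity)] at h
  rcases (norm_nonneg η).eq_or_lt with h0 | h0
  · rw [← h0]; positivity
  · rw [one_mul]; nlinarith

lemma LX_lower (n : ℕ) (η : Fin n → ℂ) : ‖η‖ ≤ 1 * ‖(LX n).flip η‖ := by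
  rw [one_mul]
  refine (pi_norm_le_iff_of_nonneg (norm_nonneg _)).2 fun i => ?_
  have h := ((LX n).flip η).le_opNorm (Pi.single i (starRingEnd ℂ (η i)))
  have h2 : ((LX n).flip η) (Pi.single i (starRingEnd ℂ (η i))) = ‖η i‖ ^ 2 := by
    rw [ContinuousLinearMap.flip_apply, LX_apply, Finset.sum_eq_single i]
    · rw [Pi.single_eq_same, mul_comm, Complex.mul_conj, Complex.ofReal_re,
        Complex.normSq_eq_norm_sq]
    · intro j _ hj; simp [hj]
    · simp
  rw [h2, Pi.norm_single, RCLike.norm_conj, Real.norm_of_nonneg (by positivity)] at h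
  rcases (norm_nonneg (η i)).eq_or_lt with h0 | h0
  · rw [← h0]; positivity
  · nlinarith

lemma neg_lower {V : Type} [NormedAddCommGroup V] [NormedSpace ℝ V] {L : V →L[ℝ] V →L[ℝ] ℝ}
    (hL : ∀ η, ‖η‖ ≤ 1 * ‖L.flip η‖) (η : V) : ‖η‖ ≤ 1 * ‖(-L).flip η‖ := by
  have : (-L).flip η = - (L.flip η) := by ext; simp
  rw [this, norm_neg]; exact hL η

section
variable {E V : Type} [NormedAddCommGroup E] [NormedSpace ℝ E] [MeasureSpace E] [BorelSpace E]
  [FiniteDimensional ℝ E] [(volume : Measure E).IsAddHaarMeasure]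
  [NormedAddCommGroup V] [NormedSpace ℝ V] [MeasureSpace V] [BorelSpace V]
  [FiniteDimensional ℝ V] [(volume : Measure V).IsAddHaarMeasure]

lemma integrable_mul_unit {α : Type} [MeasurableSpace α] {ν : Measure α} {f a : α → ℂ}
    (hf : Integrable f ν) (ha : AEStronglyMeasurable a ν) (h : ∀ x, ‖a x‖ = 1) :
    Integrable (fun x => a x * f x) ν :=
  hf.bdd_mul ha (c := 1) (ae_of_all _ fun x => (h x).le)

/-- Fubini for the partial Fourier transform. -/
lemma integral_pft (L : V →L[ℝ] V →L[ℝ] ℝ) (Φ : 𝓢(E × V, ℂ)) (φ : E → V) (hφ : Continuous φ)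
    (a : E → ℂ) (ha : Continuous a) (ha1 : ∀ e, ‖a e‖ = 1) :
    ∫ p : E × V, a p.1 * ((𝐞 (L p.2 (φ p.1)) : Circle) : ℂ) * Φ p =
      ∫ e, a e * pft volume (-L) Φ (e, φ e) := by
  have hc : Continuous (fun p : E × V => a p.1 * ((𝐞 (L p.2 (φ p.1)) : Circle) : ℂ)) := by
    refine (ha.comp continuous_fst).mul (continuous_subtype_val.comp
      (Real.continuous_fourierChar.comp ?_))
    exact L.continuous₂.comp (continuous_snd.prodMk (hφ.comp continuous_fst))
  haveI : ProperSpace E := FiniteDimensional.proper ℝ E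
  haveI : ProperSpace V := FiniteDimensional.proper ℝ V
  haveI : (volume : Measure (E × V)).IsAddHaarMeasure := by
    rw [Measure.volume_eq_prod]; infer_instance
  have hi : Integrable (fun p : E × V => a p.1 * ((𝐞 (L p.2 (φ p.1)) : Circle) : ℂ) * Φ p) := by
    refine integrable_mul_unit Φ.integrable hc.aestronglyMeasurable fun x => ?_
    rw [norm_mul, ha1, one_mul]; exact Circle.norm_coe _
  rw [Measure.volume_eq_prod, integral_prod _ hi]
  congr 1
  ext1 e
  rw [pft, ← integral_const_mul]
  congr 1
  ext1 y
  simp [Circle.smul_def, mul_assoc]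

end

/-- Partial Fourier inversion. -/
lemma pft_inversion {E : Type} [NormedAddCommGroup E] [NormedSpace ℝ E] (Ψ : 𝓢(E × ℂ, ℂ)) :
    ∃ Φ : 𝓢(E × ℂ, ℂ), ∀ p, pft volume (-LC) Φ p = Ψ p := by
  refine ⟨pftS volume LC LC_lower Ψ, fun p => ?_⟩
  have h0 : ∀ v w : ℂ, inner ℝ v w = (v * starRingEnd ℂ w).re := by
    intro v w; rw [Complex.inner]; simp; ring
  set f : ℂ → ℂ := fun y => Ψ (p.1, y) with hf
  have hfi : Integrable f := slice_integrable Ψ p.1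
  have hfc : Continuous f := by fun_prop
  have e1 : ∀ w, 𝓕 f w = pftS volume LC LC_lower Ψ (p.1, starRingEnd ℂ w) := by
    intro w
    rw [Real.fourier_eq]
    change _ = pft volume LC Ψ (p.1, starRingEnd ℂ w)
    simp only [pft, LC_apply, h0, hf]
  have hmp : MeasurePreserving (starRingEnd ℂ : ℂ → ℂ) := Complex.conjLIE.measurePreserving
  have hme : MeasurableEmbedding (starRingEnd ℂ : ℂ → ℂ) :=
    Complex.conjLIE.toHomeomorph.measurableEmbedding
  have hFi : Integrable (𝓕 f) := by
    have := (hmp.integrable_comp_emb hme).2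
      (slice_integrable (μ := volume) (pftS volume LC LC_lower Ψ) p.1)
    refine this.congr (ae_of_all _ fun w => (e1 w).symm)
  have e2 := congrFun (hfc.fourierInv_fourier_eq hfi hFi) p.2
  rw [Real.fourierInv_eq] at e2
  have e3 := hmp.integral_comp hme
    (fun y => 𝐞 (-(-LC) y p.2) • pftS volume LC LC_lower Ψ (p.1, y))
  change ∫ y, 𝐞 (-(-LC) y p.2) • pftS volume LC LC_lower Ψ (p.1, y) = _
  rw [← e3]
  change _ = f p.2
  rw [← e2]
  congr 1
  ext1 w
  rw [e1]
  congr 2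
  rw [h0]
  simp

/-- Measures with densities are determined by their Fourier transforms. -/
lemma density_lemma {Z : Type} [MeasureSpace Z] [SigmaFinite (volume : Measure Z)]
    (Φ : Z → ℂ) (hΦ : Integrable Φ) (q : Z → ℂ) (hq : Measurable q) (h : ℂ → ℂ)
    (hh : Integrable h)
    (H : ∀ l : ℂ, ∫ z, ch (l * q z) * Φ z = ∫ ξ, ch (l * ξ) * h ξ) (g : ℂ → ℂ)
    (hg : Continuous g) (hgc : HasCompactSupport g) :
    ∫ z, g (q z) * Φ z = ∫ ξ, g ξ * h ξ := by
  have h0 : ∀ v w : ℂ, inner ℝ v w = (starRingEnd ℂ v * w).re := by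
    intro v w; rw [Complex.inner, mul_comm]
  have gen : ∀ (Y : Type) [MeasureSpace Y] [SigmaFinite (volume : Measure Y)] (Φ : Y → ℂ)
      (_ : Integrable Φ) (q : Y → ℂ) (_ : Measurable q) (g : 𝓢(ℂ, ℂ)),
      ∫ z, g (q z) * Φ z = ∫ w, 𝓕 (g : ℂ → ℂ) w * ∫ z, ch (starRingEnd ℂ w * q z) * Φ z := by
    intro Y _ _ Φ hΦ q hq g
    have hgi : Integrable (𝓕 (g : ℂ → ℂ)) := by
      rw [← SchwartzMap.fourier_coe]; exact (𝓕 g).integrable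
    have e : ∀ z, g z = ∫ w, ch (starRingEnd ℂ w * z) * 𝓕 (g : ℂ → ℂ) w := by
      intro z
      have := congrFun (g.continuous.fourierInv_fourier_eq g.integrable hgi) z
      rw [← this, Real.fourierInv_eq]
      congr 1
      ext1 w
      rw [h0, Circle.smul_def]; rfl
    have hi : Integrable (fun p : Y × ℂ => ch (starRingEnd ℂ p.2 * q p.1) *
        (Φ p.1 * 𝓕 (g : ℂ → ℂ) p.2)) := by
      refine integrable_mul_unit (hΦ.mul_prod hgi) ?_ fun x => ch_norm _
      refine (ch_continuous.measurable.comp ?_).aestronglyMeasurable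
      exact (Complex.continuous_conj.measurable.comp measurable_snd).mul (hq.comp measurable_fst)
    calc ∫ z, g (q z) * Φ z = ∫ z, ∫ w, ch (starRingEnd ℂ w * q z) *
        (Φ z * 𝓕 (g : ℂ → ℂ) w) := by
          congr 1
          ext1 z
          rw [e, ← integral_mul_const]
          congr 1
          ext1 w
          ring
      _ = ∫ w, ∫ z, ch (starRingEnd ℂ w * q z) *
        (Φ z * 𝓕 (g : ℂ → ℂ) w) := integral_integral_swap hi
      _ = _ := by
        congr 1
        ext1 w
        rw [← integral_const_mul]
        congr 1
        ext1 z
        ring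
  have smooth : ∀ g : 𝓢(ℂ, ℂ), ∫ z, g (q z) * Φ z = ∫ ξ, g ξ * h ξ := by
    intro g
    have e := gen ℂ h hh id measurable_id g
    simp only [id] at e
    rw [gen Z Φ hΦ q hq g, e]
    simp only [H]
  have bound : ∀ (Y : Type) [MeasureSpace Y] (Φ : Y → ℂ)
      (_ : Integrable Φ) (q : Y → ℂ) (_ : Measurable q) (g' : ℂ → ℂ) (_ : Continuous g')
      (_ : HasCompactSupport g') (ε : ℝ) (_ : ∀ x, dist (g' x) (g x) < ε),
      dist (∫ z, g' (q z) * Φ z) (∫ z, g (q z) * Φ z) ≤ ε * ∫ z, ‖Φ z‖ := by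
    intro Y _ Φ hΦ q hq g' hg' hgc' ε hε
    have hIntCts : ∀ f : ℂ → ℂ, Continuous f → HasCompactSupport f →
        Integrable (fun z => f (q z) * Φ z) := by
      intro f hf hfc
      obtain ⟨C, hC⟩ := hfc.exists_bound_of_continuous hf
      exact hΦ.bdd_mul (hf.measurable.comp hq).aestronglyMeasurable (ae_of_all _ fun x => hC (q x))
    rw [dist_eq_norm, ← integral_sub (hIntCts g' hg' hgc') (hIntCts g hg hgc), ← integral_const_mul]
    refine norm_integral_le_of_norm_le (hΦ.norm.const_mul ε) (ae_of_all _ fun z => ?_)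
    rw [← sub_mul, norm_mul, ← dist_eq_norm]
    gcongr
    exact (hε _).le
  refine dist_le_zero.1 (le_of_forall_pos_le_add fun ε hε => ?_)
  set M := (∫ z, ‖Φ z‖) + ∫ ξ, ‖h ξ‖ with hM
  have hM0 : 0 ≤ M := add_nonneg (integral_nonneg fun _ => norm_nonneg _)
    (integral_nonneg fun _ => norm_nonneg _)
  obtain ⟨g', hs, hd, hsupp⟩ := hg.exists_contDiff_approx ⊤ (ε := fun _ => ε / (M + 1))
    continuous_const (fun _ => by positivity)
  have hgc' : HasCompactSupport g' := hgc.mono hsupp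
  have b1 := bound Z Φ hΦ q hq g' hs.continuous hgc' _ hd
  have b2 := bound ℂ h hh id measurable_id g' hs.continuous hgc' _ hd
  have b3 := smooth (hgc'.toSchwartzMap hs)
  simp only [HasCompactSupport.toSchwartzMap_toFun] at b3
  simp only [id] at b2
  have b3' : ∫ z, g' (q z) * Φ z = ∫ ξ, g' ξ * h ξ := b3
  rw [b3', dist_comm] at b1
  calc dist (∫ z, g (q z) * Φ z) (∫ ξ, g ξ * h ξ)
      ≤ _ := dist_triangle _ (∫ ξ, g' ξ * h ξ) _
    _ ≤ ε / (M + 1) * (∫ z, ‖Φ z‖) + ε / (M + 1) * ∫ ξ, ‖h ξ‖ := add_le_add b1 b2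
    _ = ε * (M / (M + 1)) := by rw [← mul_add, ← hM]; ring
    _ ≤ ε * 1 := by gcongr; rw [div_le_one (by positivity)]; linarith
    _ = 0 + ε := by ring

end PF

namespace PF
set_option linter.unusedSectionVars false

lemma ae_ne_zero : ∀ᵐ t : ℂ, t ≠ 0 := by
  filter_upwards [compl_mem_ae_iff.2 (measure_singleton (0 : ℂ))] with t ht using ht

/-- The integrable kernel on `ℂ`. -/
def kk (v : ℂ) : ℝ := ((1 + ‖v‖ ^ 2) ^ 2)⁻¹

lemma kk_integrable : Integrable kk := by
  have := integrable_rpow_neg_one_add_norm_sq (E := ℂ) (μ := volume) (r := 4)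
    (by rw [Complex.finrank_real_complex]; norm_num)
  refine this.congr (ae_of_all _ fun v => ?_)
  simp only [kk]
  rw [show (-4 / 2 : ℝ) = -((2 : ℕ) : ℝ) by norm_num, Real.rpow_neg (by positivity),
    Real.rpow_natCast]

lemma kk_nonneg (v : ℂ) : 0 ≤ kk v := by unfold kk; positivity

lemma kk_continuous : Continuous kk := by
  unfold kk
  refine Continuous.inv₀ (by fun_prop) fun v => by positivity

lemma w1_integrable : Integrable (fun t : ℂ => ‖t‖⁻¹ * ((1 + ‖t‖) ^ 3)⁻¹) := by
  have h := (integrable_fun_norm_addHaar (E := ℂ) (volume : Measure ℂ)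
    (f := fun y => y⁻¹ * ((1 + y) ^ 3)⁻¹)).2
  refine h ?_
  have h2 := (integrable_one_add_norm (E := ℝ) (μ := volume) (r := 3) (by simp)).integrableOn
    (s := Set.Ioi 0)
  refine h2.congr_fun (fun y hy => ?_) measurableSet_Ioi
  have hy' : 0 < y := hy
  simp only [Complex.finrank_real_complex, Real.norm_of_nonneg hy'.le, smul_eq_mul]
  rw [show (-3 : ℝ) = -((3 : ℕ) : ℝ) by norm_num, Real.rpow_neg (by positivity),
    Real.rpow_natCast]
  field_simp
  norm_num

lemma dom_integrable (a : ℂ) : Integrable (fun q : ℂ × ℂ =>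
    (‖q.1‖ ^ 2)⁻¹ * ((1 + ‖q.1‖) ^ 3)⁻¹ * kk ((((Real.sqrt ‖q.1‖)⁻¹ : ℝ) : ℂ) * (q.2 - a))) := by
  have hm : Measurable (fun q : ℂ × ℂ =>
    (‖q.1‖ ^ 2)⁻¹ * ((1 + ‖q.1‖) ^ 3)⁻¹ * kk ((((Real.sqrt ‖q.1‖)⁻¹ : ℝ) : ℂ) * (q.2 - a))) := by
    have := kk_continuous.measurable
    fun_prop
  rw [Measure.volume_eq_prod, integrable_prod_iff hm.aestronglyMeasurable]
  have hs : ∀ t : ℂ, t ≠ 0 → (((Real.sqrt ‖t‖)⁻¹ : ℝ) : ℂ) ≠ 0 := by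
    intro t ht
    have : 0 < ‖t‖ := norm_pos_iff.2 ht
    exact_mod_cast (inv_pos.2 (Real.sqrt_pos.2 this)).ne'
  constructor
  · filter_upwards [ae_ne_zero] with t ht
    exact ((scal_C_integrable kk_integrable _ (hs t ht)).comp_sub_right a).const_mul _
  · refine (w1_integrable.mul_const (∫ v, kk v)).congr ?_
    filter_upwards [ae_ne_zero] with t ht
    have h0 : 0 < ‖t‖ := norm_pos_iff.2 ht
    have e1 : ∀ u, ‖(‖t‖ ^ 2)⁻¹ * ((1 + ‖t‖) ^ 3)⁻¹ *
        kk ((((Real.sqrt ‖t‖)⁻¹ : ℝ) : ℂ) * (u - a))‖ = (‖t‖ ^ 2)⁻¹ * ((1 + ‖t‖) ^ 3)⁻¹ *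
        kk ((((Real.sqrt ‖t‖)⁻¹ : ℝ) : ℂ) * (u - a)) := fun u =>
      Real.norm_of_nonneg (mul_nonneg (by positivity) (kk_nonneg _))
    simp only [e1]
    rw [integral_const_mul, integral_sub_right_eq_self
      (fun v => kk ((((Real.sqrt ‖t‖)⁻¹ : ℝ) : ℂ) * v)) a, scal_C kk _ (hs t ht)]
    have e2 : ‖(((Real.sqrt ‖t‖)⁻¹ : ℝ) : ℂ)‖ ^ 2 = ‖t‖⁻¹ := by
      rw [Complex.norm_real, Real.norm_eq_abs, sq_abs, inv_pow, Real.sq_sqrt h0.le]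
    rw [e2, smul_eq_mul]
    field_simp

lemma H_measurable (d : ℕ) (Φ₂ : 𝓢(ℂ × ℂ × ℂ, ℂ)) : Measurable (fun p : ℂ × (ℂ × ℂ) =>
    Φ₂ (p.2.2, (p.1 - p.2.2 ^ 2) / p.2.1, p.2.1) * ((‖p.2.1‖ ^ ((d : ℝ) - 5) : ℝ) : ℂ)) := by
  have := Φ₂.continuous.measurable
  fun_prop

lemma rpow_w (m : ℕ) (t : ℂ) (ht : t ≠ 0) :
    ‖t‖ ^ (((2 * m + 3 : ℕ) : ℝ) - 5) = ‖t‖ ^ (2 * m) * (‖t‖ ^ 2)⁻¹ := by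
  have h0 : 0 < ‖t‖ := norm_pos_iff.2 ht
  rw [show ((2 * m + 3 : ℕ) : ℝ) - 5 = ((2 * m : ℕ) : ℝ) - ((2 : ℕ) : ℝ) by push_cast; ring,
    Real.rpow_sub h0, Real.rpow_natCast, Real.rpow_natCast]
  rfl

/-- Absolute convergence of the twisted pushforward. -/
lemma part1 (m : ℕ) (Φ₂ : 𝓢(ℂ × ℂ × ℂ, ℂ)) (ξ : ℂ) : Integrable (fun q : ℂ × ℂ =>
    Φ₂ (q.2, (ξ - q.2 ^ 2) / q.1, q.1) *
      ((‖q.1‖ ^ (((2 * m + 3 : ℕ) : ℝ) - 5) : ℝ) : ℂ)) := by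
  obtain ⟨a, ha⟩ : ∃ a : ℂ, a ^ 2 = ξ := IsAlgClosed.exists_pow_nat_eq ξ (by norm_num)
  obtain ⟨C, hC⟩ : ∃ C : ℝ, ∀ p : ℂ × ℂ × ℂ, (1 + ‖p‖) ^ (2 * m + 5) * ‖Φ₂ p‖ ≤ C := by
    refine ⟨2 ^ (2 * m + 5) * ((Finset.Iic ((2 * m + 5 : ℕ), (0 : ℕ))).sup
      (fun m => SchwartzMap.seminorm ℝ m.1 m.2)) Φ₂, fun p => ?_⟩
    have := SchwartzMap.one_add_le_sup_seminorm_apply (𝕜 := ℝ) (m := (2 * m + 5, 0))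
      (k := 2 * m + 5) (n := 0) le_rfl le_rfl Φ₂ p
    rw [norm_iteratedFDeriv_zero] at this
    exact this
  have hC0 : 0 ≤ C := le_trans (by positivity) (hC 0)
  refine (((dom_integrable a).add (dom_integrable (-a))).const_mul C).mono'
    ((H_measurable _ Φ₂).comp (measurable_const.prodMk measurable_id)).aestronglyMeasurable ?_
  have hae : ∀ᵐ q : ℂ × ℂ, q.1 ≠ 0 := by
    rw [Measure.volume_eq_prod]
    exact Measure.quasiMeasurePreserving_fst.ae ae_ne_zero
  filter_upwards [hae] with q hq
  obtain ⟨t, u⟩ := q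
  simp only at hq
  have h0 : 0 < ‖t‖ := norm_pos_iff.2 hq
  rw [norm_mul, rpow_w m t hq, Complex.norm_real, Real.norm_of_nonneg (by positivity)]
  set b := (ξ - u ^ 2) / t with hb
  have hb' : ‖b‖ = ‖u - a‖ * ‖u + a‖ / ‖t‖ := by
    rw [hb, ← ha, show a ^ 2 - u ^ 2 = -((u - a) * (u + a)) by ring, norm_div, norm_neg, norm_mul]
  have hP : (1 + ‖b‖) ^ 2 * (1 + ‖t‖) ^ (2 * m + 3) * ‖Φ₂ (u, b, t)‖ ≤ C := by
    refine le_trans ?_ (hC (u, b, t))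
    have h1 : ‖b‖ ≤ ‖(u, b, t)‖ := (norm_fst_le (b, t)).trans (norm_snd_le (u, b, t))
    have h2 : ‖t‖ ≤ ‖(u, b, t)‖ := (norm_snd_le (b, t)).trans (norm_snd_le (u, b, t))
    have h3 : (1 + ‖(u, b, t)‖) ^ (2 * m + 5) =
        (1 + ‖(u, b, t)‖) ^ 2 * (1 + ‖(u, b, t)‖) ^ (2 * m + 3) := by ring
    rw [h3]
    gcongr
  have hkey : ((1 + ‖b‖) ^ 2)⁻¹ ≤ kk ((((Real.sqrt ‖t‖)⁻¹ : ℝ) : ℂ) * (u - a)) +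
      kk ((((Real.sqrt ‖t‖)⁻¹ : ℝ) : ℂ) * (u - -a)) := by
    have e : ∀ z : ℂ, kk ((((Real.sqrt ‖t‖)⁻¹ : ℝ) : ℂ) * z) = ((1 + ‖z‖ ^ 2 / ‖t‖) ^ 2)⁻¹ := by
      intro z
      rw [kk, norm_mul, mul_pow, Complex.norm_real, Real.norm_eq_abs, sq_abs, inv_pow,
        Real.sq_sqrt h0.le]
      ring
    rcases le_total ‖u - a‖ ‖u + a‖ with h | h
    · refine le_trans ?_ (le_add_of_nonneg_right (kk_nonneg _))
      rw [e, hb', sq ‖u - a‖]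
      gcongr
    · refine le_trans ?_ (le_add_of_nonneg_left (kk_nonneg _))
      rw [e, hb', sub_neg_eq_add, sq ‖u + a‖]
      gcongr
  have hT : ‖t‖ ^ (2 * m) ≤ (1 + ‖t‖) ^ (2 * m) := by gcongr; linarith
  have hΦ : ‖Φ₂ (u, b, t)‖ ≤ C * ((1 + ‖t‖) ^ (2 * m + 3))⁻¹ * ((1 + ‖b‖) ^ 2)⁻¹ := by
    rw [← div_eq_mul_inv, ← div_eq_mul_inv, le_div_iff₀ (by positivity),
      le_div_iff₀ (by positivity)]
    linarith
  simp only [Pi.add_apply]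
  rw [← mul_add]
  set S := kk ((((Real.sqrt ‖t‖)⁻¹ : ℝ) : ℂ) * (u - a)) +
      kk ((((Real.sqrt ‖t‖)⁻¹ : ℝ) : ℂ) * (u - -a)) with hS
  have hS0 : 0 ≤ S := add_nonneg (kk_nonneg _) (kk_nonneg _)
  calc ‖Φ₂ (u, b, t)‖ * (‖t‖ ^ (2 * m) * (‖t‖ ^ 2)⁻¹)
      ≤ (C * ((1 + ‖t‖) ^ (2 * m + 3))⁻¹ * S) * ((1 + ‖t‖) ^ (2 * m) * (‖t‖ ^ 2)⁻¹) := by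
        gcongr
        exact hΦ.trans (by gcongr)
    _ = C * ((‖t‖ ^ 2)⁻¹ * ((1 + ‖t‖) ^ 3)⁻¹ * S) := by
        rw [pow_add]
        field_simp

end PF

namespace PF
set_option linter.unusedSectionVars false

instance volProd {E F : Type} [NormedAddCommGroup E] [NormedSpace ℝ E] [MeasureSpace E]
    [BorelSpace E] [FiniteDimensional ℝ E] [(volume : Measure E).IsAddHaarMeasure]
    [NormedAddCommGroup F] [NormedSpace ℝ F] [MeasureSpace F] [BorelSpace F]
    [FiniteDimensional ℝ F] [(volume : Measure F).IsAddHaarMeasure] :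
    (volume : Measure (E × F)).IsAddHaarMeasure := by
  haveI : ProperSpace E := FiniteDimensional.proper ℝ E
  haveI : ProperSpace F := FiniteDimensional.proper ℝ F
  rw [Measure.volume_eq_prod]; infer_instance

lemma aff_int {F : Type} [NormedAddCommGroup F] [NormedSpace ℝ F] (k : ℂ → F) (a t : ℂ)
    (ht : t ≠ 0) : ∫ ξ, k ((ξ - a) / t) = (‖t‖ ^ 2) • ∫ b, k b := by
  rw [integral_sub_right_eq_self (fun ξ => k (ξ / t)) a]
  have := scal_C k t⁻¹ (inv_ne_zero ht)
  simp only [div_eq_inv_mul]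
  rw [this, norm_inv, inv_pow, inv_inv]

lemma aff_integrable {F : Type} [NormedAddCommGroup F] [NormedSpace ℝ F] {k : ℂ → F}
    (hk : Integrable k) (a t : ℂ) (ht : t ≠ 0) : Integrable (fun ξ => k ((ξ - a) / t)) := by
  have h := (scal_C_integrable hk t⁻¹ (inv_ne_zero ht)).comp_sub_right a
  simpa only [div_eq_inv_mul] using h

/-- temperate growth of even powers of the norm of a coordinate -/
lemma htg_normpow {E : Type} [NormedAddCommGroup E] [NormedSpace ℝ E] (f : E →L[ℝ] ℂ) (m : ℕ) :
    (fun p => ((‖f p‖ ^ (2 * m) : ℝ) : ℂ)).HasTemperateGrowth := by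
  have h1 : (fun x : ℂ => ‖x‖ ^ 2).HasTemperateGrowth := Function.hasTemperateGrowth_norm_sq ℂ
  have h2 : (fun x : E => ‖f x‖ ^ 2).HasTemperateGrowth :=
    h1.comp f.hasTemperateGrowth
  have h3 := (Complex.ofRealCLM.hasTemperateGrowth).comp (h2.pow m)
  refine (iff_of_eq (congrArg _ ?_)).1 h3
  ext p
  simp [pow_mul]

/-- Weighted Schwartz function. -/
def wS (m : ℕ) (Φ : 𝓢((ℂ × ℂ) × ℂ, ℂ)) : 𝓢((ℂ × ℂ) × ℂ, ℂ) :=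
  SchwartzMap.smulLeftCLM ℂ (fun p : (ℂ × ℂ) × ℂ => ((‖p.1.2‖ ^ (2 * m) : ℝ) : ℂ)) Φ

lemma wS_apply (m : ℕ) (Φ : 𝓢((ℂ × ℂ) × ℂ, ℂ)) (p) :
    wS m Φ p = ((‖p.1.2‖ ^ (2 * m) : ℝ) : ℂ) * Φ p := by
  have := htg_normpow ((ContinuousLinearMap.snd ℝ ℂ ℂ).comp
    (ContinuousLinearMap.fst ℝ (ℂ × ℂ) ℂ)) m
  exact SchwartzMap.smulLeftCLM_apply_apply this Φ p

section
variable (m : ℕ) (Φ₂ : 𝓢(ℂ × ℂ × ℂ, ℂ)) (Φ' : 𝓢((ℂ × ℂ) × ℂ, ℂ))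

/-- The integrand of the twisted pushforward. -/
def HH (p : ℂ × (ℂ × ℂ)) : ℂ :=
  Φ₂ (p.2.2, (p.1 - p.2.2 ^ 2) / p.2.1, p.2.1) *
    ((‖p.2.1‖ ^ (((2 * m + 3 : ℕ) : ℝ) - 5) : ℝ) : ℂ)

lemma HH_eq (hΦ : ∀ u b t, Φ₂ (u, b, t) = Φ' ((u, t), b))
    (l ξ t u : ℂ) (ht : t ≠ 0) : ch (l * ξ) * HH m Φ₂ (ξ, (t, u)) =
    (fun b => ((‖t‖ ^ 2)⁻¹ : ℝ) • (ch (l * u ^ 2) * (ch (b * (l * t)) * wS m Φ' ((u, t), b))))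
      ((ξ - u ^ 2) / t) := by
  simp only [HH, wS_apply, hΦ]
  rw [rpow_w m t ht, show l * ξ = l * u ^ 2 + (ξ - u ^ 2) / t * (l * t) by field_simp; ring,
    ch_add, Complex.real_smul]
  push_cast
  ring

lemma wS_slice (q : ℂ × ℂ) (l u t : ℂ) : Integrable
    (fun b => ((‖t‖ ^ 2)⁻¹ : ℝ) • (ch (l * u ^ 2) * (ch (b * (l * t)) * wS m Φ' (q, b)))) := by
  refine Integrable.smul ((‖t‖ ^ 2)⁻¹ : ℝ) (Integrable.const_mul (?_ : Integrable (fun b =>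
    ch (b * (l * t)) * wS m Φ' (q, b))) (ch (l * u ^ 2)))
  refine integrable_mul_unit (slice_integrable _ _) ?_ fun _ => ch_norm _
  have := ch_continuous
  exact Continuous.aestronglyMeasurable (by fun_prop)

lemma ae_ne_zero_fst : ∀ᵐ q : ℂ × ℂ, q.1 ≠ 0 := by
  rw [Measure.volume_eq_prod]
  exact Measure.quasiMeasurePreserving_fst.ae ae_ne_zero

lemma HH_integrable (hΦ : ∀ u b t, Φ₂ (u, b, t) = Φ' ((u, t), b)) :
     Integrable (HH m Φ₂) := by
  have hm : Measurable (HH m Φ₂) := H_measurable _ Φ₂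
  rw [Measure.volume_eq_prod, integrable_prod_iff' hm.aestronglyMeasurable]
  have hE : ∀ ξ t u : ℂ, t ≠ 0 → HH m Φ₂ (ξ, (t, u)) =
      (fun b => ((‖t‖ ^ 2)⁻¹ : ℝ) • (ch (0 * u ^ 2) * (ch (b * (0 * t)) * wS m Φ' ((u, t), b))))
      ((ξ - u ^ 2) / t) := fun ξ t u ht => by
    have := HH_eq m Φ₂ Φ' hΦ 0 ξ t u ht
    rwa [zero_mul, ch_zero, one_mul] at this
  constructor
  · filter_upwards [ae_ne_zero_fst] with q hq
    obtain ⟨t, u⟩ := q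
    refine (aff_integrable (wS_slice m Φ' (u, t) 0 u t) (u ^ 2) t hq).congr
      (ae_of_all _ fun ξ => (hE ξ t u hq).symm)
  · have h1 : Integrable (fun q : ℂ × ℂ => ∫ b, ‖wS m Φ' (q, b)‖) := by
      have : Integrable (fun p : (ℂ × ℂ) × ℂ => ‖wS m Φ' p‖) := (wS m Φ').integrable.norm
      exact this.integral_prod_left
    refine h1.swap.congr ?_
    filter_upwards [ae_ne_zero_fst] with q hq
    obtain ⟨t, u⟩ := q
    have h0 : 0 < ‖t‖ := norm_pos_iff.2 hq
    have e : ∀ ξ, ‖HH m Φ₂ (ξ, (t, u))‖ =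
        (fun b => (‖t‖ ^ 2)⁻¹ * ‖wS m Φ' ((u, t), b)‖) ((ξ - u ^ 2) / t) := by
      intro ξ
      rw [hE ξ t u hq, norm_smul, norm_mul, norm_mul, ch_norm, ch_norm, one_mul, one_mul,
        Real.norm_of_nonneg (by positivity)]
    simp only [e, Function.comp]
    rw [aff_int (fun b => (‖t‖ ^ 2)⁻¹ * ‖wS m Φ' ((u, t), b)‖) _ t hq, integral_const_mul,
      smul_eq_mul]
    simp only [Prod.swap]
    field_simp

lemma hThree_eq (ξ : ℂ) : hThreeC (2 * m + 3) Φ₂ ξ = ∫ q : ℂ × ℂ, HH m Φ₂ (ξ, q) := by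
  rw [hThreeC, Measure.volume_eq_prod]
  have h := part1 m Φ₂ ξ
  rw [Measure.volume_eq_prod] at h
  refine Eq.trans ?_ (integral_prod (fun q : ℂ × ℂ => HH m Φ₂ (ξ, q)) h).symm
  rw [Measure.restrict_eq_self_of_ae_mem]
  · rfl
  · exact ae_ne_zero

lemma hThree_integrable (hΦ : ∀ u b t, Φ₂ (u, b, t) = Φ' ((u, t), b)) :
     Integrable (hThreeC (2 * m + 3) Φ₂) := by
  rw [show hThreeC (2 * m + 3) Φ₂ = _ from funext (hThree_eq m Φ₂)]
  have := HH_integrable m Φ₂ Φ' hΦ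
  exact this.integral_prod_left

/-- Fourier transform of the twisted pushforward. -/
lemma hThree_fourier (hΦ : ∀ u b t, Φ₂ (u, b, t) = Φ' ((u, t), b))
    (l : ℂ) : ∫ ξ, ch (l * ξ) * hThreeC (2 * m + 3) Φ₂ ξ =
    ∫ q : ℂ × ℂ, ch (l * q.1 ^ 2) * (((‖q.2‖ ^ (2 * m) : ℝ) : ℂ) *
      pft volume (-LC) Φ' (q, l * q.2)) := by
  have hc := ch_continuous
  have hi : Integrable (fun p : ℂ × (ℂ × ℂ) => ch (l * p.1) * HH m Φ₂ p) :=
    integrable_mul_unit (HH_integrable m Φ₂ Φ' hΦ)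
      (Continuous.aestronglyMeasurable (by fun_prop)) fun _ => ch_norm _
  have e1 : ∀ ξ, ch (l * ξ) * hThreeC (2 * m + 3) Φ₂ ξ =
      ∫ q : ℂ × ℂ, ch (l * ξ) * HH m Φ₂ (ξ, q) := fun ξ => by
    rw [hThree_eq, integral_const_mul]
  simp only [e1]
  rw [integral_integral_swap hi]
  have e2 : ∀ᵐ q : ℂ × ℂ, ∫ ξ, ch (l * ξ) * HH m Φ₂ (ξ, q) =
      (fun q : ℂ × ℂ => ch (l * q.1 ^ 2) * (((‖q.2‖ ^ (2 * m) : ℝ) : ℂ) *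
      pft volume (-LC) Φ' (q, l * q.2))) q.swap := by
    filter_upwards [ae_ne_zero_fst] with q hq
    obtain ⟨t, u⟩ := q
    have h0 : (‖t‖ ^ 2) ≠ 0 := by simpa using hq
    simp only [HH_eq m Φ₂ Φ' hΦ l _ t u hq]
    rw [aff_int (fun b => ((‖t‖ ^ 2)⁻¹ : ℝ) • (ch (l * u ^ 2) * (ch (b * (l * t)) *
      wS m Φ' ((u, t), b)))) _ t hq, integral_smul, smul_smul, mul_inv_cancel₀ h0, one_smul,
      integral_const_mul]
    simp only [Prod.swap, pft]
    rw [← integral_const_mul (((‖t‖ ^ (2 * m) : ℝ) : ℂ))]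
    congr 2
    ext1 b
    simp [wS_apply, Circle.smul_def, ch]
    ring
  rw [integral_congr_ae e2, Measure.volume_eq_prod]
  exact integral_prod_swap (fun q : ℂ × ℂ => ch (l * q.1 ^ 2) * (((‖q.2‖ ^ (2 * m) : ℝ) : ℂ) *
      pft volume (-LC) Φ' (q, l * q.2)))

end
end PF

namespace PF
set_option linter.unusedSectionVars false

/-- Restriction of a Schwartz function to the graph of a linear map. -/
def restr {E V : Type} [NormedAddCommGroup E] [NormedSpace ℝ E]
    [NormedAddCommGroup V] [NormedSpace ℝ V] (S : 𝓢(E × V, ℂ)) (φ : E →L[ℝ] V) : 𝓢(E, ℂ) :=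
  SchwartzMap.compCLMOfAntilipschitz ℂ (K := 1)
    ((ContinuousLinearMap.id ℝ E).prod φ).hasTemperateGrowth
    (AntilipschitzWith.of_le_mul_dist fun x y => by
      rw [NNReal.coe_one, one_mul, Prod.dist_eq]; exact le_max_left _ _) S

lemma restr_apply {E V : Type} [NormedAddCommGroup E] [NormedSpace ℝ E]
    [NormedAddCommGroup V] [NormedSpace ℝ V] (S : 𝓢(E × V, ℂ)) (φ : E →L[ℝ] V) (e : E) :
    restr S φ e = S (e, φ e) := rfl

/-- scaling of the second component, as a real-linear map -/
def sclm (V : Type) [NormedAddCommGroup V] [NormedSpace ℂ V] (l : ℂ) : (ℂ × V) →L[ℝ] V :=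
  (l • ContinuousLinearMap.snd ℂ ℂ V).restrictScalars ℝ

lemma sclm_apply (V : Type) [NormedAddCommGroup V] [NormedSpace ℂ V] (l : ℂ) (p : ℂ × V) :
    sclm V l p = l • p.2 := rfl

section
variable {V : Type} [NormedAddCommGroup V] [NormedSpace ℂ V] [MeasureSpace V] [BorelSpace V]
  [FiniteDimensional ℝ V] [(volume : Measure V).IsAddHaarMeasure]

lemma int_uv (S : 𝓢((ℂ × V) × V, ℂ)) (l : ℂ) :
    ∫ q : ℂ × V, ch (l * q.1 ^ 2) * S (q, l • q.2) =
      ∫ u, ch (l * u ^ 2) * ∫ x, S ((u, x), l • x) := by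
  have := FiniteDimensional.proper ℝ V
  have hc := ch_continuous
  have hi : Integrable (fun q : ℂ × V => ch (l * q.1 ^ 2) * restr S (sclm V l) q) :=
    integrable_mul_unit (restr S (sclm V l)).integrable
      (Continuous.aestronglyMeasurable (by fun_prop)) fun _ => ch_norm _
  refine (integral_prod _ hi).trans ?_
  congr 1
  ext1 u
  exact integral_const_mul (ch (l * u ^ 2)) (fun x => S ((u, x), l • x))

lemma int_pft_uv (L : V →L[ℝ] V →L[ℝ] ℝ) (hL : ∀ η, ‖η‖ ≤ 1 * ‖L.flip η‖) (Φ : 𝓢((ℂ × V) × V, ℂ))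
    (l : ℂ) :
    ∫ p : (ℂ × V) × V, ch (l * p.1.1 ^ 2) * ((𝐞 (L p.2 (l • p.1.2)) : Circle) : ℂ) * Φ p =
      ∫ u, ch (l * u ^ 2) * ∫ x, pft volume (-L) Φ ((u, x), l • x) := by
  have hc := ch_continuous
  have h1 := integral_pft L Φ (sclm V l) (sclm V l).continuous (fun q : ℂ × V => ch (l * q.1 ^ 2))
    (by fun_prop) (fun _ => ch_norm _)
  have h2 := int_uv (pftS volume (-L) (neg_lower hL) Φ) l
  exact h1.trans h2
end

/-- reassociation -/
def assocS {A B C : Type} [NormedAddCommGroup A] [NormedSpace ℝ A]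
    [NormedAddCommGroup B] [NormedSpace ℝ B] [NormedAddCommGroup C] [NormedSpace ℝ C]
    (S : 𝓢((A × B) × C, ℂ)) : 𝓢(A × (B × C), ℂ) :=
  SchwartzMap.compCLMOfContinuousLinearEquiv ℂ (ContinuousLinearEquiv.prodAssoc ℝ A B C).symm S

/-- reassociation -/
def unassocS {A B C : Type} [NormedAddCommGroup A] [NormedSpace ℝ A]
    [NormedAddCommGroup B] [NormedSpace ℝ B] [NormedAddCommGroup C] [NormedSpace ℝ C]
    (S : 𝓢(A × (B × C), ℂ)) : 𝓢((A × B) × C, ℂ) :=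
  SchwartzMap.compCLMOfContinuousLinearEquiv ℂ (ContinuousLinearEquiv.prodAssoc ℝ A B C) S

/-- First direction, in product coordinates. -/
lemma core_one (m : ℕ) (Φ : 𝓢((ℂ × (Fin (m + 1) → ℂ)) × (Fin (m + 1) → ℂ), ℂ)) :
    ∃ Φ' : 𝓢((ℂ × ℂ) × ℂ, ℂ), ∀ l : ℂ,
      ∫ p : (ℂ × (Fin (m + 1) → ℂ)) × (Fin (m + 1) → ℂ),
        ch (l * (p.1.1 ^ 2 + ∑ i, p.1.2 i * p.2 i)) * Φ p =
      ∫ q : ℂ × ℂ, ch (l * q.1 ^ 2) * (((‖q.2‖ ^ (2 * m) : ℝ) : ℂ) *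
        pft volume (-LC) Φ' (q, l * q.2)) := by
  set F := pftS volume (-LX (m + 1)) (neg_lower (LX_lower (m + 1))) Φ with hF
  obtain ⟨Ψ, hΨ⟩ := avg_lemma (μ := (volume : Measure (Fin (m + 1) → ℂ))) (assocS F) (rho 1)
    (rho_contDiff 1) (rho_supp 1) (1 / 2) (by norm_num) (rho_zero 1) (fun _ => 1)
    (Function.HasTemperateGrowth.const 1)
  obtain ⟨Φ', hΦ'⟩ := pft_inversion (unassocS (cc⁻¹ • Ψ))
  refine ⟨Φ', fun l => ?_⟩
  have hL : ∫ p : (ℂ × (Fin (m + 1) → ℂ)) × (Fin (m + 1) → ℂ),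
        ch (l * (p.1.1 ^ 2 + ∑ i, p.1.2 i * p.2 i)) * Φ p =
      ∫ u, ch (l * u ^ 2) * ∫ x, F ((u, x), l • x) := by
    refine Eq.trans ?_ (int_pft_uv (LX (m + 1)) (LX_lower _) Φ l)
    congr 1
    ext1 p
    congr 1
    rw [mul_add, ch_add]
    congr 1
    simp only [ch, LX_apply, Finset.mul_sum, Pi.smul_apply, smul_eq_mul]
    congr 4
    ext1 i
    ring
  have hR : ∫ q : ℂ × ℂ, ch (l * q.1 ^ 2) * (((‖q.2‖ ^ (2 * m) : ℝ) : ℂ) *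
        pft volume (-LC) Φ' (q, l * q.2)) =
      ∫ u, ch (l * u ^ 2) * ∫ t, ((‖t‖ ^ (2 * m) : ℝ) : ℂ) * (cc⁻¹ * Ψ (u, (t, l * t))) := by
    have h := int_uv (wS m (unassocS (cc⁻¹ • Ψ))) l
    simp only [wS_apply] at h
    simp only [hΦ']
    exact h
  rw [hL, hR]
  congr 1
  ext1 u
  congr 1
  set I := ∫ x, F ((u, x), l • x) with hI
  have key : ∀ᵐ t : ℂ, ((‖t‖ ^ (2 * m) : ℝ) : ℂ) * (cc⁻¹ * Ψ (u, (t, l * t))) =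
      (rho 1 (t, l * t) * (((‖t‖ ^ (2 * 1))⁻¹ : ℝ) : ℂ)) * (cc⁻¹ * I) := by
    filter_upwards [ae_ne_zero] with t ht
    have h0 : (‖t‖ : ℂ) ≠ 0 := by simpa using ht
    rw [hΨ]
    have e : ∀ x : Fin (m + 1) → ℂ, (1 : ℂ) * assocS F (u, (t • x, (l * t) • x)) =
        (fun x => F ((u, x), l • x)) (t • x) := by
      intro x; rw [one_mul, mul_smul]; rfl
    simp only [e]
    rw [scal_pi (m + 1) (fun x => F ((u, x), l • x)) t ht, ← hI, Complex.real_smul]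
    push_cast
    rw [mul_add, pow_add]
    field_simp
    ring
  rw [integral_congr_ae key, integral_mul_const, int_rho]
  have h1 : ((1 + ‖l‖ ^ 2 : ℝ) : ℂ) ≠ 0 := by
    exact_mod_cast (by positivity : (0 : ℝ) < 1 + ‖l‖ ^ 2).ne'
  have h2 := cc_ne
  field_simp

/-- External power of a Schwartz function. -/
lemma powS {V : Type} [NormedAddCommGroup V] [NormedSpace ℝ V] (G : 𝓢(V, ℂ)) (m : ℕ) :
    ∃ S : 𝓢(Fin m → V, ℂ), ∀ z, S z = ∏ i, G (z i) := by
  induction m with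
  | zero =>
    refine ⟨HasCompactSupport.toSchwartzMap (f := fun _ => 1)
      (HasCompactSupport.intro (K := Set.univ) isCompact_univ (by simp)) contDiff_const, ?_⟩
    intro z
    rw [Fin.prod_univ_zero]
    rfl
  | succ m ih =>
    obtain ⟨S, hS⟩ := ih
    refine ⟨SchwartzMap.compCLMOfContinuousLinearEquiv ℂ
      (Fin.consEquivL ℝ (fun _ : Fin (m + 1) => V)).symm (extS G S), fun z => ?_⟩
    rw [SchwartzMap.compCLMOfContinuousLinearEquiv_apply, Function.comp_apply, extS_apply,
      Fin.prod_univ_succ, hS]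
    rfl

/-- Second direction, in product coordinates. -/
lemma core_two (m : ℕ) (Φ' : 𝓢((ℂ × ℂ) × ℂ, ℂ)) :
    ∃ Φ : 𝓢(((ℂ × ℂ) × ℂ) × (Fin m → ℂ × ℂ), ℂ), ∀ l : ℂ,
      ∫ p : ((ℂ × ℂ) × ℂ) × (Fin m → ℂ × ℂ),
        ch (l * (p.1.1.1 ^ 2 + p.1.1.2 * p.1.2 + ∑ i, (p.2 i).1 * (p.2 i).2)) * Φ p =
      ∫ q : ℂ × ℂ, ch (l * q.1 ^ 2) * (((‖q.2‖ ^ (2 * m) : ℝ) : ℂ) *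
        pft volume (-LC) Φ' (q, l * q.2)) := by
  set K := pftS volume (-LC) (neg_lower LC_lower) Φ' with hK
  obtain ⟨Ψ, hΨ⟩ := avg_lemma (μ := (volume : Measure ℂ)) (assocS K) (rho (m + 1))
    (rho_contDiff _) (rho_supp _) (1 / 2) (by norm_num) (rho_zero _)
    (fun a => ((‖a‖ ^ (2 * m) : ℝ) : ℂ)) (htg_normpow (ContinuousLinearMap.id ℝ ℂ) m)
  obtain ⟨Φ₃, hΦ₃⟩ := pft_inversion (unassocS Ψ)
  obtain ⟨G, hG⟩ := pft_inversion ((rho_supp 0).toSchwartzMap (rho_contDiff 0))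
  obtain ⟨S, hS⟩ := powS G m
  refine ⟨(cc ^ (m + 1))⁻¹ • extS Φ₃ S, fun l => ?_⟩
  have h1 : ((1 + ‖l‖ ^ 2 : ℝ) : ℂ) ≠ 0 := by
    exact_mod_cast (by positivity : (0 : ℝ) < 1 + ‖l‖ ^ 2).ne'
  have h2 := cc_ne
  have hc := ch_continuous
  set s := ((1 + ‖l‖ ^ 2 : ℝ) : ℂ) with hs
  set J := ∫ q : ℂ × ℂ, ch (l * q.1 ^ 2) * (((‖q.2‖ ^ (2 * m) : ℝ) : ℂ) *
        pft volume (-LC) Φ' (q, l * q.2)) with hJ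
  have hJ' : J = ∫ u, ch (l * u ^ 2) * ∫ t, ((‖t‖ ^ (2 * m) : ℝ) : ℂ) * K ((u, t), l * t) := by
    have h := int_uv (wS m K) l
    simp only [wS_apply] at h
    exact h
  have hGint : ∫ z : ℂ × ℂ, ch (l * (z.1 * z.2)) * G z = s⁻¹ * cc := by
    have h := integral_pft LC G (fun x => l * x) (by fun_prop) (fun _ => 1) continuous_const
      (by simp)
    have h3 : ∫ z : ℂ × ℂ, ch (l * (z.1 * z.2)) * G z =
        ∫ p : ℂ × ℂ, 1 * ((𝐞 (LC p.2 (l * p.1)) : Circle) : ℂ) * G p := by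
      congr 1
      ext1 p
      rw [one_mul, ch, LC_apply]
      congr 4
      ring
    rw [h3, h]
    have h4 := int_rho 0 l
    rw [pow_zero, one_mul] at h4
    rw [← h4]
    congr 1
    ext1 t
    rw [hG, mul_zero, pow_zero, inv_one, Complex.ofReal_one, mul_one, one_mul]
    rfl
  have hΦint : ∫ p : (ℂ × ℂ) × ℂ, ch (l * (p.1.1 ^ 2 + p.1.2 * p.2)) * Φ₃ p = s ^ m * cc * J := by
    have h := int_pft_uv LC LC_lower Φ₃ l
    have h3 : ∫ p : (ℂ × ℂ) × ℂ, ch (l * (p.1.1 ^ 2 + p.1.2 * p.2)) * Φ₃ p =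
        ∫ p : (ℂ × ℂ) × ℂ, ch (l * p.1.1 ^ 2) * ((𝐞 (LC p.2 (l • p.1.2)) : Circle) : ℂ) * Φ₃ p := by
      congr 1
      ext1 p
      rw [mul_add, ch_add]
      simp only [ch, LC_apply, smul_eq_mul]
      congr 5
      ring
    rw [h3, h, hJ', ← integral_const_mul]
    congr 1
    ext1 u
    rw [mul_left_comm]
    congr 1
    set I := ∫ t, ((‖t‖ ^ (2 * m) : ℝ) : ℂ) * K ((u, t), l * t) with hI
    have key : ∀ᵐ t : ℂ, pft volume (-LC) Φ₃ ((u, t), l • t) =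
        (rho (m + 1) (t, l * t) * (((‖t‖ ^ (2 * (m + 1)))⁻¹ : ℝ) : ℂ)) * I := by
      filter_upwards [ae_ne_zero] with t ht
      have h0 : (‖t‖ : ℂ) ≠ 0 := by simpa using ht
      rw [hΦ₃]
      change Ψ (u, (t, l * t)) = _
      rw [hΨ]
      have e : ∀ a : ℂ, ((‖a‖ ^ (2 * m) : ℝ) : ℂ) * assocS K (u, (t • a, (l * t) • a)) =
          (((‖t‖ ^ (2 * m))⁻¹ : ℝ) : ℂ) *
            (fun a => ((‖a‖ ^ (2 * m) : ℝ) : ℂ) * K ((u, a), l * a)) (t * a) := by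
        intro a
        simp only [smul_eq_mul, norm_mul, mul_pow, mul_assoc]
        change _ * K ((u, t * a), l * (t * a)) = _
        push_cast
        field_simp
      simp only [e]
      rw [integral_const_mul, scal_C (fun a => ((‖a‖ ^ (2 * m) : ℝ) : ℂ) * K ((u, a), l * a)) t ht,
        ← hI, Complex.real_smul]
      push_cast
      rw [mul_add, pow_add]
      field_simp
      ring
    rw [integral_congr_ae key, integral_mul_const, int_rho, ← hs, pow_succ]
    field_simp
  have e : ∀ p : ((ℂ × ℂ) × ℂ) × (Fin m → ℂ × ℂ),
      ch (l * (p.1.1.1 ^ 2 + p.1.1.2 * p.1.2 + ∑ i, (p.2 i).1 * (p.2 i).2)) *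
        ((cc ^ (m + 1))⁻¹ • extS Φ₃ S) p = (cc ^ (m + 1))⁻¹ *
        ((ch (l * (p.1.1.1 ^ 2 + p.1.1.2 * p.1.2)) * Φ₃ p.1) *
        ∏ i, ch (l * ((p.2 i).1 * (p.2 i).2)) * G (p.2 i)) := by
    intro p
    rw [SchwartzMap.smul_apply, extS_apply, smul_eq_mul, hS, Finset.prod_mul_distrib, ← ch_sum,
      mul_add, ch_add, Finset.mul_sum]
    ring
  simp only [e]
  rw [integral_const_mul, Measure.volume_eq_prod,
    integral_prod_mul (fun p : (ℂ × ℂ) × ℂ => ch (l * (p.1.1 ^ 2 + p.1.2 * p.2)) * Φ₃ p)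
      (fun z : Fin m → ℂ × ℂ => ∏ i, ch (l * ((z i).1 * (z i).2)) * G (z i)), hΦint,
    integral_fintype_prod_volume_eq_pow (fun z : ℂ × ℂ => ch (l * (z.1 * z.2)) * G z), hGint,
    Fintype.card_fin]
  rw [mul_pow, inv_pow, pow_succ]
  field_simp

end PF

namespace PF
set_option linter.unusedSectionVars false

/-- Change of variables along a linear equivalence, up to a constant. -/
lemma change_var {D E : Type} [NormedAddCommGroup D] [NormedSpace ℝ D] [MeasureSpace D]
    [BorelSpace D] [FiniteDimensional ℝ D] [(volume : Measure D).IsAddHaarMeasure]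
    [NormedAddCommGroup E] [NormedSpace ℝ E] [MeasureSpace E] [BorelSpace E]
    [FiniteDimensional ℝ E] [(volume : Measure E).IsAddHaarMeasure] (A : D ≃L[ℝ] E) :
    ∃ c : ℂ, c ≠ 0 ∧ ∀ f : E → ℂ, ∫ z, f (A z) = c * ∫ p, f p := by
  have hp := FiniteDimensional.proper ℝ E
  have h1 : (Measure.map A (volume : Measure D)).IsAddHaarMeasure :=
    A.isAddHaarMeasure_map volume
  have h2 := Measure.isAddLeftInvariant_eq_smul (Measure.map A (volume : Measure D))
    (volume : Measure E)
  have h3 := Measure.addHaarScalarFactor_pos_of_isAddHaarMeasure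
    (Measure.map A (volume : Measure D)) (volume : Measure E)
  set c := Measure.addHaarScalarFactor (Measure.map A (volume : Measure D)) (volume : Measure E)
  refine ⟨((c : ℝ) : ℂ), by exact_mod_cast h3.ne', fun f => ?_⟩
  have h4 := integral_map_equiv (μ := (volume : Measure D)) A.toHomeomorph.toMeasurableEquiv f
  have h5 : Measure.map A.toHomeomorph.toMeasurableEquiv (volume : Measure D) =
    c • (volume : Measure E) := h2
  rw [h5, integral_smul_nnreal_measure] at h4
  refine h4.symm.trans ?_
  rw [← Complex.real_smul]
  rfl

instance haarA (m : ℕ) :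
    (volume : Measure ((ℂ × (Fin (m + 1) → ℂ)) × (Fin (m + 1) → ℂ))).IsAddHaarMeasure :=
  Measure.prod.instIsAddHaarMeasure (volume : Measure (ℂ × (Fin (m + 1) → ℂ)))
    (volume : Measure (Fin (m + 1) → ℂ))

instance haarB (m : ℕ) : (volume : Measure (Fin m → ℂ × ℂ)).IsAddHaarMeasure :=
  Measure.pi.isAddHaarMeasure (fun _ : Fin m => (volume : Measure (ℂ × ℂ)))

instance haarC (m : ℕ) :
    (volume : Measure (((ℂ × ℂ) × ℂ) × (Fin m → ℂ × ℂ))).IsAddHaarMeasure :=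
  Measure.prod.instIsAddHaarMeasure (volume : Measure ((ℂ × ℂ) × ℂ))
    (volume : Measure (Fin m → ℂ × ℂ))

/-- first coordinate map -/
def cA1 (m : ℕ) : (Fin (2 * m + 3) → ℂ) →ₗ[ℂ] (ℂ × (Fin (m + 1) → ℂ)) × (Fin (m + 1) → ℂ) where
  toFun z := ((z 0, fun i => z ⟨2 * i + 1, by omega⟩), fun i => z ⟨2 * i + 2, by omega⟩)
  map_add' _ _ := rfl
  map_smul' _ _ := rfl

/-- second coordinate map -/
def cA2 (m : ℕ) : (Fin (2 * m + 3) → ℂ) →ₗ[ℂ] ((ℂ × ℂ) × ℂ) × (Fin m → ℂ × ℂ) where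
  toFun z := (((z 0, z ⟨1, by omega⟩), z ⟨2, by omega⟩),
    fun i => (z ⟨2 * i + 3, by omega⟩, z ⟨2 * i + 4, by omega⟩))
  map_add' _ _ := rfl
  map_smul' _ _ := rfl

lemma cA1_inj (m : ℕ) : Function.Injective (cA1 m) := by
  intro z w h
  simp only [cA1, LinearMap.coe_mk, AddHom.coe_mk, Prod.mk.injEq] at h
  obtain ⟨⟨h0, h1⟩, h2⟩ := h
  ext ⟨j, hj⟩
  rcases Nat.eq_zero_or_pos j with rfl | hj0
  · exact h0
  rcases Nat.even_or_odd' j with ⟨k, rfl | rfl⟩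
  · obtain ⟨k, rfl⟩ : ∃ i, k = i + 1 := ⟨k - 1, by omega⟩
    exact congrFun h2 ⟨k, by omega⟩
  · exact congrFun h1 ⟨k, by omega⟩

lemma cA2_inj (m : ℕ) : Function.Injective (cA2 m) := by
  intro z w h
  simp only [cA2, LinearMap.coe_mk, AddHom.coe_mk, Prod.mk.injEq] at h
  obtain ⟨⟨⟨h0, h1⟩, h2⟩, h3⟩ := h
  ext ⟨j, hj⟩
  rcases Nat.lt_or_ge j 3 with h | h
  · interval_cases j
    · exact h0
    · exact h1
    · exact h2
  rcases Nat.even_or_odd' j with ⟨k, rfl | rfl⟩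
  · obtain ⟨k, rfl⟩ : ∃ i, k = i + 2 := ⟨k - 2, by omega⟩
    exact (Prod.mk.inj (congrFun h3 ⟨k, by omega⟩)).2
  · obtain ⟨k, rfl⟩ : ∃ i, k = i + 1 := ⟨k - 1, by omega⟩
    exact (Prod.mk.inj (congrFun h3 ⟨k, by omega⟩)).1

lemma exists_A1 (m : ℕ) : ∃ A : (Fin (2 * m + 3) → ℂ) ≃L[ℝ]
    (ℂ × (Fin (m + 1) → ℂ)) × (Fin (m + 1) → ℂ), ∀ z, A z = cA1 m z :=
  ⟨((LinearEquiv.ofInjectiveOfFinrankEq (cA1 m) (cA1_inj m)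
    (by simp; omega)).restrictScalars ℝ).toContinuousLinearEquiv, fun _ => rfl⟩

lemma exists_A2 (m : ℕ) : ∃ A : (Fin (2 * m + 3) → ℂ) ≃L[ℝ]
    ((ℂ × ℂ) × ℂ) × (Fin m → ℂ × ℂ), ∀ z, A z = cA2 m z :=
  ⟨((LinearEquiv.ofInjectiveOfFinrankEq (cA2 m) (cA2_inj m)
    (by simp [Module.finrank_pi_fintype]; omega)).restrictScalars ℝ).toContinuousLinearEquiv,
    fun _ => rfl⟩

lemma splitQ_one (m : ℕ) (z : Fin (2 * m + 3) → ℂ) : splitQC (2 * m + 3) z =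
    (cA1 m z).1.1 ^ 2 + ∑ i, (cA1 m z).1.2 i * (cA1 m z).2 i := by
  have h1 : ¬ Even (2 * m + 3) := by rw [Nat.not_even_iff_odd]; exact ⟨m + 1, by ring⟩
  rw [splitQC, if_neg h1, show (2 * m + 3) / 2 = m + 1 by omega, Finset.sum_range]
  congr 1
  refine Finset.sum_congr rfl fun i _ => ?_
  rw [padC, padC, dif_pos (by omega), dif_pos (by omega)]
  rfl

lemma splitQ_two (m : ℕ) (z : Fin (2 * m + 3) → ℂ) : splitQC (2 * m + 3) z =
    (cA2 m z).1.1.1 ^ 2 + (cA2 m z).1.1.2 * (cA2 m z).1.2 +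
      ∑ i, ((cA2 m z).2 i).1 * ((cA2 m z).2 i).2 := by
  rw [splitQ_one, Fin.sum_univ_succ, add_assoc]
  rfl

lemma splitQ_meas (m : ℕ) : Measurable (splitQC (2 * m + 3)) := by
  rw [show splitQC (2 * m + 3) = _ from funext (splitQ_one m)]
  simp only [cA1, LinearMap.coe_mk, AddHom.coe_mk]
  fun_prop

/-- reordering of coordinates -/
def reord : (ℂ × ℂ × ℂ) ≃L[ℝ] (ℂ × ℂ) × ℂ :=
  ((ContinuousLinearEquiv.refl ℝ ℂ).prodCongr (ContinuousLinearEquiv.prodComm ℝ ℂ ℂ)).trans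
    (ContinuousLinearEquiv.prodAssoc ℝ ℂ ℂ ℂ).symm

lemma reord_apply (u b t : ℂ) : reord (u, b, t) = ((u, t), b) := rfl

/-- transport along the reordering -/
def toThree (Φ' : 𝓢((ℂ × ℂ) × ℂ, ℂ)) : 𝓢(ℂ × ℂ × ℂ, ℂ) :=
  SchwartzMap.compCLMOfContinuousLinearEquiv ℂ reord Φ'

/-- transport along the reordering -/
def ofThree (Φ₂ : 𝓢(ℂ × ℂ × ℂ, ℂ)) : 𝓢((ℂ × ℂ) × ℂ, ℂ) :=
  SchwartzMap.compCLMOfContinuousLinearEquiv ℂ reord.symm Φ₂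

lemma toThree_eq (Φ' : 𝓢((ℂ × ℂ) × ℂ, ℂ)) (u b t : ℂ) :
    toThree Φ' (u, b, t) = Φ' ((u, t), b) := rfl

lemma ofThree_eq (Φ₂ : 𝓢(ℂ × ℂ × ℂ, ℂ)) (u b t : ℂ) :
    Φ₂ (u, b, t) = ofThree Φ₂ ((u, t), b) := rfl

lemma main_one (m : ℕ) (Φ : 𝓢(Fin (2 * m + 3) → ℂ, ℂ)) : ∃ Φ₂ : 𝓢(ℂ × ℂ × ℂ, ℂ),
    ∀ g : ℂ → ℂ, Continuous g → HasCompactSupport g →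
      ∫ z, g (splitQC (2 * m + 3) z) * Φ z = ∫ ξ, g ξ * hThreeC (2 * m + 3) Φ₂ ξ := by
  obtain ⟨A, hA⟩ := exists_A1 m
  obtain ⟨c, hc0, hc⟩ := change_var A
  obtain ⟨Φ', hΦ'⟩ := core_one m (c • SchwartzMap.compCLMOfContinuousLinearEquiv ℂ A.symm Φ)
  refine ⟨toThree Φ', fun g hg hgc => ?_⟩
  refine density_lemma _ Φ.integrable _ (splitQ_meas m) _
    (hThree_integrable m _ Φ' (toThree_eq Φ')) (fun l => ?_) g hg hgc
  rw [hThree_fourier m _ Φ' (toThree_eq Φ'), ← hΦ' l]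
  have e : ∀ z, ch (l * splitQC (2 * m + 3) z) * Φ z =
      (fun p : (ℂ × (Fin (m + 1) → ℂ)) × (Fin (m + 1) → ℂ) =>
        ch (l * (p.1.1 ^ 2 + ∑ i, p.1.2 i * p.2 i)) * Φ (A.symm p)) (A z) := by
    intro z
    beta_reduce
    rw [A.symm_apply_apply, hA, splitQ_one]
  rw [integral_congr_ae (ae_of_all _ e)]
  refine (hc (fun p => ch (l * (p.1.1 ^ 2 + ∑ i, p.1.2 i * p.2 i)) * Φ (A.symm p))).trans ?_
  rw [← integral_const_mul]
  congr 1
  ext1 p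
  rw [mul_left_comm]
  rfl

lemma main_two (m : ℕ) (Φ₂ : 𝓢(ℂ × ℂ × ℂ, ℂ)) : ∃ Φ : 𝓢(Fin (2 * m + 3) → ℂ, ℂ),
    ∀ g : ℂ → ℂ, Continuous g → HasCompactSupport g →
      ∫ z, g (splitQC (2 * m + 3) z) * Φ z = ∫ ξ, g ξ * hThreeC (2 * m + 3) Φ₂ ξ := by
  obtain ⟨A, hA⟩ := exists_A2 m
  obtain ⟨c, hc0, hc⟩ := change_var A
  obtain ⟨Φ, hΦ⟩ := core_two m (ofThree Φ₂)
  refine ⟨c⁻¹ • SchwartzMap.compCLMOfContinuousLinearEquiv ℂ A Φ, fun g hg hgc => ?_⟩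
  refine density_lemma _ (SchwartzMap.integrable _) _ (splitQ_meas m) _
    (hThree_integrable m _ _ (ofThree_eq Φ₂)) (fun l => ?_) g hg hgc
  rw [hThree_fourier m _ _ (ofThree_eq Φ₂), ← hΦ l]
  have e : ∀ z, ch (l * splitQC (2 * m + 3) z) *
      (c⁻¹ • SchwartzMap.compCLMOfContinuousLinearEquiv ℂ A Φ) z =
      c⁻¹ * (fun p : ((ℂ × ℂ) × ℂ) × (Fin m → ℂ × ℂ) =>
        ch (l * (p.1.1.1 ^ 2 + p.1.1.2 * p.1.2 + ∑ i, (p.2 i).1 * (p.2 i).2)) * Φ p) (A z) := by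
    intro z
    change _ * (c⁻¹ * Φ (A z)) = _
    simp only [hA, splitQ_two]
    ring
  rw [integral_congr_ae (ae_of_all _ e), integral_const_mul]
  refine (congrArg (c⁻¹ * ·) (hc (fun p =>
    ch (l * (p.1.1.1 ^ 2 + p.1.1.2 * p.1.2 + ∑ i, (p.2 i).1 * (p.2 i).2)) * Φ p))).trans ?_
  beta_reduce
  rw [← mul_assoc, inv_mul_cancel₀ hc0, one_mul]

end PF

/-- complex, odd-dimensional case of the reduction of pushforwards under
the split quadratic form in `d` variables to twisted pushforwards in `3` variables. -/
theorem pushforward_eq_twisted_pushforward_complex_odd (d : ℕ) (hd : 3 ≤ d) (hdo : Odd d) :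
    (∀ Φ₂ : SchwartzMap (ℂ × ℂ × ℂ) ℂ,
      (∀ ξ : ℂ, ξ ≠ 0 → IntegrableOn
          (fun q : ℂ × ℂ =>
            Φ₂ (q.2, (ξ - q.2 ^ 2) / q.1, q.1) * ((‖q.1‖ ^ ((d : ℝ) - 5) : ℝ) : ℂ))
          (({0}ᶜ : Set ℂ) ×ˢ (Set.univ : Set ℂ))) ∧
      LocallyIntegrable (hThreeC d Φ₂) volume) ∧
    (∀ Φ : SchwartzMap (Fin d → ℂ) ℂ, ∃ Φ₂ : SchwartzMap (ℂ × ℂ × ℂ) ℂ,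
      ∀ g : ℂ → ℂ, Continuous g → HasCompactSupport g →
        ∫ z : Fin d → ℂ, g (splitQC d z) * Φ z = ∫ ξ : ℂ, g ξ * hThreeC d Φ₂ ξ) ∧
    (∀ Φ₂ : SchwartzMap (ℂ × ℂ × ℂ) ℂ, ∃ Φ : SchwartzMap (Fin d → ℂ) ℂ,
      ∀ g : ℂ → ℂ, Continuous g → HasCompactSupport g →
        ∫ z : Fin d → ℂ, g (splitQC d z) * Φ z = ∫ ξ : ℂ, g ξ * hThreeC d Φ₂ ξ) := by
  obtain ⟨k, rfl⟩ := hdo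
  obtain ⟨m, rfl⟩ : ∃ m, k = m + 1 := ⟨k - 1, by omega⟩
  rw [show 2 * (m + 1) + 1 = 2 * m + 3 by ring]
  refine ⟨fun Φ₂ => ⟨fun ξ _ => (PF.part1 m Φ₂ ξ).integrableOn, ?_⟩, PF.main_one m, PF.main_two m⟩
  exact (PF.hThree_integrable m Φ₂ _ (PF.ofThree_eq Φ₂)).locallyIntegrable
end
end
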